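/- Let n ≥ 1, let F, F₀ satisfy (H0) and (H1) on B₁ ⊂ ℝ^{n+1}, and let u be a Lipschitz solution of the thin obstacle problem in B₁. Then u ∈ C¹(B₁⁺ ∪ B₁') ∩ C¹(B₁⁻ ∪ B₁'): u is continuously differentiable in each open half-ball B₁⁺ and B₁⁻, and the gradient ∇u extends from B₁⁺ to a continuous map on B₁⁺ ∪ B₁' and from B₁⁻ to a continuous map on B₁⁻ ∪ B₁'. -/

import Mathlib

open MeasureTheory Metric Filter
open scoped InnerProductSpace NNReal ENNReal Topology

noncomputable section

/-- Euclidean space `ℝ^{n+1}`. -/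
abbrev Eucl (n : ℕ) : Type := EuclideanSpace ℝ (Fin (n + 1))

namespace TOP

variable {n : ℕ}

/-- The `(n+1)`-st standard basis vector `e_{n+1}`. -/
def eLast (n : ℕ) : Eucl n := EuclideanSpace.single (Fin.last n) 1

/-- Open upper half ball `B_r⁺(x₀)`. -/
def hBall (x₀ : Eucl n) (r : ℝ) : Set (Eucl n) :=
  Metric.ball x₀ r ∩ {x : Eucl n | 0 < x (Fin.last n)}

/-- Open lower half ball `B_r⁻(x₀)`. -/
def hBallNeg (x₀ : Eucl n) (r : ℝ) : Set (Eucl n) :=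
  Metric.ball x₀ r ∩ {x : Eucl n | x (Fin.last n) < 0}

/-- Thin ball `B_r'(x₀)`. -/
def tBall (x₀ : Eucl n) (r : ℝ) : Set (Eucl n) :=
  Metric.ball x₀ r ∩ {x : Eucl n | x (Fin.last n) = 0}

/-- (H0): `F` and `F₀` are of class `C¹` on `B₁ × ℝ × ℝ^{n+1}`. -/
def H0 (F : Eucl n → ℝ → Eucl n → Eucl n) (F₀ : Eucl n → ℝ → Eucl n → ℝ) : Prop :=
  ContDiffOn ℝ 1 (fun q : Eucl n × ℝ × Eucl n => F q.1 q.2.1 q.2.2)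
      (Metric.ball (0 : Eucl n) 1 ×ˢ (Set.univ : Set ℝ) ×ˢ (Set.univ : Set (Eucl n))) ∧
    ContDiffOn ℝ 1 (fun q : Eucl n × ℝ × Eucl n => F₀ q.1 q.2.1 q.2.2)
      (Metric.ball (0 : Eucl n) 1 ×ˢ (Set.univ : Set ℝ) ×ˢ (Set.univ : Set (Eucl n)))

/-- (H1): uniform ellipticity of `D_pF` on compact subsets. -/
def H1 (F : Eucl n → ℝ → Eucl n → Eucl n) : Prop :=
  ∀ M : ℝ, 0 < M → ∃ lam : ℝ, 0 < lam ∧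
    ∀ x ∈ Metric.ball (0 : Eucl n) 1, ∀ z : ℝ, |z| ≤ M → ∀ p : Eucl n, ‖p‖ ≤ M →
      ∀ ξ : Eucl n, lam * ‖ξ‖ ^ 2 ≤ ⟪fderiv ℝ (F x z) p ξ, ξ⟫_ℝ

/-- (H1) with a prescribed ellipticity function `lam : M ↦ λ(M)`. -/
def H1With (lam : ℝ → ℝ) (F : Eucl n → ℝ → Eucl n → Eucl n) : Prop :=
  ∀ M : ℝ, 0 < M → 0 < lam M ∧
    ∀ x ∈ Metric.ball (0 : Eucl n) 1, ∀ z : ℝ, |z| ≤ M → ∀ p : Eucl n, ‖p‖ ≤ M →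
      ∀ ξ : Eucl n, lam M * ‖ξ‖ ^ 2 ≤ ⟪fderiv ℝ (F x z) p ξ, ξ⟫_ℝ

/-- `div_x F (x, z, p) = ∑ᵢ ∂_{xᵢ} Fᵢ (x, z, p)`. -/
def divx (F : Eucl n → ℝ → Eucl n → Eucl n) (x : Eucl n) (z : ℝ) (p : Eucl n) : ℝ :=
  ∑ i : Fin (n + 1), fderiv ℝ (fun y : Eucl n => F y z p i) x (EuclideanSpace.single i 1)

/-- `(F, F₀)` is `t`-rescaled with bound function `L : M ↦ L(M)`. -/
def Rescaled (t : ℝ) (L : ℝ → ℝ) (F : Eucl n → ℝ → Eucl n → Eucl n)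
    (F₀ : Eucl n → ℝ → Eucl n → ℝ) : Prop :=
  ∀ M : ℝ, 0 < M → ∀ x ∈ Metric.ball (0 : Eucl n) 1, ∀ z : ℝ, |z| ≤ M →
    ∀ p : Eucl n, ‖p‖ ≤ M →
      |(- divx F x z p - ⟪deriv (fun s : ℝ => F x s p) z, p⟫_ℝ + F₀ x z p)| ≤ t * L M ∧
        ‖fderiv ℝ (F x z) p‖ ≤ L M

/-- The operator `H_t` acting classically on a `C²` function `φ`:
`H_t(φ)(x) = −div_x F − ⟨∂_z F, ∇φ⟩ − tr(D_pF · D²φ) + F₀`, all evaluated at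
`(x, φ(x), ∇φ(x))`. -/
def Hop (F : Eucl n → ℝ → Eucl n → Eucl n) (F₀ : Eucl n → ℝ → Eucl n → ℝ)
    (φ : Eucl n → ℝ) (x : Eucl n) : ℝ :=
  - divx F x (φ x) (gradient φ x)
    - ⟪deriv (fun s : ℝ => F x s (gradient φ x)) (φ x), gradient φ x⟫_ℝ
    - ∑ i : Fin (n + 1),
        ⟪fderiv ℝ (F x (φ x)) (gradient φ x)
          (fderiv ℝ (gradient φ) x (EuclideanSpace.single i 1)), EuclideanSpace.single i 1⟫_ℝ
    + F₀ x (φ x) (gradient φ x)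

/-- The admissible class `A_g` for the thin obstacle problem: `W^{1,∞}(B₁)` functions
with boundary value `g` on `∂B₁` which are nonnegative on `B₁'`. -/
def AdmissibleThin (g v : Eucl n → ℝ) : Prop :=
  (∃ C : ℝ≥0, LipschitzOnWith C v (Metric.closedBall (0 : Eucl n) 1)) ∧
    (∀ x ∈ Metric.sphere (0 : Eucl n) 1, v x = g x) ∧
    ∀ x ∈ tBall (0 : Eucl n) 1, 0 ≤ v x

/-- A (Lipschitz) solution of the thin obstacle problem in `B₁`. -/
def ThinSolution (F : Eucl n → ℝ → Eucl n → Eucl n) (F₀ : Eucl n → ℝ → Eucl n → ℝ)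
    (g u : Eucl n → ℝ) : Prop :=
  AdmissibleThin g u ∧
    ∀ v : Eucl n → ℝ, AdmissibleThin g v →
      0 ≤ ∫ x in Metric.ball (0 : Eucl n) 1,
        (⟪F x (u x) (gradient u x), gradient v x - gradient u x⟫_ℝ +
          F₀ x (u x) (gradient u x) * (v x - u x))

/-- The admissible class `A_g` for the boundary (Signorini) obstacle problem:
`W^{1,∞}(B₁⁺)` functions with boundary value `g` on `∂B₁⁺ ∖ B₁'` which are
nonnegative on `B₁'`. -/
def AdmissibleBdry (g v : Eucl n → ℝ) : Prop :=
  (∃ C : ℝ≥0, LipschitzOnWith C v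
      (Metric.closedBall (0 : Eucl n) 1 ∩ {x : Eucl n | 0 ≤ x (Fin.last n)})) ∧
    (∀ x : Eucl n, ‖x‖ = 1 → 0 ≤ x (Fin.last n) → v x = g x) ∧
    ∀ x ∈ tBall (0 : Eucl n) 1, 0 ≤ v x

/-- A (Lipschitz) solution of the boundary (Signorini) obstacle problem in `B₁⁺`. -/
def BdrySolution (F : Eucl n → ℝ → Eucl n → Eucl n) (F₀ : Eucl n → ℝ → Eucl n → ℝ)
    (g u : Eucl n → ℝ) : Prop :=
  AdmissibleBdry g u ∧
    ∀ v : Eucl n → ℝ, AdmissibleBdry g v →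
      0 ≤ ∫ x in hBall (0 : Eucl n) 1,
        (⟪F x (u x) (gradient u x), gradient v x - gradient u x⟫_ℝ +
          F₀ x (u x) (gradient u x) * (v x - u x))

/-- The coincidence set `Λ(u) = {x ∈ B₁' : u(x) = 0}`. -/
def coincidenceSet (u : Eucl n → ℝ) : Set (Eucl n) :=
  {x ∈ tBall (0 : Eucl n) 1 | u x = 0}

/-- The free boundary `Γ(u)`: the boundary of `Λ(u)` in the relative topology of `B₁'`. -/
def freeBoundary (u : Eucl n → ℝ) : Set (Eucl n) :=
  {x ∈ coincidenceSet u |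
    ∀ r : ℝ, 0 < r → ∃ y ∈ tBall (0 : Eucl n) 1, y ∈ Metric.ball x r ∧ 0 < u y}

/-- `w` satisfies the Caccioppoli inequality with constant `Q` at `x₀ ∈ B₁'`. -/
def CaccAt (w : Eucl n → ℝ) (Q : ℝ) (x₀ : Eucl n) : Prop :=
  ∀ k : ℝ, 0 ≤ k → ∀ r R : ℝ, 0 < r → r < R → R < 1 - ‖x₀‖ →
    (∫ x in ({x : Eucl n | k ≤ w x} ∩ hBall x₀ r), ‖gradient w x‖ ^ 2) ≤
      Q / (R - r) ^ 2 * (∫ x in ({x : Eucl n | k ≤ w x} ∩ hBall x₀ R), (w x - k) ^ 2) +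
        Q * (volume ({x : Eucl n | k ≤ w x} ∩ hBall x₀ R)).toReal

/-- Difference quotient `D_e^h w (x) = (w(x + h e) − w(x))/h`. -/
def diffQuot (h : ℝ) (e : Eucl n) (w : Eucl n → ℝ) (x : Eucl n) : ℝ :=
  (w (x + h • e) - w x) / h

/-- The barrier function `η(x) = t(|x' − x₀'|² − K x_{n+1}²) + m x_{n+1} + γ`. -/
def etaFn (x₀ : Eucl n) (t K m γ : ℝ) (x : Eucl n) : ℝ :=
  t * ((∑ i : Fin n, (x i.castSucc - x₀ i.castSucc) ^ 2) - K * (x (Fin.last n)) ^ 2) +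
    m * x (Fin.last n) + γ

lemma norm_gradient_eq (f : Eucl n → ℝ) (x : Eucl n) : ‖gradient f x‖ = ‖fderiv ℝ f x‖ := by
  simp [gradient]

lemma inner_gradient (f : Eucl n → ℝ) (x v : Eucl n) : ⟪gradient f x, v⟫_ℝ = fderiv ℝ f x v := by
  simp [gradient]

lemma measurable_gradient (f : Eucl n → ℝ) : Measurable (gradient f) :=
  ((InnerProductSpace.toDual ℝ (Eucl n)).symm.continuous.measurable).comp (measurable_fderiv ℝ f)

lemma _root_.LipschitzWith.norm_gradient_le {C : ℝ≥0} {f : Eucl n → ℝ} (hf : LipschitzWith C f)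
    (x : Eucl n) : ‖gradient f x‖ ≤ C := by
  rw [norm_gradient_eq]; exact norm_fderiv_le_of_lipschitz ℝ hf

lemma _root_.LipschitzWith.abs_sub_le {C : ℝ≥0} {f : Eucl n → ℝ} (hf : LipschitzWith C f)
    (x y : Eucl n) : |f x - f y| ≤ C * ‖x - y‖ := by
  have := hf.dist_le_mul x y
  rwa [Real.dist_eq, dist_eq_norm] at this

lemma abs_integrableOn_of_bound {S : Set (Eucl n)} {f : Eucl n → ℝ} {C : ℝ}
    (hf : Measurable f) (hS : volume S ≠ ∞) (h : ∀ x, |f x| ≤ C) :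
    IntegrableOn f S := by
  refine Measure.integrableOn_of_bounded (M := C) hS hf.aestronglyMeasurable ?_
  exact Eventually.of_forall fun x => h x

/-- Translations of a Lipschitz function inside a convex set are controlled by its gradient. -/
lemma setIntegral_abs_translate_le {C : ℝ≥0} {f : Eucl n → ℝ} (hf : LipschitzWith C f)
    {S : Set (Eucl n)} (hS : Convex ℝ S) (hSm : MeasurableSet S) (hSf : volume S ≠ ∞)
    (v : Eucl n) :
    ∫ x in S ∩ (fun x => x + v) ⁻¹' S, |f (x + v) - f x| ≤ ‖v‖ * ∫ x in S, ‖gradient f x‖ := by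
  set T := S ∩ (fun x => x + v) ⁻¹' S with hT
  have hTm : MeasurableSet T := hSm.inter ((measurable_add_const v) hSm)
  have hfm : Measurable f := hf.continuous.measurable
  have key : ∀ m : ℕ, 0 < m → ∫ x in T, |f (x + v) - f x| ≤
      ∫ x in S, (m : ℝ) * |f (x + (1 / (m : ℝ)) • v) - f x| := by
    intro m hm
    have hm' : (0 : ℝ) < m := by exact_mod_cast hm
    have h_int : ∀ (a b : Eucl n) (U : Set (Eucl n)), volume U ≠ ∞ →
        IntegrableOn (fun x => |f (x + a) - f (x + b)|) U := by
      intro a b U hU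
      refine abs_integrableOn_of_bound (C := C * ‖a - b‖) ?_ hU ?_
      · exact ((hfm.comp (measurable_add_const a)).sub (hfm.comp (measurable_add_const b))).abs
      · intro x
        rw [abs_abs]
        simpa using hf.abs_sub_le (x + a) (x + b)
    have hTfin : volume T ≠ ∞ := ne_top_of_le_ne_top hSf (measure_mono Set.inter_subset_left)
    have h1 : ∀ x, |f (x + v) - f x| ≤ ∑ i ∈ Finset.range m,
        |f (x + ((i + 1 : ℕ) / (m : ℝ)) • v) - f (x + ((i : ℕ) / (m : ℝ)) • v)| := by
      intro x
      have := Finset.sum_range_sub (fun i : ℕ => f (x + ((i : ℕ) / (m : ℝ)) • v)) m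
      simp only [Nat.cast_zero, zero_div, zero_smul, add_zero, div_self hm'.ne', one_smul] at this
      rw [← this]
      exact Finset.abs_sum_le_sum_abs _ _
    have hterm : ∀ i ∈ Finset.range m, ∫ x in T,
        |f (x + ((i + 1 : ℕ) / (m : ℝ)) • v) - f (x + ((i : ℕ) / (m : ℝ)) • v)| ≤
        ∫ x in S, |f (x + (1 / (m : ℝ)) • v) - f x| := by
      intro i hi
      have hi' : (i : ℝ) ≤ m := by exact_mod_cast (Finset.mem_range.1 hi).le
      set a := ((i : ℕ) / (m : ℝ)) • v with ha
      set U := Set.image (fun x => x + a) T with hU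
      have hUS : U ⊆ S := by
        rintro _ ⟨x, ⟨hx1, hx2⟩, rfl⟩
        have h0 : (0 : ℝ) ≤ i / m := by positivity
        have h2 : (i : ℝ) / m ≤ 1 := by rw [div_le_one hm']; exact hi'
        have := hS hx1 hx2 (sub_nonneg.2 h2) h0 (by ring)
        convert this using 1
        simp only [ha]; module
      have heq : ∫ x in T,
        |f (x + ((i + 1 : ℕ) / (m : ℝ)) • v) - f (x + a)| =
          ∫ x in U, |f (x + (1 / (m : ℝ)) • v) - f x| := by
        rw [hU, (measurePreserving_add_right volume a).setIntegral_image_emb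
          (measurableEmbedding_addRight a)]
        refine setIntegral_congr_fun hTm fun x _ => ?_
        have : x + ((i + 1 : ℕ) / (m : ℝ)) • v = x + a + (1 / (m : ℝ)) • v := by
          simp only [ha, Nat.cast_add, Nat.cast_one]; module
        simp only [this]
      rw [heq]
      refine setIntegral_mono_set ?_ ?_ ?_
      · simpa using h_int ((1 / (m : ℝ)) • v) 0 S hSf
      · exact Eventually.of_forall fun x => abs_nonneg _
      · exact LE.le.eventuallyLE hUS
    calc ∫ x in T, |f (x + v) - f x| ≤ ∫ x in T, ∑ i ∈ Finset.range m,
        |f (x + ((i + 1 : ℕ) / (m : ℝ)) • v) - f (x + ((i : ℕ) / (m : ℝ)) • v)| := by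
          refine integral_mono ?_ ?_ h1
          · have := h_int v 0 T hTfin
            simp only [add_zero] at this
            exact this
          · exact integrable_finsetSum _ fun i _ => h_int _ _ T hTfin
      _ = ∑ i ∈ Finset.range m, ∫ x in T,
        |f (x + ((i + 1 : ℕ) / (m : ℝ)) • v) - f (x + ((i : ℕ) / (m : ℝ)) • v)| :=
          integral_finsetSum _ fun i _ => h_int _ _ T hTfin
      _ ≤ ∑ i ∈ Finset.range m, ∫ x in S, |f (x + (1 / (m : ℝ)) • v) - f x| :=
          Finset.sum_le_sum hterm
      _ = _ := by
          rw [integral_const_mul]; simp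
  have hlim : Tendsto (fun m : ℕ => ∫ x in S, (m : ℝ) * |f (x + (1 / (m : ℝ)) • v) - f x|) atTop
      (𝓝 (∫ x in S, |fderiv ℝ f x v|)) := by
    refine tendsto_integral_of_dominated_convergence (fun _ => C * ‖v‖) ?_ ?_ ?_ ?_
    · intro m
      exact (measurable_const.mul
        ((hfm.comp (measurable_add_const _)).sub hfm).abs).aestronglyMeasurable
    · exact integrableOn_const hSf
    · intro m
      refine Eventually.of_forall fun x => ?_
      rcases Nat.eq_zero_or_pos m with rfl | hm
      · simp; positivity
      have hm' : (0 : ℝ) < m := by exact_mod_cast hm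
      have := hf.abs_sub_le (x + (1 / (m : ℝ)) • v) x
      rw [add_sub_cancel_left, norm_smul, Real.norm_of_nonneg (by positivity)] at this
      rw [Real.norm_of_nonneg (by positivity)]
      calc (m : ℝ) * |f (x + (1 / (m : ℝ)) • v) - f x| ≤ m * (C * (1 / m * ‖v‖)) := by gcongr
        _ = _ := by field_simp
    · refine ae_restrict_of_ae ?_
      filter_upwards [hf.ae_differentiableAt] with x hx
      have h1 := (hx.hasFDerivAt.hasLineDerivAt v)
      have h2 := h1.tendsto_slope_zero
      have h3 : Tendsto (fun m : ℕ => (1 : ℝ) / m) atTop (𝓝[≠] 0) := by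
        refine tendsto_nhdsWithin_iff.2 ⟨tendsto_one_div_atTop_nhds_zero_nat, ?_⟩
        filter_upwards [eventually_gt_atTop 0] with m hm
        have hm' : (0 : ℝ) < m := by exact_mod_cast hm
        simp [hm'.ne']
      have h4 := (h2.comp h3).abs
      refine h4.congr fun m => ?_
      simp [abs_mul]
  have h1 := ge_of_tendsto hlim (eventually_gt_atTop 0 |>.mono fun m hm => key m hm)
  refine h1.trans ?_
  rw [← integral_const_mul]
  refine integral_mono ?_ ?_ ?_
  · refine abs_integrableOn_of_bound (C := C * ‖v‖)
      (measurable_fderiv_apply_const ℝ f v).abs hSf fun x => ?_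
    rw [abs_abs]
    calc |fderiv ℝ f x v| ≤ ‖fderiv ℝ f x‖ * ‖v‖ := (fderiv ℝ f x).le_opNorm v
      _ ≤ _ := by gcongr; exact norm_fderiv_le_of_lipschitz ℝ hf
  · refine Integrable.const_mul ?_ _
    refine abs_integrableOn_of_bound (C := C) (measurable_gradient f).norm hSf fun x => ?_
    rw [abs_norm]; exact hf.norm_gradient_le x
  · intro x
    calc |fderiv ℝ f x v| ≤ ‖fderiv ℝ f x‖ * ‖v‖ := (fderiv ℝ f x).le_opNorm v
      _ = ‖v‖ * ‖gradient f x‖ := by rw [norm_gradient_eq]; ring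

lemma _root_.LipschitzWith.integrableOn_ball {C : ℝ≥0} {f : Eucl n → ℝ} (hf : LipschitzWith C f)
    (x₀ : Eucl n) (R : ℝ) : IntegrableOn f (ball x₀ R) :=
  (hf.continuous.continuousOn.integrableOn_compact (isCompact_closedBall x₀ R)).mono_set
    ball_subset_closedBall

lemma integrableOn_norm_gradient {C : ℝ≥0} {f : Eucl n → ℝ} (hf : LipschitzWith C f)
    (x₀ : Eucl n) (R : ℝ) : IntegrableOn (fun x => ‖gradient f x‖) (ball x₀ R) := by
  refine abs_integrableOn_of_bound (C := C) (measurable_gradient f).norm measure_ball_lt_top.ne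
    fun x => ?_
  rw [abs_norm]; exact hf.norm_gradient_le x

/-- If every point where `f ≠ 0` sees many zeros of `f`, then the mean of `f` is controlled by
its gradient. -/
lemma mul_setIntegral_le_of_zeros {C : ℝ≥0} {f : Eucl n → ℝ} (hf : LipschitzWith C f)
    (h0 : ∀ x, 0 ≤ f x) (x₀ : Eucl n) (R r : ℝ) (hr : 0 ≤ r) (m : ℝ) (hm : 0 ≤ m)
    (hz : ∀ x ∈ ball x₀ R, f x ≠ 0 →
      m ≤ volume.real {v : Eucl n | v ∈ ball 0 r ∧ x + v ∈ ball x₀ R ∧ f (x + v) = 0}) :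
    m * ∫ x in ball x₀ R, f x ≤
      r * volume.real (ball (0 : Eucl n) r) * ∫ x in ball x₀ R, ‖gradient f x‖ := by
  set S := ball x₀ R with hS
  set V := ball (0 : Eucl n) r with hV
  have hfm : Measurable f := hf.continuous.measurable
  set Z : Set (Eucl n) := {y | y ∈ S ∧ f y = 0} with hZ
  have hZm : MeasurableSet Z := measurableSet_ball.inter (hfm (measurableSet_singleton 0))
  set g : Eucl n → Eucl n → ℝ≥0∞ := fun x v => ENNReal.ofReal (f x) * Z.indicator 1 (x + v) with hg
  have hgm : Measurable (Function.uncurry g) := by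
    refine Measurable.mul (hfm.comp measurable_fst).ennreal_ofReal ?_
    exact (measurable_one.indicator hZm).comp (measurable_fst.add measurable_snd)
  have hlow : ENNReal.ofReal (m * ∫ x in S, f x) ≤ ∫⁻ x in S, ∫⁻ v in V, g x v := by
    rw [ENNReal.ofReal_mul hm, ofReal_integral_eq_lintegral_ofReal (hf.integrableOn_ball x₀ R)
      (Eventually.of_forall h0), ← lintegral_const_mul _ hfm.ennreal_ofReal]
    refine setLIntegral_mono' measurableSet_ball fun x hx => ?_
    have e0 : ∫⁻ v in V, g x v =
        ENNReal.ofReal (f x) * ∫⁻ v in V, Z.indicator (1 : Eucl n → ℝ≥0∞) (x + v) :=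
      lintegral_const_mul _ ((measurable_one.indicator hZm).comp (measurable_const_add x))
    rw [e0, mul_comm]
    by_cases hfx : f x = 0
    · simp [hfx]
    gcongr
    have := hz x hx hfx
    have e : ∫⁻ v in V, Z.indicator (1 : Eucl n → ℝ≥0∞) (x + v) =
        volume {v : Eucl n | v ∈ ball 0 r ∧ x + v ∈ ball x₀ R ∧ f (x + v) = 0} := by
      have h1 : (fun v => Z.indicator (1 : Eucl n → ℝ≥0∞) (x + v)) =
          ((fun v => x + v) ⁻¹' Z).indicator 1 := by
        rfl
      rw [h1, lintegral_indicator_one ((measurable_const_add x) hZm),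
        Measure.restrict_apply ((measurable_const_add x) hZm), Set.inter_comm]
      rfl
    rw [e]
    refine (ENNReal.ofReal_le_ofReal this).trans ?_
    rw [measureReal_def, ENNReal.ofReal_toReal]
    exact ne_top_of_le_ne_top measure_ball_lt_top.ne (measure_mono fun v hv => hv.1)
  have hup : ∫⁻ v in V, ∫⁻ x in S, g x v ≤
      ENNReal.ofReal (r * volume.real V * ∫ x in S, ‖gradient f x‖) := by
    have : ∀ v ∈ V, ∫⁻ x in S, g x v ≤ ENNReal.ofReal (r * ∫ x in S, ‖gradient f x‖) := by
      intro v hv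
      set T := S ∩ (fun x => x + v) ⁻¹' S with hT
      have hTm : MeasurableSet T := measurableSet_ball.inter
        ((measurable_add_const v) measurableSet_ball)
      have h1 : ∫⁻ x in S, g x v ≤ ∫⁻ x in T, ENNReal.ofReal |f (x + v) - f x| := by
        have hSm : MeasurableSet S := measurableSet_ball
        rw [← lintegral_indicator hSm, ← lintegral_indicator hTm]
        refine lintegral_mono fun x => ?_
        by_cases hxS : x ∈ S
        · by_cases hxZ : x + v ∈ Z
          · have hxT : x ∈ T := ⟨hxS, hxZ.1⟩
            simp only [Set.indicator_of_mem hxS, Set.indicator_of_mem hxT, hg,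
              Set.indicator_of_mem hxZ, hxZ.2]
            simp [abs_of_nonneg (h0 x)]
          · have : g x v = 0 := by simp only [hg, Set.indicator_of_notMem hxZ, mul_zero]
            rw [Set.indicator_of_mem hxS, this]; exact bot_le
        · rw [Set.indicator_of_notMem hxS]; exact bot_le
      refine h1.trans ?_
      have h2 : IntegrableOn (fun x => |f (x + v) - f x|) T := by
        refine abs_integrableOn_of_bound (C := C * ‖v‖)
          ((hfm.comp (measurable_add_const v)).sub hfm).abs
          (ne_top_of_le_ne_top measure_ball_lt_top.ne (measure_mono Set.inter_subset_left)) ?_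
        intro x
        rw [abs_abs]
        simpa using hf.abs_sub_le (x + v) x
      rw [← ofReal_integral_eq_lintegral_ofReal h2 (Eventually.of_forall fun x => abs_nonneg _)]
      refine ENNReal.ofReal_le_ofReal ?_
      refine (setIntegral_abs_translate_le hf (convex_ball x₀ R) measurableSet_ball
        measure_ball_lt_top.ne v).trans ?_
      have : ‖v‖ ≤ r := by simpa using (mem_ball_zero_iff.1 hv).le
      gcongr
    calc ∫⁻ v in V, ∫⁻ x in S, g x v
        ≤ ∫⁻ v in V, ENNReal.ofReal (r * ∫ x in S, ‖gradient f x‖) :=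
          setLIntegral_mono' measurableSet_ball this
      _ = ENNReal.ofReal (r * ∫ x in S, ‖gradient f x‖) * volume V := by simp
      _ = _ := by
          rw [mul_right_comm, ENNReal.ofReal_mul (p := r * ∫ x in S, ‖gradient f x‖)]
          · congr 1
            rw [measureReal_def, ENNReal.ofReal_toReal measure_ball_lt_top.ne]
          · exact mul_nonneg hr (integral_nonneg fun x => norm_nonneg _)
  have hswap : ∫⁻ x in S, ∫⁻ v in V, g x v = ∫⁻ v in V, ∫⁻ x in S, g x v :=
    lintegral_lintegral_swap hgm.aemeasurable
  rw [hswap] at hlow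
  refine (ENNReal.ofReal_le_ofReal_iff ?_).1 (hlow.trans hup)
  exact mul_nonneg (mul_nonneg hr measureReal_nonneg) (integral_nonneg fun x => norm_nonneg _)

lemma gradient_eq_zero_of_notMem {f : Eucl n → ℝ} {K : Set (Eucl n)} (hK : IsClosed K)
    (h : ∀ x ∉ K, f x = 0) {x : Eucl n} (hx : x ∉ K) : gradient f x = 0 := by
  have : f =ᶠ[𝓝 x] fun _ => 0 := by
    filter_upwards [hK.isOpen_compl.mem_nhds hx] with y hy using h y hy
  simp [gradient, this.fderiv_eq]

/-- A Sobolev inequality with a gain for functions of small support. -/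
lemma integral_le_of_small_support {C : ℝ≥0} {f : Eucl n → ℝ} (hf : LipschitzWith C f)
    (h0 : ∀ x, 0 ≤ f x) {x₀ : Eucl n} {R r : ℝ} (hr : 0 < r)
    (hsupp : ∀ x ∉ closedBall x₀ R, f x = 0)
    (hA : 2 * volume.real {x | f x ≠ 0} ≤ volume.real (ball (0 : Eucl n) r)) :
    ∫ x, f x ≤ 2 * r * ∫ x, ‖gradient f x‖ := by
  set S := ball x₀ (R + r) with hS
  set A := {x | f x ≠ 0} with hAdef
  have hfm : Measurable f := hf.continuous.measurable
  have hAm : MeasurableSet A := (hfm (measurableSet_singleton 0)).compl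
  have hAS : ∀ x, f x ≠ 0 → x ∈ closedBall x₀ R := fun x hx => by
    by_contra h; exact hx (hsupp x h)
  have hsub : closedBall x₀ R ⊆ S := closedBall_subset_ball (by linarith)
  have e1 : ∫ x, f x = ∫ x in S, f x := by
    symm; apply setIntegral_eq_integral_of_forall_compl_eq_zero
    intro x hx; exact hsupp x fun h => hx (hsub h)
  have e2 : ∫ x, ‖gradient f x‖ = ∫ x in S, ‖gradient f x‖ := by
    symm; apply setIntegral_eq_integral_of_forall_compl_eq_zero
    intro x hx
    rw [gradient_eq_zero_of_notMem isClosed_closedBall hsupp fun h => hx (hsub h), norm_zero]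
  rw [e1, e2]
  set V := volume.real (ball (0 : Eucl n) r) with hV
  have hVpos : 0 < V := by
    rw [hV, measureReal_def]
    exact ENNReal.toReal_pos (measure_ball_pos volume 0 hr).ne' measure_ball_lt_top.ne
  have hAfin : volume A ≠ ∞ := ne_top_of_le_ne_top measure_closedBall_lt_top.ne
    (measure_mono (fun x hx => hAS x hx : A ⊆ closedBall x₀ R))
  have := mul_setIntegral_le_of_zeros hf h0 x₀ (R + r) r hr.le (V / 2) (by positivity) ?_
  · have h3 : V * (∫ x in S, f x) ≤ V * (2 * r * ∫ x in S, ‖gradient f x‖) := by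
      linarith
    exact le_of_mul_le_mul_left h3 hVpos
  · intro x hx hfx
    have hsubset : ball (0 : Eucl n) r \ ((fun v => x + v) ⁻¹' A) ⊆
        {v : Eucl n | v ∈ ball 0 r ∧ x + v ∈ ball x₀ (R + r) ∧ f (x + v) = 0} := by
      rintro v ⟨hv, hvA⟩
      refine ⟨hv, ?_, by simpa [hAdef] using hvA⟩
      have h1 := mem_closedBall.1 (hAS x hfx)
      rw [mem_ball_zero_iff] at hv
      rw [mem_ball]
      calc dist (x + v) x₀ ≤ dist (x + v) x + dist x x₀ := dist_triangle _ _ _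
        _ = ‖v‖ + dist x x₀ := by simp
        _ < R + r := by linarith
    have h2 := measureReal_mono (μ := volume) hsubset
      (ne_top_of_le_ne_top measure_ball_lt_top.ne (measure_mono fun v hv => hv.1))
    refine le_trans ?_ h2
    have h3 := le_measureReal_sdiff (μ := volume) (s₁ := ball (0 : Eucl n) r)
      (s₂ := (fun v => x + v) ⁻¹' A) (by rw [measure_preimage_add]; exact hAfin)
    have h4 : volume.real ((fun v => x + v) ⁻¹' A) = volume.real A := by
      simp [measureReal_def, measure_preimage_add]
    rw [h4] at h3
    linarith

/-- Real-valued Lipschitz functions on `ℝ^{n+1}`, with unspecified constant. -/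
def IsLip (f : Eucl n → ℝ) : Prop := ∃ C : ℝ≥0, LipschitzWith C f

namespace IsLip
variable {f g : Eucl n → ℝ}

lemma continuous (hf : IsLip f) : Continuous f := hf.choose_spec.continuous

lemma measurable (hf : IsLip f) : Measurable f := hf.continuous.measurable

lemma of_abs_sub_le {C : ℝ} (h : ∀ x y, |f x - f y| ≤ C * ‖x - y‖) : IsLip f :=
  ⟨C.toNNReal, LipschitzWith.of_dist_le' fun x y => by
    rw [Real.dist_eq, dist_eq_norm]; exact h x y⟩

lemma exists_abs_sub_le (hf : IsLip f) : ∃ C : ℝ, 0 ≤ C ∧ ∀ x y, |f x - f y| ≤ C * ‖x - y‖ := by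
  obtain ⟨C, hC⟩ := hf
  exact ⟨C, C.2, hC.abs_sub_le⟩

lemma const (c : ℝ) : IsLip (fun _ : Eucl n => c) := ⟨0, LipschitzWith.const c⟩

lemma sub (hf : IsLip f) (hg : IsLip g) : IsLip fun x => f x - g x :=
  ⟨_, hf.choose_spec.sub hg.choose_spec⟩

lemma neg (hf : IsLip f) : IsLip fun x => - f x := ⟨_, hf.choose_spec.neg⟩

lemma max (hf : IsLip f) (hg : IsLip g) : IsLip fun x => max (f x) (g x) :=
  ⟨_, hf.choose_spec.max hg.choose_spec⟩

lemma min (hf : IsLip f) (hg : IsLip g) : IsLip fun x => min (f x) (g x) :=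
  ⟨_, hf.choose_spec.min hg.choose_spec⟩

lemma mul_of_bounded {A B : ℝ} (hf : IsLip f) (hg : IsLip g) (hA : ∀ x, |f x| ≤ A)
    (hB : ∀ x, f x ≠ 0 → |g x| ≤ B) : IsLip fun x => f x * g x := by
  obtain ⟨C, hC0, hC⟩ := hf.exists_abs_sub_le
  obtain ⟨D, hD0, hD⟩ := hg.exists_abs_sub_le
  have hA0 : 0 ≤ A := (abs_nonneg _).trans (hA 0)
  have key : ∀ x y, f x ≠ 0 → |f x * g x - f y * g y| ≤ (A * D + |B| * C) * ‖x - y‖ := by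
    intro x y hx
    have hb := (hB x hx).trans (le_abs_self B)
    calc |f x * g x - f y * g y| = |f y * (g x - g y) + g x * (f x - f y)| := by congr 1; ring
      _ ≤ |f y| * |g x - g y| + |g x| * |f x - f y| := by
          rw [← abs_mul, ← abs_mul]; exact abs_add_le _ _
      _ ≤ A * (D * ‖x - y‖) + |B| * (C * ‖x - y‖) := by
          gcongr
          exacts [hA y, hD x y, hC x y]
      _ = _ := by ring
  refine of_abs_sub_le (C := A * D + |B| * C) fun x y => ?_
  by_cases hx : f x = 0
  · by_cases hy : f y = 0
    · simp only [hx, hy, zero_mul, sub_self, abs_zero]; positivity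
    · rw [abs_sub_comm, norm_sub_rev]; exact key y x hy
  · exact key x y hx

lemma const_mul (hf : IsLip f) (c : ℝ) : IsLip fun x => c * f x := by
  obtain ⟨C, hC0, hC⟩ := hf.exists_abs_sub_le
  refine of_abs_sub_le (C := |c| * C) fun x y => ?_
  rw [← mul_sub, abs_mul, mul_assoc]
  gcongr
  exact hC x y

lemma comp_add (hf : IsLip f) (v : Eucl n) : IsLip fun x => f (x + v) := by
  obtain ⟨C, hC0, hC⟩ := hf.exists_abs_sub_le
  refine of_abs_sub_le (C := C) fun x y => ?_
  simpa using hC (x + v) (y + v)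

lemma mul_of_support {A : ℝ} (hf : IsLip f) (hg : IsLip g) (hA : ∀ x, |f x| ≤ A)
    {x₀ : Eucl n} {R : ℝ} (hB : ∀ x ∉ closedBall x₀ R, f x = 0) : IsLip fun x => f x * g x := by
  obtain ⟨B, hB'⟩ := (isCompact_closedBall x₀ R).exists_bound_of_continuousOn
    hg.continuous.continuousOn
  refine hf.mul_of_bounded hg hA (B := B) fun x hx => ?_
  exact hB' x (by by_contra h; exact hx (hB x h))

lemma exists_bound_of_support (hf : IsLip f) {x₀ : Eucl n} {R : ℝ}
    (hB : ∀ x ∉ closedBall x₀ R, f x = 0) : ∃ A, 0 ≤ A ∧ ∀ x, |f x| ≤ A := by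
  obtain ⟨B, hB'⟩ := (isCompact_closedBall x₀ R).exists_bound_of_continuousOn
    hf.continuous.continuousOn
  refine ⟨|B|, abs_nonneg _, fun x => ?_⟩
  by_cases hx : x ∈ closedBall x₀ R
  · exact (hB' x hx).trans (le_abs_self B)
  · rw [hB x hx]; simp

lemma exists_gradient_bound (hf : IsLip f) : ∃ C : ℝ, 0 ≤ C ∧ ∀ x, ‖gradient f x‖ ≤ C := by
  obtain ⟨C, hC⟩ := hf
  exact ⟨C, C.2, hC.norm_gradient_le⟩

lemma ae_differentiableAt (hf : IsLip f) : ∀ᵐ x, DifferentiableAt ℝ f x :=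
  hf.choose_spec.ae_differentiableAt

lemma integrableOn_ball (hf : IsLip f) (x₀ : Eucl n) (R : ℝ) : IntegrableOn f (ball x₀ R) :=
  hf.choose_spec.integrableOn_ball x₀ R

end IsLip

/-- Volume of the unit ball. -/
def omega (n : ℕ) : ℝ := volume.real (ball (0 : Eucl n) 1)

lemma omega_pos : 0 < omega n := by
  rw [omega, measureReal_def]
  exact ENNReal.toReal_pos (measure_ball_pos volume 0 one_pos).ne' measure_ball_lt_top.ne

lemma volume_real_ball (x : Eucl n) {r : ℝ} (hr : 0 ≤ r) :
    volume.real (ball x r) = r ^ (n + 1) * omega n := by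
  rw [omega, measureReal_def, measureReal_def, Measure.addHaar_ball _ _ hr, ENNReal.toReal_mul,
    ENNReal.toReal_ofReal (by positivity)]
  simp

/-- Standard Lipschitz cutoff between `ball x₀ r` and `ball x₀ s`. -/
def cutoff (x₀ : Eucl n) (r s : ℝ) (x : Eucl n) : ℝ :=
  max (min ((s - ‖x - x₀‖) * (s - r)⁻¹) 1) 0

section cutoff
variable {x₀ : Eucl n} {r s : ℝ}

lemma cutoff_nonneg (x) : 0 ≤ cutoff x₀ r s x := le_max_right _ _

lemma cutoff_le_one (x) : cutoff x₀ r s x ≤ 1 := max_le (min_le_right _ _) zero_le_one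

lemma abs_cutoff_le_one (x) : |cutoff x₀ r s x| ≤ 1 := by
  rw [abs_of_nonneg (cutoff_nonneg x)]; exact cutoff_le_one x

lemma cutoff_eq_one (hrs : r < s) {x} (hx : ‖x - x₀‖ ≤ r) : cutoff x₀ r s x = 1 := by
  have h : 1 ≤ (s - ‖x - x₀‖) * (s - r)⁻¹ := by
    rw [← div_eq_mul_inv, le_div_iff₀ (by linarith)]; linarith
  rw [cutoff, min_eq_right h, max_eq_left zero_le_one]

lemma cutoff_eq_zero (hrs : r < s) {x} (hx : s ≤ ‖x - x₀‖) : cutoff x₀ r s x = 0 := by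
  refine max_eq_right ((min_le_left _ _).trans ?_)
  exact mul_nonpos_of_nonpos_of_nonneg (by linarith) (inv_nonneg.2 (by linarith))

lemma cutoff_eq_zero_of_notMem (hrs : r < s) {x} (hx : x ∉ ball x₀ s) : cutoff x₀ r s x = 0 :=
  cutoff_eq_zero hrs (by rw [mem_ball, dist_eq_norm] at hx; exact not_lt.1 hx)

lemma cutoff_lipschitz (hrs : r < s) :
    LipschitzWith (s - r)⁻¹.toNNReal (cutoff x₀ r s) := by
  refine LipschitzWith.max_const (LipschitzWith.min_const ?_ 1) 0
  refine LipschitzWith.of_dist_le' fun x y => ?_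
  rw [Real.dist_eq, ← sub_mul, abs_mul, abs_of_pos (inv_pos.2 (sub_pos.2 hrs)), mul_comm]
  gcongr
  rw [dist_eq_norm, abs_sub_comm]
  have := abs_norm_sub_norm_le (x - x₀) (y - x₀)
  simpa using this

lemma cutoff_isLip (hrs : r < s) : IsLip (cutoff x₀ r s) := ⟨_, cutoff_lipschitz hrs⟩

lemma norm_gradient_cutoff_le (hrs : r < s) (x) :
    ‖gradient (cutoff x₀ r s) x‖ ≤ (s - r)⁻¹ := by
  have := (cutoff_lipschitz (x₀ := x₀) hrs).norm_gradient_le x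
  rwa [Real.coe_toNNReal _ (inv_nonneg.2 (by linarith))] at this

end cutoff

lemma gradient_mul {f g : Eucl n → ℝ} {x : Eucl n} (hf : DifferentiableAt ℝ f x)
    (hg : DifferentiableAt ℝ g x) :
    gradient (fun y => f y * g y) x = f x • gradient g x + g x • gradient f x := by
  simp only [gradient, fderiv_fun_mul hf hg, map_add, map_smul]

lemma gradient_add {f g : Eucl n → ℝ} {x : Eucl n} (hf : DifferentiableAt ℝ f x)
    (hg : DifferentiableAt ℝ g x) :
    gradient (fun y => f y + g y) x = gradient f x + gradient g x := by
  simp only [gradient, fderiv_fun_add hf hg, map_add]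

lemma gradient_sub {f g : Eucl n → ℝ} {x : Eucl n} (hf : DifferentiableAt ℝ f x)
    (hg : DifferentiableAt ℝ g x) :
    gradient (fun y => f y - g y) x = gradient f x - gradient g x := by
  simp only [gradient, fderiv_fun_sub hf hg, map_sub]

lemma gradient_const_mul {f : Eucl n → ℝ} {x : Eucl n} (hf : DifferentiableAt ℝ f x) (c : ℝ) :
    gradient (fun y => c * f y) x = c • gradient f x := by
  simp only [gradient, fderiv_const_mul hf, map_smul]

lemma gradient_congr {f g : Eucl n → ℝ} {x : Eucl n} (h : f =ᶠ[𝓝 x] g) :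
    gradient f x = gradient g x := by
  simp [gradient, h.fderiv_eq]

lemma gradient_eq_zero_of_isLocalMin {f : Eucl n → ℝ} {x : Eucl n} (h : IsLocalMin f x) :
    gradient f x = 0 := by
  simp [gradient, h.fderiv_eq_zero]

lemma gradient_eq_zero_of_isLocalMax {f : Eucl n → ℝ} {x : Eucl n} (h : IsLocalMax f x) :
    gradient f x = 0 := by
  simp [gradient, h.fderiv_eq_zero]

lemma setIntegral_of_support {f : Eucl n → ℝ} {x₀ : Eucl n} {R : ℝ}
    (h : ∀ x ∉ ball x₀ R, f x = 0) : ∫ x in ball x₀ R, f x = ∫ x, f x :=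
  setIntegral_eq_integral_of_forall_compl_eq_zero h

/-- `L²` Sobolev inequality with a gain for functions of small support. -/
lemma integral_sq_le_of_small_support {f : Eucl n → ℝ} (hf : IsLip f)
    {x₀ : Eucl n} {R r : ℝ} (hr : 0 < r) (hsupp : ∀ x ∉ closedBall x₀ R, f x = 0)
    (hA : 2 * volume.real {x | f x ≠ 0} ≤ volume.real (ball (0 : Eucl n) r)) :
    ∫ x, f x ^ 2 ≤ 16 * r ^ 2 * ∫ x, ‖gradient f x‖ ^ 2 := by
  obtain ⟨A, hA0, hAb⟩ := hf.exists_bound_of_support hsupp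
  obtain ⟨G, hG0, hGb⟩ := hf.exists_gradient_bound
  have hsq : IsLip fun x => f x * f x := hf.mul_of_bounded hf hAb fun x _ => hAb x
  have hset : {x | f x * f x ≠ 0} = {x | f x ≠ 0} := by ext x; simp
  have h1 := integral_le_of_small_support hsq.choose_spec (fun x => mul_self_nonneg _) hr
    (x₀ := x₀) (R := R) (fun x hx => by rw [hsupp x hx, zero_mul]) (by rwa [hset])
  have hg0 : ∀ x ∉ ball x₀ (R + 1), gradient f x = 0 := fun x hx =>
    gradient_eq_zero_of_notMem isClosed_closedBall hsupp
      fun h => hx (closedBall_subset_ball (by linarith) h)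
  have hf0 : ∀ x ∉ ball x₀ (R + 1), f x = 0 := fun x hx =>
    hsupp x fun h => hx (closedBall_subset_ball (by linarith) h)
  have hgsq0 : ∀ x ∉ ball x₀ (R + 1), gradient (fun x => f x * f x) x = 0 := fun x hx =>
    gradient_eq_zero_of_notMem isClosed_closedBall (fun y hy => by rw [hsupp y hy, zero_mul])
      fun h => hx (closedBall_subset_ball (by linarith) h)
  have e1 : ∫ x in ball x₀ (R + 1), f x ^ 2 = ∫ x, f x ^ 2 :=
    setIntegral_of_support fun x hx => by rw [hf0 x hx]; simp
  have e2 : ∫ x in ball x₀ (R + 1), ‖gradient f x‖ ^ 2 = ∫ x, ‖gradient f x‖ ^ 2 :=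
    setIntegral_of_support fun x hx => by rw [hg0 x hx]; simp
  have e3 : ∫ x in ball x₀ (R + 1), ‖gradient (fun x => f x * f x) x‖ =
      ∫ x, ‖gradient (fun x => f x * f x) x‖ :=
    setIntegral_of_support fun x hx => by rw [hgsq0 x hx]; simp
  rw [← e3] at h1
  have i1 : IntegrableOn (fun x => f x ^ 2) (ball x₀ (R + 1)) :=
    abs_integrableOn_of_bound (C := A ^ 2) (hf.measurable.pow_const 2) measure_ball_lt_top.ne
      fun x => by rw [abs_pow]; gcongr; exact hAb x
  have i2 : IntegrableOn (fun x => ‖gradient f x‖ ^ 2) (ball x₀ (R + 1)) :=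
    abs_integrableOn_of_bound (C := G ^ 2) ((measurable_gradient f).norm.pow_const 2)
      measure_ball_lt_top.ne fun x => by rw [abs_pow, abs_norm]; gcongr; exact hGb x
  have h2 : ∫ x in ball x₀ (R + 1), ‖gradient (fun x => f x * f x) x‖ ≤
      ∫ x in ball x₀ (R + 1), ((4 * r)⁻¹ * f x ^ 2 + 4 * r * ‖gradient f x‖ ^ 2) := by
    refine integral_mono_ae (integrableOn_norm_gradient hsq.choose_spec _ _)
      ((i1.const_mul _).add (i2.const_mul _)) ?_
    refine ae_restrict_of_ae ?_
    filter_upwards [hf.ae_differentiableAt] with x hx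
    rw [gradient_mul hx hx, ← add_smul, norm_smul, Real.norm_eq_abs]
    have h3 : |f x + f x| = 2 * |f x| := by rw [← two_mul, abs_mul]; simp
    rw [h3]
    have h4 : (4 * r)⁻¹ * f x ^ 2 + 4 * r * ‖gradient f x‖ ^ 2 - 2 * |f x| * ‖gradient f x‖ =
        (4 * r)⁻¹ * (|f x| - 4 * r * ‖gradient f x‖) ^ 2 := by
      field_simp; rw [← sq_abs (f x)]; ring
    have h5 : 0 ≤ (4 * r)⁻¹ * (|f x| - 4 * r * ‖gradient f x‖) ^ 2 := by positivity
    linarith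
  rw [integral_add (i1.const_mul _) (i2.const_mul _), integral_const_mul, integral_const_mul,
    e1, e2] at h2
  have h6 : ∫ x, f x * f x = ∫ x, f x ^ 2 := by simp only [sq]
  rw [h6] at h1
  have h7 := h1.trans (mul_le_mul_of_nonneg_left h2 (by positivity : (0 : ℝ) ≤ 2 * r))
  have h8 : 2 * r * ((4 * r)⁻¹ * ∫ x, f x ^ 2) = (∫ x, f x ^ 2) / 2 := by field_simp; norm_num
  rw [mul_add, h8] at h7
  linarith

/-- The truncation `(w - k)⁺`. -/
def pp (w : Eucl n → ℝ) (k : ℝ) (x : Eucl n) : ℝ := max (w x - k) 0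

lemma pp_nonneg (w : Eucl n → ℝ) (k : ℝ) (x : Eucl n) : 0 ≤ pp w k x := le_max_right _ _

lemma pp_isLip {w : Eucl n → ℝ} (hw : IsLip w) (k : ℝ) : IsLip (pp w k) :=
  (hw.sub (IsLip.const k)).max (IsLip.const 0)

lemma pp_of_le {w : Eucl n → ℝ} {k : ℝ} {x : Eucl n} (h : w x ≤ k) : pp w k x = 0 :=
  max_eq_right (by linarith)

lemma pp_of_ge {w : Eucl n → ℝ} {k : ℝ} {x : Eucl n} (h : k ≤ w x) : pp w k x = w x - k :=
  max_eq_left (by linarith)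

lemma gradient_pp_of_le {w : Eucl n → ℝ} {k : ℝ} {x : Eucl n} (h : w x ≤ k) :
    gradient (pp w k) x = 0 :=
  gradient_eq_zero_of_isLocalMin (Eventually.of_forall fun y => by
    rw [pp_of_le h]; exact pp_nonneg w k y)

lemma gradient_pp_of_gt {w : Eucl n → ℝ} (hw : Continuous w) {k : ℝ} {x : Eucl n} (h : k < w x) :
    gradient (pp w k) x = gradient w x := by
  have h1 : gradient (pp w k) x = gradient (fun y => w y + (-k)) x := by
    refine gradient_congr ?_
    filter_upwards [hw.continuousAt.eventually (lt_mem_nhds h)] with y hy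
    rw [pp_of_ge hy.le]; ring
  rw [h1]; simp only [gradient, fderiv_add_const]

/-- The De Giorgi inequality at level `k`. -/
def DGAt (Q : ℝ) (w : Eucl n → ℝ) (x₀ : Eucl n) (R k : ℝ) : Prop :=
  ∀ r s : ℝ, 0 < r → r < s → s ≤ R →
    ∫ x in ball x₀ r, ‖gradient (pp w k) x‖ ^ 2 ≤
      Q / (s - r) ^ 2 * (∫ x in ball x₀ s, pp w k x ^ 2) +
        Q * volume.real ({x | k < w x} ∩ ball x₀ s)

lemma DGAt.mono {Q : ℝ} {w : Eucl n → ℝ} {x₀ : Eucl n} {R R' k : ℝ} (h : DGAt Q w x₀ R k)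
    (hR : R' ≤ R) : DGAt Q w x₀ R' k :=
  fun r s hr hrs hs => h r s hr hrs (hs.trans hR)

lemma superlevel_inter_ball_ne_top (w : Eucl n → ℝ) (k : ℝ) (x₀ : Eucl n) (s : ℝ) :
    volume ({x | k < w x} ∩ ball x₀ s) ≠ ∞ :=
  ne_top_of_le_ne_top measure_ball_lt_top.ne (measure_mono Set.inter_subset_right)

lemma measurableSet_superlevel {w : Eucl n → ℝ} (hw : IsLip w) (k : ℝ) (x₀ : Eucl n) (s : ℝ) :
    MeasurableSet ({x | k < w x} ∩ ball x₀ s) :=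
  (measurableSet_lt measurable_const hw.measurable).inter measurableSet_ball

lemma IsLip.sq_integrableOn {f : Eucl n → ℝ} (hf : IsLip f) (x₀ : Eucl n) (R : ℝ) :
    IntegrableOn (fun x => f x ^ 2) (ball x₀ R) :=
  ((hf.continuous.pow 2).continuousOn.integrableOn_compact (isCompact_closedBall x₀ R)).mono_set
    ball_subset_closedBall

lemma IsLip.gradient_sq_integrableOn {f : Eucl n → ℝ} (hf : IsLip f) (x₀ : Eucl n) (R : ℝ) :
    IntegrableOn (fun x => ‖gradient f x‖ ^ 2) (ball x₀ R) := by
  obtain ⟨G, hG0, hGb⟩ := hf.exists_gradient_bound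
  exact abs_integrableOn_of_bound (C := G ^ 2) ((measurable_gradient f).norm.pow_const 2)
      measure_ball_lt_top.ne fun x => by rw [abs_pow, abs_norm]; gcongr; exact hGb x

lemma integral_pp_sq_le {w : Eucl n → ℝ} (hw : IsLip w) {x₀ : Eucl n} {s k H : ℝ}
    (hH : ∀ x ∈ ball x₀ s, w x ≤ k + H) :
    ∫ x in ball x₀ s, pp w k x ^ 2 ≤ H ^ 2 * volume.real ({x | k < w x} ∩ ball x₀ s) := by
  have hm := measurableSet_superlevel hw k x₀ s
  have h1 : ∫ x in ball x₀ s, pp w k x ^ 2 = ∫ x in {x | k < w x} ∩ ball x₀ s, pp w k x ^ 2 := by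
    refine setIntegral_eq_of_subset_of_forall_sdiff_eq_zero measurableSet_ball
      Set.inter_subset_right fun x hx => ?_
    have : ¬ k < w x := fun h => hx.2 ⟨h, hx.1⟩
    rw [pp_of_le (not_lt.1 this)]; simp
  rw [h1]
  have h2 : ∫ x in {x | k < w x} ∩ ball x₀ s, H ^ 2 =
      H ^ 2 * volume.real ({x | k < w x} ∩ ball x₀ s) := by simp [mul_comm]
  rw [← h2]
  refine setIntegral_mono_on (((pp_isLip hw k).sq_integrableOn x₀ s).mono_set
    Set.inter_subset_right) (integrableOn_const (superlevel_inter_ball_ne_top w k x₀ s)) hm ?_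
  rintro x ⟨hx1, hx2⟩
  have hx1' : k < w x := hx1
  rw [pp_of_ge hx1'.le]
  have := hH x hx2
  exact pow_le_pow_left₀ (by linarith) (by linarith) 2

/-- One step of the De Giorgi iteration. -/
lemma deGiorgi_step {Q : ℝ} (hQ : 0 ≤ Q) {w : Eucl n → ℝ} (hw : IsLip w) {x₀ : Eucl n}
    {r s k H h ρ : ℝ} (hr : 0 < r) (hrs : r < s) (hh : 0 ≤ h) (hρ : 0 < ρ)
    (hH : ∀ x ∈ ball x₀ s, w x ≤ k + H) (hDG : DGAt Q w x₀ s k)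
    (hA : 2 * volume.real ({x | k < w x} ∩ ball x₀ s) ≤ volume.real (ball (0 : Eucl n) ρ)) :
    h ^ 2 * volume.real ({x | k + h < w x} ∩ ball x₀ r) ≤
      16 * ρ ^ 2 * ((8 * (Q + 1) / (s - r) ^ 2 * H ^ 2 + 2 * Q) *
        volume.real ({x | k < w x} ∩ ball x₀ s)) := by
  set a := volume.real ({x | k < w x} ∩ ball x₀ s) with ha
  have ha0 : 0 ≤ a := measureReal_nonneg
  set m := (r + s) / 2 with hm
  have hrm : r < m := by linarith
  have hms : m < s := by linarith
  set η := cutoff x₀ r m with hη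
  set v := pp w k with hv
  have hvL : IsLip v := pp_isLip hw k
  have hηL : IsLip η := cutoff_isLip hrm
  set f := fun x => η x * v x with hf
  have hη0 : ∀ x ∉ closedBall x₀ m, η x = 0 := fun x hx =>
    cutoff_eq_zero_of_notMem hrm fun h => hx (ball_subset_closedBall h)
  have hηb0 : ∀ x ∉ ball x₀ m, η x = 0 := fun x hx => cutoff_eq_zero_of_notMem hrm hx
  have hfL : IsLip f := hηL.mul_of_support hvL abs_cutoff_le_one hη0
  have hf0 : ∀ x ∉ closedBall x₀ m, f x = 0 := fun x hx => by simp only [hf, hη0 x hx, zero_mul]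
  have hsob := integral_sq_le_of_small_support hfL hρ hf0 (by
    refine le_trans ?_ hA
    refine mul_le_mul_of_nonneg_left (measureReal_mono ?_ ?_) zero_le_two
    swap
    · exact superlevel_inter_ball_ne_top w k x₀ s
    · intro x hx
      have hx' : η x * v x ≠ 0 := hx
      refine ⟨?_, ?_⟩
      · by_contra hc
        exact right_ne_zero_of_mul hx' (pp_of_le (not_lt.1 hc))
      · by_contra hc
        exact left_ne_zero_of_mul hx' (hηb0 x fun h => hc (ball_subset_ball hms.le h)))
  have hgrad : ∫ x, ‖gradient f x‖ ^ 2 ≤ (8 * (Q + 1) / (s - r) ^ 2 * H ^ 2 + 2 * Q) * a := by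
    have e1 : ∫ x in ball x₀ s, ‖gradient f x‖ ^ 2 = ∫ x, ‖gradient f x‖ ^ 2 :=
      setIntegral_of_support fun x hx => by
        rw [gradient_eq_zero_of_notMem isClosed_closedBall hf0
          fun h => hx (closedBall_subset_ball hms h)]; simp
    have e2 : ∫ x in ball x₀ m, ‖gradient f x‖ ^ 2 = ∫ x in ball x₀ s, ‖gradient f x‖ ^ 2 := by
      rw [e1]
      refine setIntegral_eq_integral_of_ae_compl_eq_zero ?_
      have hsph : volume (sphere x₀ m) = 0 := Measure.addHaar_sphere_of_ne_zero _ _ (by linarith)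
      have : ∀ᵐ x, x ∉ sphere x₀ m := measure_eq_zero_iff_ae_notMem.1 hsph
      filter_upwards [this] with x hx hxb
      rw [gradient_eq_zero_of_notMem isClosed_closedBall hf0, norm_zero]
      · norm_num
      · intro hxc
        rw [mem_closedBall] at hxc; rw [mem_ball] at hxb; rw [mem_sphere] at hx
        exact hx (le_antisymm hxc (not_lt.1 hxb))
    rw [← e1, ← e2]
    have i1 := hfL.gradient_sq_integrableOn x₀ m
    have i2 := hvL.gradient_sq_integrableOn x₀ m
    have i3 := hvL.sq_integrableOn x₀ m
    have h1 : ∫ x in ball x₀ m, ‖gradient f x‖ ^ 2 ≤ ∫ x in ball x₀ m,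
        (2 * ‖gradient v x‖ ^ 2 + 2 * (m - r)⁻¹ ^ 2 * v x ^ 2) := by
      refine integral_mono_ae i1 ((i2.const_mul _).add (i3.const_mul _)) ?_
      refine ae_restrict_of_ae ?_
      filter_upwards [hηL.ae_differentiableAt, hvL.ae_differentiableAt] with x hx1 hx2
      simp only [hf]
      rw [gradient_mul hx1 hx2]
      have h2 : ‖η x • gradient v x + v x • gradient η x‖ ≤
          ‖gradient v x‖ + v x * (m - r)⁻¹ := by
        refine (norm_add_le _ _).trans ?_
        rw [norm_smul, norm_smul, Real.norm_eq_abs, Real.norm_eq_abs,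
          abs_of_nonneg (pp_nonneg w k x)]
        have := abs_cutoff_le_one (x₀ := x₀) (r := r) (s := m) x
        have h3 := norm_gradient_cutoff_le (x₀ := x₀) hrm x
        have h4 := pp_nonneg w k x
        have h5 : |η x| * ‖gradient v x‖ ≤ 1 * ‖gradient v x‖ := by gcongr
        have h6 : v x * ‖gradient η x‖ ≤ v x * (m - r)⁻¹ := by gcongr
        linarith
      calc ‖η x • gradient v x + v x • gradient η x‖ ^ 2
          ≤ (‖gradient v x‖ + v x * (m - r)⁻¹) ^ 2 := by gcongr
        _ ≤ _ := by nlinarith [sq_nonneg (‖gradient v x‖ - v x * (m - r)⁻¹)]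
    rw [integral_add (i2.const_mul _) (i3.const_mul _), integral_const_mul,
      integral_const_mul] at h1
    have h2 := hDG m s (by linarith) hms le_rfl
    have h3 := integral_pp_sq_le hw hH
    have h4 : ∫ x in ball x₀ m, v x ^ 2 ≤ ∫ x in ball x₀ s, v x ^ 2 :=
      setIntegral_mono_set (hvL.sq_integrableOn x₀ s) (Eventually.of_forall fun x => sq_nonneg _)
        (ball_subset_ball hms.le).eventuallyLE
    have e3 : s - m = (s - r) / 2 := by rw [hm]; ring
    have e4 : m - r = (s - r) / 2 := by rw [hm]; ring
    rw [e3] at h2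
    rw [e4] at h1
    have hsr : 0 < s - r := by linarith
    calc _ ≤ _ := h1
      _ ≤ 2 * (Q / ((s - r) / 2) ^ 2 * (H ^ 2 * a) + Q * a) +
          2 * ((s - r) / 2)⁻¹ ^ 2 * (H ^ 2 * a) := by
          gcongr
          · exact h2.trans (by gcongr)
          · exact h4.trans h3
      _ = _ := by field_simp; ring
  have hlow : h ^ 2 * volume.real ({x | k + h < w x} ∩ ball x₀ r) ≤ ∫ x, f x ^ 2 := by
    have e1 : ∫ x in ball x₀ s, f x ^ 2 = ∫ x, f x ^ 2 :=
      setIntegral_of_support fun x hx => by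
        rw [hf0 x fun h => hx (closedBall_subset_ball hms h)]; simp
    have h2 : ∫ x in {x | k + h < w x} ∩ ball x₀ r, h ^ 2 =
      h ^ 2 * volume.real ({x | k + h < w x} ∩ ball x₀ r) := by simp [mul_comm]
    rw [← e1, ← h2]
    have hsub : {x | k + h < w x} ∩ ball x₀ r ⊆ ball x₀ s := fun x hx =>
      ball_subset_ball hrs.le hx.2
    refine le_trans (setIntegral_mono_on
      (integrableOn_const (superlevel_inter_ball_ne_top w (k + h) x₀ r))
      ((hfL.sq_integrableOn x₀ s).mono_set hsub) (measurableSet_superlevel hw _ _ _) ?_)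
      (setIntegral_mono_set (hfL.sq_integrableOn x₀ s) (Eventually.of_forall fun x => sq_nonneg _)
        hsub.eventuallyLE)
    rintro x ⟨hx1, hx2⟩
    have hx1' : k + h < w x := hx1
    have : η x = 1 := cutoff_eq_one hrm (by rw [mem_ball, dist_eq_norm] at hx2; exact hx2.le)
    simp only [hf, this, one_mul, hv]
    rw [pp_of_ge (by linarith)]
    exact pow_le_pow_left₀ hh (by linarith) 2
  exact hlow.trans (hsob.trans (by gcongr))

/-- De Giorgi's first lemma: small superlevel sets force a decrease of the supremum. -/
lemma deGiorgi_one (n : ℕ) {Q : ℝ} (hQ : 0 ≤ Q) : ∃ ν : ℝ, 0 < ν ∧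
    ∀ (w : Eucl n → ℝ), IsLip w → ∀ (x₀ : Eucl n) (R k H : ℝ), 0 < R → R ≤ H →
      (∀ k' ≥ k, DGAt Q w x₀ R k') → (∀ x ∈ ball x₀ R, w x ≤ k + H) →
      volume.real ({x | k < w x} ∩ ball x₀ R) ≤ ν * R ^ (n + 1) →
      ∀ x ∈ ball x₀ (R / 2), w x ≤ k + H / 2 := by
  set K : ℝ := 65536 * (Q + 1) with hK
  have hK0 : 0 < K := by positivity
  obtain ⟨ς, hς0, hς⟩ : ∃ ς : ℝ, 0 < ς ∧ K * ς ^ 2 ≤ (1 / 4) ^ (n + 1) := by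
    refine ⟨(1 / 2) ^ (n + 1) / (K + 1), by positivity, ?_⟩
    rw [div_pow, ← pow_mul, mul_comm (n + 1) 2, pow_mul]
    norm_num
    rw [← mul_div_assoc, div_le_iff₀ (by positivity)]
    rw [mul_comm]
    gcongr
    nlinarith
  refine ⟨ς ^ (n + 1) * omega n / 2, by have := omega_pos (n := n); positivity, ?_⟩
  intro w hw x₀ R k H hR hRH hDG hH hA
  have hH0 : 0 < H := hR.trans_le hRH
  set kk : ℕ → ℝ := fun j => k + H / 2 * (1 - (1 / 2) ^ j) with hkk
  set RR : ℕ → ℝ := fun j => R / 2 * (1 + (1 / 2) ^ j) with hRR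
  have hom := omega_pos (n := n)
  have key : ∀ j, volume.real ({x | kk j < w x} ∩ ball x₀ (RR j)) ≤
      ς ^ (n + 1) * omega n / 2 * R ^ (n + 1) * ((1 / 4) ^ (n + 1)) ^ j := by
    intro j
    induction j with
    | zero => simpa [hkk, hRR, ← two_mul] using hA
    | succ j ih =>
      set p : ℝ := (1 / 2) ^ j with hp
      have hp0 : 0 < p := by positivity
      have hp1 : p ≤ 1 := pow_le_one₀ (by norm_num) (by norm_num)
      have hps : (1 / 2 : ℝ) ^ (j + 1) = p / 2 := by rw [pow_succ]; ring
      have hk1 : kk (j + 1) = kk j + H * p / 4 := by simp only [hkk, hps]; ring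
      have hR1 : RR j - RR (j + 1) = R * p / 4 := by simp only [hRR, hps, ← hp]; ring
      have hRj : RR j ≤ R := by
        simp only [hRR, ← hp]; nlinarith
      have hkj : k ≤ kk j := by
        simp only [hkk, ← hp]; nlinarith
      have hp4 : ((1 / 4 : ℝ) ^ (n + 1)) ^ j = (p ^ 2) ^ (n + 1) := by
        rw [← pow_mul, ← pow_mul, hp, ← pow_mul]
        rw [show (1 / 4 : ℝ) = (1 / 2) ^ 2 by norm_num, ← pow_mul]; congr 1; ring
      have hRj1 : 0 < RR (j + 1) := by simp only [hRR]; positivity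
      have hst := deGiorgi_step hQ hw (x₀ := x₀) (r := RR (j + 1)) (s := RR j) (k := kk j) (H := H)
        (h := H * p / 4) (ρ := ς * R * p ^ 2) hRj1
        (by have : 0 < R * p / 4 := by positivity
            linarith) (by positivity) (by positivity)
        (fun x hx => (hH x (ball_subset_ball hRj hx)).trans (by linarith))
        ((hDG (kk j) hkj).mono hRj) (by
          rw [volume_real_ball _ (by positivity)]
          rw [hp4] at ih
          calc _ ≤ 2 * (ς ^ (n + 1) * omega n / 2 * R ^ (n + 1) * (p ^ 2) ^ (n + 1)) := by gcongr
            _ = _ := by rw [mul_pow, mul_pow]; ring)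
      rw [← hk1, hR1] at hst
      set a := volume.real ({x | kk j < w x} ∩ ball x₀ (RR j)) with ha
      have ha0 : 0 ≤ a := measureReal_nonneg
      set b := volume.real ({x | kk (j + 1) < w x} ∩ ball x₀ (RR (j + 1))) with hb
      have h1 : 8 * (Q + 1) / (R * p / 4) ^ 2 * H ^ 2 + 2 * Q ≤
          256 * (Q + 1) * (H ^ 2 / (R ^ 2 * p ^ 2)) := by
        have h2 : 1 ≤ H ^ 2 / (R ^ 2 * p ^ 2) := by
          rw [le_div_iff₀ (by positivity), one_mul, ← mul_pow]
          refine pow_le_pow_left₀ (by positivity) ?_ 2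
          nlinarith
        have h3 : 8 * (Q + 1) / (R * p / 4) ^ 2 * H ^ 2 =
            128 * (Q + 1) * (H ^ 2 / (R ^ 2 * p ^ 2)) := by field_simp; ring
        rw [h3]; nlinarith
      have h4 : (H * p / 4) ^ 2 * b ≤ (H * p / 4) ^ 2 * (K * ς ^ 2 * a) := by
        refine hst.trans ?_
        calc _ ≤ 16 * (ς * R * p ^ 2) ^ 2 *
              (256 * (Q + 1) * (H ^ 2 / (R ^ 2 * p ^ 2)) * a) := by gcongr
          _ = (H * p / 4) ^ 2 * (65536 * (Q + 1) * ς ^ 2 * a) := by field_simp; ring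
          _ = _ := by rw [hK]
      have h5 : b ≤ K * ς ^ 2 * a := le_of_mul_le_mul_left h4 (by positivity)
      calc b ≤ K * ς ^ 2 * a := h5
        _ ≤ (1 / 4) ^ (n + 1) *
            (ς ^ (n + 1) * omega n / 2 * R ^ (n + 1) * ((1 / 4) ^ (n + 1)) ^ j) := by gcongr
        _ = _ := by rw [pow_succ ((1 / 4 : ℝ) ^ (n + 1)) j]; ring
  have hsub : ∀ j, {x | k + H / 2 < w x} ∩ ball x₀ (R / 2) ⊆ {x | kk j < w x} ∩ ball x₀ (RR j) := by
    rintro j x ⟨hx1, hx2⟩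
    have hp0 : (0 : ℝ) < (1 / 2) ^ j := by positivity
    refine ⟨lt_of_le_of_lt (b := k + H / 2) ?_ hx1, ball_subset_ball ?_ hx2⟩
    · simp only [hkk]; nlinarith
    · simp only [hRR]; nlinarith
  have hlim : Tendsto (fun j : ℕ => ς ^ (n + 1) * omega n / 2 * R ^ (n + 1) *
      ((1 / 4 : ℝ) ^ (n + 1)) ^ j) atTop (𝓝 0) := by
    have := (tendsto_pow_atTop_nhds_zero_of_lt_one (r := (1 / 4 : ℝ) ^ (n + 1)) (by positivity)
      (pow_lt_one₀ (by norm_num) (by norm_num) (by omega))).const_mul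
        (ς ^ (n + 1) * omega n / 2 * R ^ (n + 1))
    simpa using this
  have hz : volume.real ({x | k + H / 2 < w x} ∩ ball x₀ (R / 2)) ≤ 0 :=
    ge_of_tendsto hlim (Eventually.of_forall fun j =>
      (measureReal_mono (hsub j) (superlevel_inter_ball_ne_top _ _ _ _)).trans (key j))
  have hz' : volume ({x | k + H / 2 < w x} ∩ ball x₀ (R / 2)) = 0 := by
    have := le_antisymm hz measureReal_nonneg
    rw [measureReal_def, ENNReal.toReal_eq_zero_iff] at this
    exact this.resolve_right (superlevel_inter_ball_ne_top _ _ _ _)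
  have ho : IsOpen ({x | k + H / 2 < w x} ∩ ball x₀ (R / 2)) :=
    (isOpen_lt continuous_const hw.continuous).inter isOpen_ball
  rw [ho.measure_eq_zero_iff volume] at hz'
  intro x hx
  by_contra hc
  have : x ∈ ({x | k + H / 2 < w x} ∩ ball x₀ (R / 2)) := ⟨not_le.1 hc, hx⟩
  rw [hz'] at this
  exact this

lemma sq_setIntegral_le {S : Set (Eucl n)} (hS : volume S ≠ ∞)
    {g : Eucl n → ℝ} (hg : IntegrableOn g S) (hg2 : IntegrableOn (fun x => g x ^ 2) S) :
    (∫ x in S, g x) ^ 2 ≤ volume.real S * ∫ x in S, g x ^ 2 := by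
  set V := volume.real S with hV
  set I := ∫ x in S, g x with hI
  have hV0 : 0 ≤ V := measureReal_nonneg
  have hc : IntegrableOn (fun _ : Eucl n => (1 : ℝ)) S := integrableOn_const hS
  have h1 : 0 ≤ ∫ x in S, (V ^ 2 * g x ^ 2 + (-(2 * V * I)) * g x + I ^ 2 * 1) :=
    integral_nonneg fun x => by
      have : V ^ 2 * g x ^ 2 + (-(2 * V * I)) * g x + I ^ 2 * 1 = (V * g x - I) ^ 2 := by ring
      rw [this]; exact sq_nonneg _
  have i1 : IntegrableOn (fun x => V ^ 2 * g x ^ 2 + (-(2 * V * I)) * g x) S :=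
    (hg2.const_mul _).add (hg.const_mul _)
  rw [integral_add i1 (hc.const_mul _),
    integral_add (hg2.const_mul _) (hg.const_mul _), integral_const_mul, integral_const_mul,
    integral_const_mul] at h1
  have h2 : ∫ _ in S, (1 : ℝ) = V := by simp [hV]
  rw [h2, ← hI] at h1
  rcases hV0.eq_or_lt with h0 | h0
  · have : I = 0 := by
      rw [hI]
      apply setIntegral_measure_zero
      rw [hV, measureReal_def, eq_comm, ENNReal.toReal_eq_zero_iff] at h0
      exact h0.resolve_right hS
    rw [this, ← h0]; simp
  · have h3 : 0 ≤ V * (V * (∫ x in S, g x ^ 2) - I ^ 2) := by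
      have : V * (V * (∫ x in S, g x ^ 2) - I ^ 2) =
        V ^ 2 * (∫ x in S, g x ^ 2) + -(2 * V * I) * I + I ^ 2 * V := by ring
      rw [this]; exact h1
    have := nonneg_of_mul_nonneg_right h3 h0
    linarith

/-- Measure of a superlevel set versus that of the intermediate level set. -/
lemma isoperimetric_levels {w : Eucl n → ℝ} (hw : IsLip w) {x₀ : Eucl n} {R l h c : ℝ}
    (hR : 0 < R) (hh : 0 < h) (hc : 0 < c)
    (hz : c * R ^ (n + 1) ≤ volume.real ({x | w x ≤ l} ∩ ball x₀ R)) :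
    (h * volume.real ({x | l + h ≤ w x} ∩ ball x₀ R)) ^ 2 ≤
      (2 ^ (n + 2) * omega n * R / c) ^ 2 *
        (volume.real ({x | l < w x ∧ w x < l + h} ∩ ball x₀ R) *
          ∫ x in ball x₀ R, ‖gradient (pp w l) x‖ ^ 2) := by
  set f := fun x => min (pp w l x) h with hf
  have hfL : IsLip f := (pp_isLip hw l).min (IsLip.const h)
  have hf0 : ∀ x, 0 ≤ f x := fun x => le_min (pp_nonneg w l x) hh.le
  have hfz : ∀ x, w x ≤ l → f x = 0 := fun x hx => by
    simp only [hf, pp_of_le hx]; exact min_eq_left hh.le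
  have hfh : ∀ x, l + h ≤ w x → f x = h := fun x hx => by
    simp only [hf]; rw [pp_of_ge (by linarith)]; exact min_eq_right (by linarith)
  set D := {x | l < w x ∧ w x < l + h} ∩ ball x₀ R with hD
  have hDm : MeasurableSet D := ((measurableSet_lt measurable_const hw.measurable).inter
    (measurableSet_lt hw.measurable measurable_const)).inter measurableSet_ball
  have hDf : volume D ≠ ∞ := ne_top_of_le_ne_top measure_ball_lt_top.ne
    (measure_mono Set.inter_subset_right)
  have hDB : D ⊆ ball x₀ R := Set.inter_subset_right
  have h1 := mul_setIntegral_le_of_zeros hfL.choose_spec hf0 x₀ R (2 * R) (by linarith)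
    (c * R ^ (n + 1)) (by positivity) (by
      intro x hx _
      refine hz.trans ?_
      have e : {v : Eucl n | v ∈ ball 0 (2 * R) ∧ x + v ∈ ball x₀ R ∧ f (x + v) = 0} ⊇
          (fun v => x + v) ⁻¹' ({x | w x ≤ l} ∩ ball x₀ R) := by
        rintro v ⟨hv1, hv2⟩
        refine ⟨?_, hv2, hfz _ hv1⟩
        rw [mem_ball_zero_iff]
        rw [mem_ball] at hv2 hx
        calc ‖v‖ = dist (x + v) x := by simp
          _ ≤ dist (x + v) x₀ + dist x₀ x := dist_triangle _ _ _
          _ < 2 * R := by rw [dist_comm x₀ x]; linarith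
      have h2 := measureReal_mono (μ := volume) e
        (ne_top_of_le_ne_top measure_ball_lt_top.ne (measure_mono fun v hv => hv.1))
      refine le_trans (le_of_eq ?_) h2
      rw [measureReal_def, measureReal_def, measure_preimage_add])
  have h2 : h * volume.real ({x | l + h ≤ w x} ∩ ball x₀ R) ≤ ∫ x in ball x₀ R, f x := by
    have e2 : ∫ x in {x | l + h ≤ w x} ∩ ball x₀ R, h =
      h * volume.real ({x | l + h ≤ w x} ∩ ball x₀ R) := by simp [mul_comm]
    rw [← e2]
    have hsub : {x | l + h ≤ w x} ∩ ball x₀ R ⊆ ball x₀ R := Set.inter_subset_right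
    refine le_trans (le_of_eq ?_) (setIntegral_mono_set (hfL.integrableOn_ball x₀ R)
      (Eventually.of_forall hf0) hsub.eventuallyLE)
    refine setIntegral_congr_fun ((measurableSet_le measurable_const hw.measurable).inter
      measurableSet_ball) fun x hx => ?_
    exact (hfh x hx.1).symm
  have hgD : ∀ x ∈ ball x₀ R \ D, gradient f x = 0 := by
    rintro x ⟨hxB, hxD⟩
    by_cases hx1 : w x ≤ l
    · refine gradient_eq_zero_of_isLocalMin (Eventually.of_forall fun y => ?_)
      rw [hfz x hx1]; exact hf0 y
    · have hx2 : l + h ≤ w x := by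
        by_contra hx2; exact hxD ⟨⟨not_le.1 hx1, not_le.1 hx2⟩, hxB⟩
      refine gradient_eq_zero_of_isLocalMax (Eventually.of_forall fun y => ?_)
      rw [hfh x hx2]; exact min_le_right _ _
  have hgD' : ∀ x ∈ D, gradient f x = gradient (pp w l) x := by
    rintro x ⟨⟨hx1, hx2⟩, -⟩
    refine gradient_congr ?_
    filter_upwards [hw.continuous.continuousAt.eventually (lt_mem_nhds hx1),
      hw.continuous.continuousAt.eventually (gt_mem_nhds hx2)] with y hy1 hy2
    simp only [hf]; rw [pp_of_ge (le_of_lt hy1)]; exact min_eq_left (by linarith)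
  have h3 : ∫ x in ball x₀ R, ‖gradient f x‖ = ∫ x in D, ‖gradient (pp w l) x‖ := by
    rw [setIntegral_eq_of_subset_of_forall_sdiff_eq_zero measurableSet_ball hDB
      (fun x hx => by rw [hgD x hx, norm_zero])]
    exact setIntegral_congr_fun hDm fun x hx => by simp only [hgD' x hx]
  have hvL := pp_isLip hw l
  have i2 := hvL.gradient_sq_integrableOn x₀ R
  have h4 := sq_setIntegral_le hDf
    ((integrableOn_norm_gradient hvL.choose_spec x₀ R).mono_set hDB) (i2.mono_set hDB)
  have h5 : ∫ x in D, ‖gradient (pp w l) x‖ ^ 2 ≤ ∫ x in ball x₀ R, ‖gradient (pp w l) x‖ ^ 2 :=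
    setIntegral_mono_set i2 (Eventually.of_forall fun x => sq_nonneg _) hDB.eventuallyLE
  rw [h3, volume_real_ball _ (by linarith)] at h1
  set X := h * volume.real ({x | l + h ≤ w x} ∩ ball x₀ R) with hX
  have hX0 : 0 ≤ X := mul_nonneg hh.le measureReal_nonneg
  set Y := ∫ x in D, ‖gradient (pp w l) x‖ with hY
  have h6 : X ≤ 2 ^ (n + 2) * omega n * R / c * Y := by
    have h7 : c * R ^ (n + 1) * X ≤ c * R ^ (n + 1) * (2 ^ (n + 2) * omega n * R / c * Y) := by
      refine (mul_le_mul_of_nonneg_left h2 (by positivity)).trans (h1.trans (le_of_eq ?_))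
      rw [mul_pow]; field_simp; ring
    exact le_of_mul_le_mul_left h7 (by positivity)
  calc X ^ 2 ≤ (2 ^ (n + 2) * omega n * R / c * Y) ^ 2 := by gcongr
    _ = (2 ^ (n + 2) * omega n * R / c) ^ 2 * Y ^ 2 := by ring
    _ ≤ _ := by
      gcongr
      exact h4.trans (mul_le_mul_of_nonneg_left h5 measureReal_nonneg)

/-- De Giorgi's decay lemma. -/
lemma deGiorgi_decay (n : ℕ) {Q c : ℝ} (hQ : 0 ≤ Q) (hc : 0 < c) : ∃ θ : ℝ, 0 < θ ∧ θ < 1 ∧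
    ∀ (w : Eucl n → ℝ), IsLip w → ∀ (x₀ : Eucl n) (R k H : ℝ), 0 < R → R ≤ θ * H →
      (∀ k' ≥ k, DGAt Q w x₀ (2 * R) k') → (∀ x ∈ ball x₀ (2 * R), w x ≤ k + H) →
      c * R ^ (n + 1) ≤ volume.real ({x | w x ≤ k} ∩ ball x₀ R) →
      ∀ x ∈ ball x₀ (R / 2), w x ≤ k + (1 - θ) * H := by
  obtain ⟨ν, hν0, hν⟩ := deGiorgi_one n hQ
  have hom := omega_pos (n := n)
  set C : ℝ := 4 * ((2 ^ (n + 2) * omega n / c) ^ 2 *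
    (2 * Q * (2 ^ (n + 1) * omega n))) * omega n with hC
  obtain ⟨J, hJ⟩ := exists_nat_gt (C / ν ^ 2)
  set θ : ℝ := (1 / 2) ^ (J + 1) with hθ
  have hθ0 : 0 < θ := by positivity
  refine ⟨θ, hθ0, pow_lt_one₀ (by norm_num) (by norm_num) (by omega), ?_⟩
  intro w hw x₀ R k H hR hRH hDG hH hz
  have hH0 : 0 < H := by
    by_contra h; push Not at h
    nlinarith
  set l : ℕ → ℝ := fun j => k + H * (1 - (1 / 2) ^ j) with hl
  set D : ℕ → Set (Eucl n) := fun j => {x | l j < w x ∧ w x < l (j + 1)} ∩ ball x₀ R with hD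
  have hlj : ∀ j, l (j + 1) = l j + H * (1 / 2) ^ (j + 1) := fun j => by
    simp only [hl, pow_succ]; ring
  have hlmono : Monotone l := monotone_nat_of_le_succ fun j => by
    rw [hlj]; have : 0 < H * (1 / 2) ^ (j + 1) := by positivity
    linarith
  have hkl : ∀ j, k ≤ l j := fun j => by
    have : (1 / 2 : ℝ) ^ j ≤ 1 := pow_le_one₀ (by norm_num) (by norm_num)
    simp only [hl]; nlinarith
  have hstep : ∀ j, j < J → volume.real ({x | l J ≤ w x} ∩ ball x₀ R) ^ 2 ≤
      C / omega n * R ^ (n + 1) * volume.real (D j) := by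
    intro j hj
    set p : ℝ := (1 / 2) ^ j with hp
    have hp0 : 0 < p := by positivity
    have h1 := isoperimetric_levels hw (x₀ := x₀) (R := R) (l := l j) (h := H * (1 / 2) ^ (j + 1))
      (c := c) hR (by positivity) hc (hz.trans (measureReal_mono (by
        rintro x ⟨hx1, hx2⟩
        exact ⟨le_trans (b := k) hx1 (hkl j), hx2⟩) (ne_top_of_le_ne_top measure_ball_lt_top.ne
          (measure_mono Set.inter_subset_right))))
    rw [← hlj] at h1
    have hsub : {x | l J ≤ w x} ∩ ball x₀ R ⊆ {x | l (j + 1) ≤ w x} ∩ ball x₀ R := by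
      rintro x ⟨hx1, hx2⟩
      exact ⟨le_trans (b := l J) (hlmono (by omega)) hx1, hx2⟩
    have h2 := measureReal_mono (μ := volume) hsub (ne_top_of_le_ne_top measure_ball_lt_top.ne
      (measure_mono Set.inter_subset_right))
    have h3 := hDG (l j) (hkl j) R (2 * R) hR (by linarith) le_rfl
    have h4 := integral_pp_sq_le hw (x₀ := x₀) (s := 2 * R) (k := l j) (H := H * p) (by
      intro x hx
      have := hH x hx
      simp only [hl, ← hp]; linarith)
    have h5 : volume.real ({x | l j < w x} ∩ ball x₀ (2 * R)) ≤
        (2 * R) ^ (n + 1) * omega n := by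
      rw [← volume_real_ball x₀ (by linarith)]
      exact measureReal_mono Set.inter_subset_right measure_ball_lt_top.ne
    have h6 : R ≤ H * p := by
      refine hRH.trans ?_
      rw [mul_comm]
      gcongr
      exact pow_le_pow_of_le_one (by norm_num) (by norm_num) (by omega)
    set a := volume.real ({x | l j < w x} ∩ ball x₀ (2 * R)) with ha
    have h7 : ∫ x in ball x₀ R, ‖gradient (pp w (l j)) x‖ ^ 2 ≤
        2 * Q * ((H * p) ^ 2 / R ^ 2) * ((2 * R) ^ (n + 1) * omega n) := by
      have h8 : 1 ≤ (H * p) ^ 2 / R ^ 2 := by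
        rw [le_div_iff₀ (by positivity), one_mul]; gcongr
      have e : 2 * R - R = R := by ring
      rw [e] at h3
      have hQa : Q * a ≤ Q * ((2 * R) ^ (n + 1) * omega n) * ((H * p) ^ 2 / R ^ 2) :=
        (mul_le_mul_of_nonneg_left h5 hQ).trans (le_mul_of_one_le_right (by positivity) h8)
      calc _ ≤ _ := h3
        _ ≤ Q / R ^ 2 * ((H * p) ^ 2 * ((2 * R) ^ (n + 1) * omega n)) +
            Q * ((2 * R) ^ (n + 1) * omega n) * ((H * p) ^ 2 / R ^ 2) := by
            refine add_le_add ?_ hQa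
            gcongr
            exact h4.trans (by gcongr)
        _ = _ := by field_simp; ring
    have h9 : (H * p / 2) ^ 2 * volume.real ({x | l J ≤ w x} ∩ ball x₀ R) ^ 2 ≤
        (H * p / 2) ^ 2 * (C / omega n * R ^ (n + 1) * volume.real (D j)) := by
      have e1 : H * (1 / 2) ^ (j + 1) = H * p / 2 := by rw [pow_succ, ← hp]; ring
      rw [e1] at h1
      calc (H * p / 2) ^ 2 * volume.real ({x | l J ≤ w x} ∩ ball x₀ R) ^ 2
          = (H * p / 2 * volume.real ({x | l J ≤ w x} ∩ ball x₀ R)) ^ 2 := by ring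
        _ ≤ (H * p / 2 * volume.real ({x | l (j + 1) ≤ w x} ∩ ball x₀ R)) ^ 2 := by gcongr
        _ ≤ (2 ^ (n + 2) * omega n * R / c) ^ 2 * (volume.real (D j) *
            (2 * Q * ((H * p) ^ 2 / R ^ 2) * ((2 * R) ^ (n + 1) * omega n))) :=
            h1.trans (by gcongr)
        _ = _ := by rw [hC, mul_pow 2 R]; field_simp; norm_num; ring
    exact le_of_mul_le_mul_left h9 (by positivity)
  have hDm : ∀ j, MeasurableSet (D j) := fun j => ((measurableSet_lt measurable_const
    hw.measurable).inter (measurableSet_lt hw.measurable measurable_const)).inter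
    measurableSet_ball
  have hdisj : ∀ i j, i < j → Disjoint (D i) (D j) := by
    intro i j hij
    rw [Set.disjoint_left]
    rintro x ⟨⟨-, hx⟩, -⟩ ⟨⟨hx', -⟩, -⟩
    have := hlmono (show i + 1 ≤ j by omega)
    linarith
  have hsum : ∑ j ∈ Finset.range J, volume.real (D j) ≤ R ^ (n + 1) * omega n := by
    rw [← measureReal_biUnion_finset, ← volume_real_ball x₀ hR.le]
    · exact measureReal_mono (Set.iUnion₂_subset fun j _ => Set.inter_subset_right)
        measure_ball_lt_top.ne
    · intro i _ j _ hij
      rcases lt_or_gt_of_ne hij with h | h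
      · exact hdisj i j h
      · exact (hdisj j i h).symm
    · exact fun j _ => hDm j
  set a := volume.real ({x | l J ≤ w x} ∩ ball x₀ R) with ha
  have ha0 : 0 ≤ a := measureReal_nonneg
  have hJa : (J : ℝ) * a ^ 2 ≤ C * (R ^ (n + 1)) ^ 2 := by
    calc (J : ℝ) * a ^ 2 = ∑ j ∈ Finset.range J, a ^ 2 := by simp
      _ ≤ ∑ j ∈ Finset.range J, C / omega n * R ^ (n + 1) * volume.real (D j) :=
          Finset.sum_le_sum fun j hj => hstep j (Finset.mem_range.1 hj)
      _ = C / omega n * R ^ (n + 1) * ∑ j ∈ Finset.range J, volume.real (D j) := by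
          rw [Finset.mul_sum]
      _ ≤ C / omega n * R ^ (n + 1) * (R ^ (n + 1) * omega n) := by gcongr
      _ = _ := by field_simp
  have haν : a ≤ ν * R ^ (n + 1) := by
    by_contra hcon
    push Not at hcon
    have h1 : (ν * R ^ (n + 1)) ^ 2 < a ^ 2 := pow_lt_pow_left₀ hcon (by positivity) two_ne_zero
    rw [div_lt_iff₀ (by positivity)] at hJ
    have h2 : C * (R ^ (n + 1)) ^ 2 < J * ν ^ 2 * (R ^ (n + 1)) ^ 2 := by gcongr
    have h3 : (J : ℝ) * (ν * R ^ (n + 1)) ^ 2 ≤ J * a ^ 2 := by gcongr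
    have e : (J : ℝ) * (ν * R ^ (n + 1)) ^ 2 = J * ν ^ 2 * (R ^ (n + 1)) ^ 2 := by ring
    linarith
  have hfin := hν w hw x₀ R (l J) (H * (1 / 2) ^ J) hR (by
      refine hRH.trans ?_
      rw [mul_comm]; gcongr
      exact pow_le_pow_of_le_one (by norm_num) (by norm_num) (by omega))
    (fun k' hk' => (hDG k' ((hkl J).trans hk')).mono (by linarith))
    (fun x hx => by
      refine (hH x (ball_subset_ball (by linarith) hx)).trans (le_of_eq ?_)
      simp only [hl]; ring)
    ((measureReal_mono (by
      rintro x ⟨hx1, hx2⟩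
      exact ⟨le_of_lt (a := l J) hx1, hx2⟩) (ne_top_of_le_ne_top measure_ball_lt_top.ne
        (measure_mono Set.inter_subset_right))).trans haν)
  intro x hx
  refine (hfin x hx).trans (le_of_eq ?_)
  simp only [hl, hθ, pow_succ]; ring

lemma half_ball_alternative (w : Eucl n → ℝ) (x₀ : Eucl n) {R : ℝ} (hR : 0 ≤ R)
    (k : ℝ) : omega n / 2 * R ^ (n + 1) ≤ volume.real ({x | w x ≤ k} ∩ ball x₀ R) ∨
      omega n / 2 * R ^ (n + 1) ≤ volume.real ({x | - w x ≤ - k} ∩ ball x₀ R) := by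
  have h1 : ball x₀ R ⊆ ({x | w x ≤ k} ∩ ball x₀ R) ∪ ({x | - w x ≤ - k} ∩ ball x₀ R) := by
    intro x hx
    rcases le_total (w x) k with h | h
    · exact Or.inl ⟨h, hx⟩
    · exact Or.inr ⟨neg_le_neg h, hx⟩
  have h2 := (measureReal_mono (μ := volume) h1 (ne_top_of_le_ne_top
    (measure_ball_lt_top (x := x₀) (r := R)).ne (measure_mono (Set.union_subset
      Set.inter_subset_right Set.inter_subset_right)))).trans (measureReal_union_le _ _)
  rw [volume_real_ball _ hR] at h2
  by_contra hcon
  push Not at hcon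
  linarith [hcon.1, hcon.2]

/-- Interior oscillation decay from two-sided De Giorgi inequalities. -/
lemma deGiorgi_osc (n : ℕ) {Q δ L : ℝ} (hQ : 0 ≤ Q) (hδ : 0 < δ) : ∃ ρ : ℝ, 0 < ρ ∧ ρ < 1 ∧
    ∀ (w : Eucl n → ℝ), IsLip w → ∀ (x₀ : Eucl n) (R : ℝ), 0 < R → R ≤ 1 →
      (∀ k, DGAt Q w x₀ R k) → (∀ k, DGAt Q (fun x => - w x) x₀ R k) →
      (∀ x ∈ ball x₀ R, |w x| ≤ L) →
      ∀ x ∈ ball x₀ (ρ * R), ∀ y ∈ ball x₀ (ρ * R), |w x - w y| ≤ δ := by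
  obtain ⟨θ, hθ0, hθ1, hdec⟩ := deGiorgi_decay n hQ (half_pos (omega_pos (n := n)))
  set σ : ℝ := min 1 (θ * δ) with hσ
  have hσ0 : 0 < σ := by positivity
  obtain ⟨J, hJ⟩ : ∃ J : ℕ, 2 * |L| * (1 - θ / 2) ^ J ≤ δ := by
    have := (tendsto_pow_atTop_nhds_zero_of_lt_one (r := 1 - θ / 2) (by linarith)
      (by linarith)).const_mul (2 * |L|)
    rw [mul_zero] at this
    obtain ⟨J, hJ⟩ := (this.eventually (gt_mem_nhds hδ)).exists
    exact ⟨J, hJ.le⟩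
  refine ⟨σ * (1 / 4) ^ (J + 1), by positivity, ?_, ?_⟩
  · calc σ * (1 / 4) ^ (J + 1) ≤ 1 * (1 / 4) ^ (J + 1) := by gcongr; exact min_le_left _ _
      _ < 1 := by rw [one_mul]; exact pow_lt_one₀ (by norm_num) (by norm_num) (by omega)
  intro w hw x₀ R hR hR1 hDG hDG' hL
  have key : ∀ j : ℕ, ∃ a b : ℝ, b - a ≤ max δ (2 * |L| * (1 - θ / 2) ^ j) ∧
      ∀ x ∈ ball x₀ (σ * (1 / 4) ^ j * R), a ≤ w x ∧ w x ≤ b := by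
    intro j
    induction j with
    | zero =>
      refine ⟨-|L|, |L|, ?_, fun x hx => ?_⟩
      · refine le_trans (le_of_eq ?_) (le_max_right _ _); simp; ring
      · have : |w x| ≤ |L| := (hL x (ball_subset_ball (by
          simp only [pow_zero, mul_one]
          have : σ ≤ 1 := min_le_left _ _
          nlinarith) hx)).trans (le_abs_self L)
        exact abs_le.1 this
    | succ j ih =>
      obtain ⟨a, b, hab, hw1⟩ := ih
      set r := σ * (1 / 4) ^ j * R with hr
      have hr0 : 0 < r := by positivity
      have hrr : σ * (1 / 4) ^ (j + 1) * R = r / 2 / 2 := by rw [hr, pow_succ]; ring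
      have hp1 : (1 / 4 : ℝ) ^ j ≤ 1 := pow_le_one₀ (by norm_num) (by norm_num)
      have hσ1 : σ ≤ 1 := min_le_left _ _
      have hrR : r ≤ R := by
        have : σ * (1 / 4) ^ j ≤ 1 := mul_le_one₀ hσ1 (by positivity) hp1
        rw [hr]; nlinarith
      rw [hrr]
      by_cases hsmall : b - a ≤ δ
      · exact ⟨a, b, hsmall.trans (le_max_left _ _), fun x hx =>
          hw1 x (ball_subset_ball (by linarith) hx)⟩
      push Not at hsmall
      have hrθ : r / 2 ≤ θ * ((b - a) / 2) := by
        have h1 : r ≤ σ := by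
          rw [hr, mul_assoc]
          exact mul_le_of_le_one_right hσ0.le (mul_le_one₀ hp1 hR.le hR1)
        have h2 : σ ≤ θ * δ := min_le_right _ _
        nlinarith
      have hgain : (b - a) * (1 - θ / 2) ≤ max δ (2 * |L| * (1 - θ / 2) ^ (j + 1)) := by
        rcases le_max_iff.1 hab with h | h
        · linarith
        · refine le_trans ?_ (le_max_right _ _)
          rw [pow_succ, ← mul_assoc]
          exact mul_le_mul_of_nonneg_right h (by linarith)
      have h2r : 2 * (r / 2) = r := by ring
      rcases half_ball_alternative w x₀ (R := r / 2) (by linarith) ((a + b) / 2) with h | h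
      · have := hdec w hw x₀ (r / 2) ((a + b) / 2) ((b - a) / 2) (by linarith) hrθ
          (fun k' _ => (hDG k').mono (by linarith))
          (fun x hx => by rw [h2r] at hx; linarith [(hw1 x hx).2]) h
        refine ⟨a, b - θ * ((b - a) / 2), le_trans (le_of_eq (by ring)) hgain, fun x hx => ⟨?_, ?_⟩⟩
        · exact (hw1 x (ball_subset_ball (by linarith) hx)).1
        · linarith [this x hx]
      · have := hdec (fun x => - w x) hw.neg x₀ (r / 2) (-((a + b) / 2)) ((b - a) / 2)
          (by linarith) hrθ (fun k' _ => (hDG' k').mono (by linarith))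
          (fun x hx => by rw [h2r] at hx; linarith [(hw1 x hx).1]) h
        refine ⟨a + θ * ((b - a) / 2), b, le_trans (le_of_eq (by ring)) hgain, fun x hx => ⟨?_, ?_⟩⟩
        · have := this x hx
          linarith
        · exact (hw1 x (ball_subset_ball (by linarith) hx)).2
  obtain ⟨a, b, hab, hw1⟩ := key (J + 1)
  have hfin : b - a ≤ δ := by
    refine hab.trans (max_le le_rfl (le_trans ?_ hJ))
    gcongr 2 * |L| * ?_
    exact pow_le_pow_of_le_one (by linarith) (by linarith) (by omega)
  intro x hx y hy
  have h1 := hw1 x hx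
  have h2 := hw1 y hy
  rw [abs_le]; constructor <;> linarith

/-- The structural data used after extracting global bounds from `(H0)` and `(H1)`. -/
structure Ell (F : Eucl n → ℝ → Eucl n → Eucl n) (F₀ : Eucl n → ℝ → Eucl n → ℝ)
    (ρ M lam Lam L : ℝ) (u : Eucl n → ℝ) : Prop where
  lam_pos : 0 < lam
  Lam_nonneg : 0 ≤ Lam
  L_nonneg : 0 ≤ L
  L_le : L + 3 ≤ M
  F_lip : ∀ x x' z z' p p', ‖F x z p - F x' z' p'‖ ≤ Lam * (‖x - x'‖ + |z - z'| + ‖p - p'‖)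
  F₀_lip : ∀ x x' z z' p p', |F₀ x z p - F₀ x' z' p'| ≤ Lam * (‖x - x'‖ + |z - z'| + ‖p - p'‖)
  F_bd : ∀ x z p, ‖F x z p‖ ≤ Lam
  F₀_bd : ∀ x z p, |F₀ x z p| ≤ Lam
  mono : ∀ x ∈ ball (0 : Eucl n) ρ, ∀ z : ℝ, |z| ≤ M → ∀ p q : Eucl n, ‖p‖ ≤ M → ‖q‖ ≤ M →
    lam * ‖p - q‖ ^ 2 ≤ ⟪F x z p - F x z q, p - q⟫_ℝ
  u_lip : ∀ x y, |u x - u y| ≤ L * ‖x - y‖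
  u_bd : ∀ x ∈ ball (0 : Eucl n) ρ, |u x| ≤ M - 1

/-- The first variation of the equation at `u` in the direction `φ`. -/
def En (F : Eucl n → ℝ → Eucl n → Eucl n) (F₀ : Eucl n → ℝ → Eucl n → ℝ)
    (u φ : Eucl n → ℝ) : ℝ :=
  ∫ x, (⟪F x (u x) (gradient u x), gradient φ x⟫_ℝ + F₀ x (u x) (gradient u x) * φ x)

variable {F : Eucl n → ℝ → Eucl n → Eucl n} {F₀ : Eucl n → ℝ → Eucl n → ℝ}
  {ρ M lam Lam L : ℝ} {u : Eucl n → ℝ}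

namespace Ell

lemma isLip (h : Ell F F₀ ρ M lam Lam L u) : IsLip u := .of_abs_sub_le h.u_lip

lemma grad_le (h : Ell F F₀ ρ M lam Lam L u) (x : Eucl n) : ‖gradient u x‖ ≤ L := by
  have h1 : LipschitzWith L.toNNReal u := by
    refine LipschitzWith.of_dist_le_mul fun x y => ?_
    rw [Real.coe_toNNReal _ h.L_nonneg, Real.dist_eq, dist_eq_norm]
    exact h.u_lip x y
  simpa [Real.coe_toNNReal _ h.L_nonneg] using h1.norm_gradient_le x

lemma F_continuous (h : Ell F F₀ ρ M lam Lam L u) :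
    Continuous fun q : Eucl n × ℝ × Eucl n => F q.1 q.2.1 q.2.2 := by
  refine LipschitzWith.continuous (K := (3 * Lam).toNNReal) (LipschitzWith.of_dist_le_mul ?_)
  intro x y
  rw [Real.coe_toNNReal _ (by have := h.Lam_nonneg; positivity), dist_eq_norm, dist_eq_norm]
  refine (h.F_lip _ _ _ _ _ _).trans ?_
  have h1 := norm_fst_le (x - y)
  have h2 := norm_snd_le (x - y)
  have h3 := norm_fst_le (x - y).2
  have h4 := norm_snd_le (x - y).2
  have h5 : ‖x.1 - y.1‖ + |x.2.1 - y.2.1| + ‖x.2.2 - y.2.2‖ ≤ 3 * ‖x - y‖ := by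
    simp only [Prod.fst_sub, Prod.snd_sub, Real.norm_eq_abs] at *
    linarith
  nlinarith [mul_le_mul_of_nonneg_left h5 h.Lam_nonneg]

lemma F₀_continuous (h : Ell F F₀ ρ M lam Lam L u) :
    Continuous fun q : Eucl n × ℝ × Eucl n => F₀ q.1 q.2.1 q.2.2 := by
  refine LipschitzWith.continuous (K := (3 * Lam).toNNReal) (LipschitzWith.of_dist_le_mul ?_)
  intro x y
  rw [Real.coe_toNNReal _ (by have := h.Lam_nonneg; positivity), dist_eq_norm, dist_eq_norm]
  refine (h.F₀_lip _ _ _ _ _ _).trans ?_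
  have h1 := norm_fst_le (x - y)
  have h2 := norm_snd_le (x - y)
  have h3 := norm_fst_le (x - y).2
  have h4 := norm_snd_le (x - y).2
  have h5 : ‖x.1 - y.1‖ + |x.2.1 - y.2.1| + ‖x.2.2 - y.2.2‖ ≤ 3 * ‖x - y‖ := by
    simp only [Prod.fst_sub, Prod.snd_sub, Real.norm_eq_abs] at *
    linarith
  nlinarith [mul_le_mul_of_nonneg_left h5 h.Lam_nonneg]

lemma measurable_F (h : Ell F F₀ ρ M lam Lam L u) {φ : Eucl n → ℝ} (hφ : Measurable φ) :
    Measurable fun x => F x (φ x) (gradient φ x) :=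
  h.F_continuous.measurable.comp
    (measurable_id.prodMk (hφ.prodMk (measurable_gradient φ)))

lemma measurable_F₀ (h : Ell F F₀ ρ M lam Lam L u) {φ : Eucl n → ℝ} (hφ : Measurable φ) :
    Measurable fun x => F₀ x (φ x) (gradient φ x) :=
  h.F₀_continuous.measurable.comp
    (measurable_id.prodMk (hφ.prodMk (measurable_gradient φ)))

end Ell

lemma gradient_eq_zero_of_support {φ : Eucl n → ℝ} {x₀ : Eucl n} {r : ℝ}
    (h0 : ∀ x ∉ closedBall x₀ r, φ x = 0) {x : Eucl n} (hx : x ∉ closedBall x₀ r) :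
    gradient φ x = 0 := gradient_eq_zero_of_notMem isClosed_closedBall h0 hx

lemma integrable_of_bound_support {f : Eucl n → ℝ} {C : ℝ} (hf : Measurable f)
    {x₀ : Eucl n} {r : ℝ} (h0 : ∀ x ∉ closedBall x₀ r, f x = 0) (h : ∀ x, |f x| ≤ C) :
    Integrable f := by
  rw [← integrableOn_iff_integrable_of_support_subset (s := closedBall x₀ r)]
  · exact abs_integrableOn_of_bound hf measure_closedBall_lt_top.ne h
  · intro x hx
    by_contra hc
    exact hx (h0 x hc)

/-- Pairings of bounded measurable fields with compactly supported Lipschitz functions. -/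
lemma integrable_pairing {V : Eucl n → Eucl n} {f φ : Eucl n → ℝ} {A : ℝ} (hV : Measurable V)
    (hf : Measurable f) (hVb : ∀ x, ‖V x‖ ≤ A) (hfb : ∀ x, |f x| ≤ A) (hφ : IsLip φ)
    {x₀ : Eucl n} {r : ℝ} (h0 : ∀ x ∉ closedBall x₀ r, φ x = 0) :
    Integrable fun x => ⟪V x, gradient φ x⟫_ℝ + f x * φ x := by
  obtain ⟨B, hB, hφB⟩ := hφ.exists_bound_of_support h0
  obtain ⟨C, hC, hφC⟩ := hφ.exists_gradient_bound
  refine integrable_of_bound_support (x₀ := x₀) (r := r) (C := A * C + A * B) ?_ ?_ ?_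
  · exact (hV.inner (measurable_gradient φ)).add (hf.mul hφ.measurable)
  · intro x hx
    rw [h0 x hx, gradient_eq_zero_of_support h0 hx]; simp
  · intro x
    have hA : 0 ≤ A := (norm_nonneg _).trans (hVb x)
    refine (abs_add_le _ _).trans (add_le_add ?_ ?_)
    · exact (abs_real_inner_le_norm _ _).trans
        (mul_le_mul (hVb x) (hφC x) (norm_nonneg _) hA)
    · rw [abs_mul]
      exact mul_le_mul (hfb x) (hφB x) (abs_nonneg _) hA

lemma En_neg (φ : Eucl n → ℝ) : En F F₀ u (fun x => - φ x) = - En F F₀ u φ := by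
  unfold En
  rw [← integral_neg]
  congr 1; ext x
  have : gradient (fun x => - φ x) x = - gradient φ x := by
    unfold gradient
    rw [fderiv_fun_neg, map_neg]
  rw [this, inner_neg_right]; ring

lemma gradient_comp_sub (φ : Eucl n → ℝ) (b x : Eucl n) :
    gradient (fun y => φ (y - b)) x = gradient φ (x - b) := by
  unfold gradient
  rw [fderiv_comp_sub]

lemma gradient_comp_add (φ : Eucl n → ℝ) (b x : Eucl n) :
    gradient (fun y => φ (y + b)) x = gradient φ (x + b) := by
  unfold gradient
  rw [fderiv_comp_add_right]

lemma En_comp_sub (φ : Eucl n → ℝ) (b : Eucl n) :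
    En F F₀ u (fun x => φ (x - b)) =
      ∫ x, (⟪F (x + b) (u (x + b)) (gradient u (x + b)), gradient φ x⟫_ℝ +
        F₀ (x + b) (u (x + b)) (gradient u (x + b)) * φ x) := by
  unfold En
  rw [← integral_add_right_eq_self _ b]
  simp only [gradient_comp_sub, add_sub_cancel_right]

/-- Pointwise coercivity of the differentiated equation. -/
lemma caccioppoli_pointwise {lam Lam C₁ T η a D : ℝ} (hlam : 0 < lam)
    (h : lam * a ^ 2 - C₁ * a - 3 * Lam * a * D - 3 * C₁ * D ≤ T) (hη : η = a) :
    lam / 2 * η ^ 2 ≤ T + (C₁ ^ 2 / lam + 9 * Lam ^ 2 / lam + 9 / 4 * C₁ ^ 2 + 1) *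
      (D ^ 2 + 1) := by
  subst hη
  have e1 : C₁ * η ≤ lam / 4 * η ^ 2 + C₁ ^ 2 / lam := by
    have : 0 ≤ (lam * η / 2 - C₁) ^ 2 / lam := by positivity
    have e : (lam * η / 2 - C₁) ^ 2 / lam = lam / 4 * η ^ 2 - C₁ * η + C₁ ^ 2 / lam := by
      field_simp; ring
    linarith
  have e2 : 3 * Lam * η * D ≤ lam / 4 * η ^ 2 + 9 * Lam ^ 2 / lam * D ^ 2 := by
    have : 0 ≤ (lam * η / 2 - 3 * Lam * D) ^ 2 / lam := by positivity
    have e : (lam * η / 2 - 3 * Lam * D) ^ 2 / lam =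
        lam / 4 * η ^ 2 - 3 * Lam * η * D + 9 * Lam ^ 2 / lam * D ^ 2 := by
      field_simp; ring
    linarith
  have e3 : 3 * C₁ * D ≤ 9 / 4 * C₁ ^ 2 + D ^ 2 := by nlinarith [sq_nonneg (3 / 2 * C₁ - D)]
  have p1 : 0 ≤ C₁ ^ 2 / lam := by positivity
  have p2 : 0 ≤ 9 * Lam ^ 2 / lam := by positivity
  have p3 : 0 ≤ 9 / 4 * C₁ ^ 2 := by positivity
  nlinarith [mul_nonneg p1 (sq_nonneg D), mul_nonneg p3 (sq_nonneg D)]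

lemma caccioppoli_algebra {lam Lam C₁ t v G γ a b c d : ℝ} (_ : 0 < lam) (hLam : 0 ≤ Lam)
    (hC₁0 : 0 ≤ C₁) (hη0 : 0 ≤ t) (hη1 : t ≤ 1) (hv : 0 ≤ v) (hG0 : 0 ≤ G) (hγ : 1 ≤ γ)
    (b1 : -(C₁ * G) ≤ a) (b2 : lam * G ^ 2 ≤ b) (b3 : -((C₁ + Lam * G) * γ) ≤ c)
    (b4 : -(C₁ + Lam * G) ≤ d) :
    lam * (t * G) ^ 2 - C₁ * (t * G) - 3 * Lam * (t * G) * (v * γ) - 3 * C₁ * (v * γ) ≤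
      t * t * (a + b) + 2 * t * v * c + t * t * v * d := by
  have hγ0 : 0 ≤ γ := by linarith
  have c1 : t * t * (lam * G ^ 2 - C₁ * G) ≤ t * t * (a + b) :=
    mul_le_mul_of_nonneg_left (by linarith) (by positivity)
  have c3 : 2 * t * v * (-((C₁ + Lam * G) * γ)) ≤ 2 * t * v * c :=
    mul_le_mul_of_nonneg_left b3 (by positivity)
  have c4 : t * t * v * (-(C₁ + Lam * G)) ≤ t * t * v * d :=
    mul_le_mul_of_nonneg_left b4 (by positivity)
  have tt : t * t ≤ t := mul_le_of_le_one_left hη0 hη1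
  have d1 : t * t * (C₁ * G) ≤ t * (C₁ * G) := mul_le_mul_of_nonneg_right tt (by positivity)
  have d2 : t * (v * γ * C₁) ≤ v * γ * C₁ := mul_le_of_le_one_left (by positivity) hη1
  have d3 : t * t * (v * (C₁ + Lam * G)) ≤ t * (v * (C₁ + Lam * G)) :=
    mul_le_mul_of_nonneg_right tt (by positivity)
  have d4 : t * (v * (C₁ + Lam * G)) * 1 ≤ t * (v * (C₁ + Lam * G)) * γ :=
    mul_le_mul_of_nonneg_left hγ (by positivity)
  linarith

/-- The constant in the Caccioppoli inequality for difference quotients. -/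
def caccQ (lam Lam L : ℝ) : ℝ :=
  2 * ((Lam * (1 + L)) ^ 2 / lam + 9 * Lam ^ 2 / lam + 9 / 4 * (Lam * (1 + L)) ^ 2 + 1) / lam

lemma caccQ_nonneg (hlam : 0 < lam) : 0 ≤ caccQ lam Lam L := by
  unfold caccQ; positivity

/-- The difference quotient with increment `b` and step `h`. -/
def dq (u : Eucl n → ℝ) (b : Eucl n) (h : ℝ) (x : Eucl n) : ℝ := (u (x + b) - u x) / h

lemma dq_isLip (hu : IsLip u) (b : Eucl n) (h : ℝ) : IsLip (dq u b h) := by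
  have := ((hu.comp_add b).sub hu).const_mul h⁻¹
  refine (this : IsLip _) |> fun H => ?_
  convert H using 2
  unfold dq; rw [div_eq_inv_mul]

lemma ae_comp_add {p : Eucl n → Prop} (h : ∀ᵐ x, p x) (b : Eucl n) :
    ∀ᵐ x : Eucl n, p (x + b) :=
  (measurePreserving_add_right (volume : Measure (Eucl n)) b).quasiMeasurePreserving.ae h

lemma Ell.caccioppoli_core (hE : Ell F F₀ ρ M lam Lam L u) {b x : Eucl n} {h k γ : ℝ}
    {η : Eucl n → ℝ} (hh : h ≠ 0) (hb : ‖b‖ ≤ |h|) (hx : x ∈ ball (0 : Eucl n) ρ)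
    (hγ : 1 ≤ γ) (hη0 : 0 ≤ η x) (hη1 : η x ≤ 1) (hηγ : ‖gradient η x‖ ≤ γ)
    (hηd : DifferentiableAt ℝ η x)
    (hd : DifferentiableAt ℝ u x) (hdb : DifferentiableAt ℝ u (x + b)) (hk : k < dq u b h x) :
    lam / 2 * (η x * ‖gradient (pp (dq u b h) k) x‖) ^ 2 ≤
      (⟪F (x + b) (u (x + b)) (gradient u (x + b)) - F x (u x) (gradient u x),
          gradient (fun y => η y * η y * pp (dq u b h) k y) x⟫_ℝ +
        (F₀ (x + b) (u (x + b)) (gradient u (x + b)) - F₀ x (u x) (gradient u x)) *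
          (η x * η x * pp (dq u b h) k x)) / h +
      lam / 2 * caccQ lam Lam L * ((pp (dq u b h) k x * γ) ^ 2 + 1) := by
  set w := dq u b h with hw
  have hwl : IsLip w := dq_isLip hE.isLip b h
  have hdb' : DifferentiableAt ℝ (fun y => u (y + b)) x := by
    rw [← differentiableAt_comp_add_right] at hdb; exact hdb
  have hwd : DifferentiableAt ℝ w x := by
    have e : w = fun y => (u (y + b) - u y) * h⁻¹ := by
      ext y; rw [hw]; unfold dq; rw [div_eq_mul_inv]
    rw [e]
    exact (hdb'.fun_sub hd).mul_const h⁻¹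
  have hwg : gradient w x = h⁻¹ • (gradient u (x + b) - gradient u x) := by
    have : w = fun y => h⁻¹ * (u (y + b) - u y) := by
      ext y; rw [hw]; unfold dq; rw [div_eq_inv_mul]
    rw [this, gradient_const_mul (hdb'.fun_sub hd), gradient_sub hdb' hd, gradient_comp_add]
  set P := gradient u (x + b) with hP
  set p := gradient u x with hp
  set v := pp w k with hv
  have hvx : 0 ≤ v x := pp_nonneg _ _ _
  have hvg : gradient v x = gradient w x := gradient_pp_of_gt hwl.continuous hk
  have hvd : DifferentiableAt ℝ v x := by
    have : v =ᶠ[𝓝 x] fun y => w y - k := by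
      filter_upwards [hwl.continuous.continuousAt.eventually (lt_mem_nhds hk)] with y hy
      exact pp_of_ge hy.le
    exact (hwd.sub_const k).congr_of_eventuallyEq this
  have hφg : gradient (fun y => η y * η y * v y) x =
      (η x * η x) • gradient w x + (2 * η x * v x) • gradient η x := by
    rw [gradient_mul (hηd.fun_mul hηd) hvd, gradient_mul hηd hηd, hvg, smul_add, smul_smul,
      ← add_smul]
    congr 2; ring
  set G := ‖gradient w x‖ with hG
  have hPp : ‖P - p‖ = |h| * G := by
    rw [hG, hwg, norm_smul, norm_inv, Real.norm_eq_abs, mul_inv_cancel_left₀ (abs_pos.2 hh).ne']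
  have hPp' : P - p = h • gradient w x := by rw [hwg, smul_inv_smul₀ hh]
  have hPn : ‖P‖ ≤ M := (hE.grad_le _).trans (by linarith [hE.L_le])
  have hpn : ‖p‖ ≤ M := (hE.grad_le _).trans (by linarith [hE.L_le])
  have hmono := hE.mono x hx (u x) ((hE.u_bd x hx).trans (by linarith)) P p hPn hpn
  have hub : |u (x + b) - u x| ≤ L * |h| := by
    have := hE.u_lip (x + b) x
    rw [add_sub_cancel_left] at this
    exact this.trans (mul_le_mul_of_nonneg_left hb hE.L_nonneg)
  set A₁ := F (x + b) (u (x + b)) P - F x (u x) P with hA₁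
  set A₂ := F x (u x) P - F x (u x) p with hA₂
  set a₀ := F₀ (x + b) (u (x + b)) P - F₀ x (u x) p with ha₀
  have hLam := hE.Lam_nonneg
  have hah : 0 < |h| := abs_pos.2 hh
  have n1 : ‖A₁‖ ≤ Lam * (1 + L) * |h| := by
    refine (hE.F_lip _ _ _ _ _ _).trans ?_
    rw [sub_self, norm_zero, add_sub_cancel_left, mul_assoc]
    refine mul_le_mul_of_nonneg_left ?_ hLam
    linarith
  have n2 : ‖A₂‖ ≤ Lam * (|h| * G) := by
    refine (hE.F_lip _ _ _ _ _ _).trans ?_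
    rw [sub_self, sub_self, norm_zero, abs_zero, hPp]; simp
  have n3 : |a₀| ≤ (Lam * (1 + L) + Lam * G) * |h| := by
    refine (hE.F₀_lip _ _ _ _ _ _).trans ?_
    rw [add_sub_cancel_left, hPp]
    have : Lam * (‖b‖ + |u (x + b) - u x| + |h| * G) ≤ Lam * (|h| + L * |h| + |h| * G) :=
      mul_le_mul_of_nonneg_left (by linarith) hLam
    linarith
  have hsplit : F (x + b) (u (x + b)) P - F x (u x) p = A₁ + A₂ := by
    rw [hA₁, hA₂]; abel
  rw [hvg, hφg, hsplit]
  set g := gradient w x with hg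
  set e := gradient η x with he
  have hG0 : 0 ≤ G := norm_nonneg _
  have hγ0 : 0 ≤ γ := by linarith
  set C₁ := Lam * (1 + L) with hC₁
  have hC₁0 : 0 ≤ C₁ := mul_nonneg hLam (by linarith [hE.L_nonneg])
  -- divided quantities
  have q1 : |⟪A₁, g⟫_ℝ / h| ≤ C₁ * G := by
    rw [abs_div, div_le_iff₀ hah]
    calc _ ≤ ‖A₁‖ * ‖g‖ := abs_real_inner_le_norm _ _
      _ ≤ (C₁ * |h|) * G := mul_le_mul_of_nonneg_right n1 hG0
      _ = _ := by ring
  have q2 : lam * G ^ 2 ≤ ⟪A₂, g⟫_ℝ / h := by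
    rw [hPp', real_inner_smul_right, norm_smul, Real.norm_eq_abs, mul_pow, sq_abs] at hmono
    have : ⟪A₂, g⟫_ℝ / h = (h * ⟪A₂, g⟫_ℝ) / h ^ 2 := by field_simp
    rw [this, le_div_iff₀ (by positivity)]
    linarith
  have q3 : |⟪A₁ + A₂, e⟫_ℝ / h| ≤ (C₁ + Lam * G) * γ := by
    rw [abs_div, div_le_iff₀ hah]
    calc _ ≤ ‖A₁ + A₂‖ * ‖e‖ := abs_real_inner_le_norm _ _
      _ ≤ ((C₁ + Lam * G) * |h|) * γ := by
          refine mul_le_mul ((norm_add_le _ _).trans ?_) hηγ (norm_nonneg _) (by positivity)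
          linarith
      _ = _ := by ring
  have q4 : |a₀ / h| ≤ C₁ + Lam * G := by
    rw [abs_div, div_le_iff₀ hah]; exact n3
  have hT : (⟪A₁ + A₂, (η x * η x) • g + (2 * η x * v x) • e⟫_ℝ + a₀ * (η x * η x * v x)) / h =
      η x * η x * (⟪A₁, g⟫_ℝ / h + ⟪A₂, g⟫_ℝ / h) + 2 * η x * v x * (⟪A₁ + A₂, e⟫_ℝ / h) +
        η x * η x * v x * (a₀ / h) := by
    rw [inner_add_right, real_inner_smul_right, real_inner_smul_right, inner_add_left]
    ring
  have hcq : lam / 2 * caccQ lam Lam L =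
      C₁ ^ 2 / lam + 9 * Lam ^ 2 / lam + 9 / 4 * C₁ ^ 2 + 1 := by
    unfold caccQ
    have := hE.lam_pos.ne'
    rw [hC₁]; field_simp
  rw [hcq, hT]
  refine caccioppoli_pointwise hE.lam_pos ?_ rfl
  exact caccioppoli_algebra hE.lam_pos hE.Lam_nonneg hC₁0 hη0 hη1 hvx hG0 hγ
    (neg_le_of_abs_le q1) q2 (neg_le_of_abs_le q3) (neg_le_of_abs_le q4)

/-- The truncated difference quotient times a squared cutoff. -/
def testFn (w : Eucl n → ℝ) (x₀ : Eucl n) (r s k : ℝ) (y : Eucl n) : ℝ :=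
  cutoff x₀ r s y * cutoff x₀ r s y * pp w k y

lemma testFn_nonneg (w : Eucl n → ℝ) (x₀ : Eucl n) (r s k : ℝ) (y : Eucl n) :
    0 ≤ testFn w x₀ r s k y :=
  mul_nonneg (mul_nonneg (cutoff_nonneg _) (cutoff_nonneg _)) (pp_nonneg _ _ _)

lemma testFn_le (w : Eucl n → ℝ) (x₀ : Eucl n) (r s k : ℝ) (y : Eucl n) :
    testFn w x₀ r s k y ≤ pp w k y :=
  mul_le_of_le_one_left (pp_nonneg _ _ _)
    (mul_le_one₀ (cutoff_le_one _) (cutoff_nonneg _) (cutoff_le_one _))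

lemma testFn_of_notMem {w : Eucl n → ℝ} {x₀ : Eucl n} {r s k : ℝ} (hrs : r < s) {y : Eucl n}
    (hy : y ∉ ball x₀ s) : testFn w x₀ r s k y = 0 := by
  unfold testFn; rw [cutoff_eq_zero_of_notMem hrs hy]; ring

lemma testFn_isLip {w : Eucl n → ℝ} (hw : IsLip w) {x₀ : Eucl n} {r s k : ℝ} (hrs : r < s) :
    IsLip (testFn w x₀ r s k) := by
  have h1 : IsLip fun y => cutoff x₀ r s y * cutoff x₀ r s y :=
    (cutoff_isLip hrs).mul_of_bounded (cutoff_isLip hrs) (A := 1) (B := 1) abs_cutoff_le_one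
      fun x _ => abs_cutoff_le_one x
  refine h1.mul_of_support (pp_isLip hw k) (A := 1) (x₀ := x₀) (R := s) ?_ ?_
  · intro x
    rw [abs_mul]
    exact mul_le_one₀ (abs_cutoff_le_one x) (abs_nonneg _) (abs_cutoff_le_one x)
  · intro x hx
    rw [cutoff_eq_zero_of_notMem hrs fun h => hx (ball_subset_closedBall h), zero_mul]

lemma Ell.dgAt (hE : Ell F F₀ ρ M lam Lam L u) {b x₀ : Eucl n} {h k R : ℝ}
    (hh : h ≠ 0) (hb : ‖b‖ ≤ |h|) (hR : R ≤ 1) (hball : ball x₀ R ⊆ ball 0 ρ)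
    (hEn : ∀ r s, 0 < r → r < s → s ≤ R →
      (En F F₀ u (fun x => testFn (dq u b h) x₀ r s k (x - b)) -
        En F F₀ u (testFn (dq u b h) x₀ r s k)) / h ≤ 0) :
    DGAt (caccQ lam Lam L) (dq u b h) x₀ R k := by
  intro r s hr hrs hsR
  set w := dq u b h with hw
  have hwl : IsLip w := dq_isLip hE.isLip b h
  set φ := testFn w x₀ r s k with hφ
  have hφl : IsLip φ := testFn_isLip hwl hrs
  have hφ0 : ∀ x ∉ closedBall x₀ s, φ x = 0 := fun x hx =>
    testFn_of_notMem hrs fun h => hx (ball_subset_closedBall h)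
  have hφ0' : ∀ x ∉ ball x₀ s, φ x = 0 := fun x hx => testFn_of_notMem hrs hx
  set η := cutoff x₀ r s with hη
  set γ := (s - r)⁻¹ with hγ
  have hsr : 0 < s - r := by linarith
  have hγ1 : 1 ≤ γ := by
    rw [hγ]; exact (one_le_inv₀ hsr).2 (by linarith)
  set Q := caccQ lam Lam L with hQ
  set T := fun x => (⟪F (x + b) (u (x + b)) (gradient u (x + b)) - F x (u x) (gradient u x),
        gradient φ x⟫_ℝ +
      (F₀ (x + b) (u (x + b)) (gradient u (x + b)) - F₀ x (u x) (gradient u x)) * φ x) / h with hT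
  have mA := hE.measurable_F hE.isLip.measurable
  have ma := hE.measurable_F₀ hE.isLip.measurable
  have mb : Measurable fun x : Eucl n => x + b := measurable_add_const b
  have i1 : Integrable fun x => ⟪F (x + b) (u (x + b)) (gradient u (x + b)), gradient φ x⟫_ℝ +
      F₀ (x + b) (u (x + b)) (gradient u (x + b)) * φ x :=
    integrable_pairing (A := Lam) (mA.comp mb) (ma.comp mb) (fun x => hE.F_bd _ _ _)
      (fun x => hE.F₀_bd _ _ _) hφl hφ0
  have i2 : Integrable fun x => ⟪F x (u x) (gradient u x), gradient φ x⟫_ℝ +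
      F₀ x (u x) (gradient u x) * φ x :=
    integrable_pairing (A := Lam) mA ma (fun x => hE.F_bd _ _ _)
      (fun x => hE.F₀_bd _ _ _) hφl hφ0
  have hTeq : T = fun x => ((⟪F (x + b) (u (x + b)) (gradient u (x + b)), gradient φ x⟫_ℝ +
      F₀ (x + b) (u (x + b)) (gradient u (x + b)) * φ x) -
      (⟪F x (u x) (gradient u x), gradient φ x⟫_ℝ + F₀ x (u x) (gradient u x) * φ x)) / h := by
    ext x; simp only [hT]; rw [inner_sub_left]; ring
  have iT : Integrable T := by
    rw [hTeq]; exact (i1.sub i2).div_const h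
  have hTint : ∫ x, T x ≤ 0 := by
    have : ∫ x, T x = (En F F₀ u (fun x => φ (x - b)) - En F F₀ u φ) / h := by
      rw [En_comp_sub, En, ← integral_sub i1 i2, ← integral_div, hTeq]
    rw [this]; exact hEn r s hr hrs hsR
  have hTs : ∫ x in ball x₀ s, T x ≤ 0 := by
    rw [setIntegral_of_support]
    · exact hTint
    · intro x hx
      have hg : gradient φ x = 0 := by
        refine gradient_eq_zero_of_isLocalMin (Eventually.of_forall fun y => ?_)
        rw [hφ0' x hx]; exact testFn_nonneg _ _ _ _ _ _
      simp only [hT]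
      rw [hg, hφ0' x hx]; simp
  set S := {x | k < w x} ∩ ball x₀ s with hS
  have mS : MeasurableSet S := measurableSet_superlevel hwl k x₀ s
  have hkey : ∀ᵐ x, x ∈ ball x₀ s → (ball x₀ r).indicator
      (fun x => lam / 2 * ‖gradient (pp w k) x‖ ^ 2) x ≤
      T x + lam / 2 * Q * γ ^ 2 * pp w k x ^ 2 + S.indicator (fun _ => lam / 2 * Q) x := by
    filter_upwards [hE.isLip.ae_differentiableAt, ae_comp_add hE.isLip.ae_differentiableAt b,
      (cutoff_isLip (x₀ := x₀) hrs).ae_differentiableAt] with x h1 h2 h3 hx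
    have hlam := hE.lam_pos
    by_cases hk : k < w x
    · have hcore := hE.caccioppoli_core (γ := γ) (η := η) hh hb
        (hball (ball_subset_ball hsR hx)) hγ1
        (cutoff_nonneg x) (cutoff_le_one x) (norm_gradient_cutoff_le hrs x) h3 h1 h2 hk
      have hTx : T x = (⟪F (x + b) (u (x + b)) (gradient u (x + b)) - F x (u x) (gradient u x),
          gradient (fun y => η y * η y * pp (dq u b h) k y) x⟫_ℝ +
        (F₀ (x + b) (u (x + b)) (gradient u (x + b)) - F₀ x (u x) (gradient u x)) *
          (η x * η x * pp (dq u b h) k x)) / h := rfl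
      rw [← hTx] at hcore
      rw [Set.indicator_of_mem (show x ∈ S from ⟨hk, hx⟩)]
      have h4 : (ball x₀ r).indicator (fun x => lam / 2 * ‖gradient (pp w k) x‖ ^ 2) x ≤
          lam / 2 * (η x * ‖gradient (pp (dq u b h) k) x‖) ^ 2 := by
        by_cases hxr : x ∈ ball x₀ r
        · rw [Set.indicator_of_mem hxr, hη, cutoff_eq_one hrs (mem_ball_iff_norm.1 hxr).le, one_mul]
        · rw [Set.indicator_of_notMem hxr]; positivity
      have h5 : lam / 2 * Q * ((pp w k x * γ) ^ 2 + 1) =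
          lam / 2 * Q * γ ^ 2 * pp w k x ^ 2 + lam / 2 * Q := by ring
      linarith
    · have hk' : w x ≤ k := not_lt.1 hk
      have hv : pp w k x = 0 := pp_of_le hk'
      have hφx : φ x = 0 := by
        change cutoff x₀ r s x * cutoff x₀ r s x * pp w k x = 0
        rw [hv, mul_zero]
      have hg : gradient φ x = 0 := by
        refine gradient_eq_zero_of_isLocalMin (Eventually.of_forall fun y => ?_)
        rw [hφx]; exact testFn_nonneg _ _ _ _ _ _
      have hTx : T x = 0 := by
        simp only [hT]; rw [hg, hφx]; simp
      rw [Set.indicator_of_notMem (fun hc : x ∈ S => hk hc.1), hTx, hv]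
      by_cases hxr : x ∈ ball x₀ r
      · rw [Set.indicator_of_mem hxr, gradient_pp_of_le hk']; simp
      · rw [Set.indicator_of_notMem hxr]; simp
  have ipp : IntegrableOn (fun x => lam / 2 * Q * γ ^ 2 * pp w k x ^ 2) (ball x₀ s) :=
    ((pp_isLip hwl k).sq_integrableOn x₀ s).const_mul _
  have iS : IntegrableOn (S.indicator fun _ => lam / 2 * Q) (ball x₀ s) := by
    refine IntegrableOn.indicator ?_ mS
    exact integrableOn_const measure_ball_lt_top.ne
  have ig : IntegrableOn (fun x => lam / 2 * ‖gradient (pp w k) x‖ ^ 2) (ball x₀ s) :=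
    ((pp_isLip hwl k).gradient_sq_integrableOn x₀ s).const_mul _
  have iTp : IntegrableOn (fun x => T x + lam / 2 * Q * γ ^ 2 * pp w k x ^ 2) (ball x₀ s) :=
    iT.integrableOn.add ipp
  have h_int := setIntegral_mono_on_ae (ig.indicator (measurableSet_ball (x := x₀) (ε := r)))
    (iTp.add iS : IntegrableOn (fun x => T x + lam / 2 * Q * γ ^ 2 * pp w k x ^ 2 +
      S.indicator (fun _ => lam / 2 * Q) x) (ball x₀ s)) measurableSet_ball hkey
  rw [setIntegral_indicator measurableSet_ball, integral_add iTp iS,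
    integral_add iT.integrableOn ipp, setIntegral_indicator mS, setIntegral_const,
    integral_const_mul, integral_const_mul, Set.inter_eq_self_of_subset_right
      (ball_subset_ball hrs.le), Set.inter_eq_self_of_subset_right (Set.inter_subset_right),
    smul_eq_mul] at h_int
  have hlam := hE.lam_pos
  have e : Q / (s - r) ^ 2 = Q * γ ^ 2 := by rw [hγ]; field_simp
  rw [e]
  have := h_int.trans (add_le_add (add_le_add hTs le_rfl) le_rfl)
  have h2 : lam / 2 * ∫ x in ball x₀ r, ‖gradient (pp w k) x‖ ^ 2 ≤ lam / 2 *
      (Q * γ ^ 2 * (∫ x in ball x₀ s, pp w k x ^ 2) + Q * volume.real S) := by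
    linarith
  exact le_of_mul_le_mul_left h2 (by positivity)

/-- Lipschitz solutions of the thin obstacle problem with extracted structural data. -/
structure Sol (F : Eucl n → ℝ → Eucl n → Eucl n) (F₀ : Eucl n → ℝ → Eucl n → ℝ)
    (ρ M lam Lam L : ℝ) (u : Eucl n → ℝ) : Prop extends Ell F F₀ ρ M lam Lam L u where
  nonneg : ∀ x ∈ ball (0 : Eucl n) ρ, x (Fin.last n) = 0 → 0 ≤ u x
  thin : ∀ (φ : Eucl n → ℝ) (x₀ : Eucl n) (r ε : ℝ), IsLip φ → (∀ x ∉ closedBall x₀ r, φ x = 0) →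
    ‖x₀‖ + r < ρ → 0 < ε → (∀ x ∈ closedBall x₀ r, x (Fin.last n) = 0 → 0 ≤ u x + ε * φ x) →
    0 ≤ En F F₀ u φ

namespace Sol

lemma mem_of_closedBall {x₀ x : Eucl n} {r : ℝ} (h : ‖x₀‖ + r < ρ)
    (hx : x ∈ closedBall x₀ r) : x ∈ ball (0 : Eucl n) ρ := by
  rw [mem_closedBall_iff_norm] at hx
  rw [mem_ball_zero_iff]
  have : ‖x‖ ≤ ‖x - x₀‖ + ‖x₀‖ := by simpa using norm_add_le (x - x₀) x₀
  linarith

lemma En_nonneg (hS : Sol F F₀ ρ M lam Lam L u) {φ : Eucl n → ℝ} {x₀ : Eucl n} {r : ℝ}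
    (hφ : IsLip φ) (h0 : ∀ x ∉ closedBall x₀ r, φ x = 0) (hr : ‖x₀‖ + r < ρ)
    (hp : ∀ x ∈ closedBall x₀ r, x (Fin.last n) = 0 → 0 ≤ φ x) : 0 ≤ En F F₀ u φ := by
  refine hS.thin φ x₀ r 1 hφ h0 hr one_pos fun x hx hx0 => ?_
  have := hS.nonneg x (mem_of_closedBall hr hx) hx0
  linarith [hp x hx hx0]

lemma En_eq_zero (hS : Sol F F₀ ρ M lam Lam L u) {φ : Eucl n → ℝ} {x₀ : Eucl n} {r : ℝ}
    (hφ : IsLip φ) (h0 : ∀ x ∉ closedBall x₀ r, φ x = 0) (hr : ‖x₀‖ + r < ρ)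
    (hp : ∀ x ∈ closedBall x₀ r, x (Fin.last n) = 0 → 0 < u x) : En F F₀ u φ = 0 := by
  obtain ⟨A, hA, hφA⟩ := hφ.exists_bound_of_support h0
  obtain ⟨m, hm, hmu⟩ : ∃ m > 0, ∀ x ∈ closedBall x₀ r, x (Fin.last n) = 0 → m ≤ u x := by
    have hc : IsCompact (closedBall x₀ r ∩ {x : Eucl n | x (Fin.last n) = 0}) :=
      (isCompact_closedBall x₀ r).inter_right
        (isClosed_eq (by fun_prop) continuous_const)
    rcases Set.eq_empty_or_nonempty (closedBall x₀ r ∩ {x : Eucl n | x (Fin.last n) = 0}) with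
      he | hne
    · refine ⟨1, one_pos, fun x hx hx0 => ?_⟩
      have : x ∈ (∅ : Set (Eucl n)) := he ▸ ⟨hx, hx0⟩
      exact this.elim
    · obtain ⟨z, hz, hzm⟩ := hc.exists_isMinOn hne hS.isLip.continuous.continuousOn
      exact ⟨u z, hp z hz.1 hz.2, fun x hx hx0 => hzm ⟨hx, hx0⟩⟩
  have hεA : m / (A + 1) * A ≤ m := by
    rw [div_mul_eq_mul_div, div_le_iff₀ (by positivity)]; nlinarith
  have hε : 0 < m / (A + 1) := by positivity
  have key : ∀ ψ : Eucl n → ℝ, IsLip ψ → (∀ x ∉ closedBall x₀ r, ψ x = 0) →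
      (∀ x, |ψ x| ≤ A) → 0 ≤ En F F₀ u ψ := by
    intro ψ hψ hψ0 hψA
    refine hS.thin ψ x₀ r (m / (A + 1)) hψ hψ0 hr hε fun x hx hx0 => ?_
    have h1 := mul_le_mul_of_nonneg_left (neg_le_of_abs_le (hψA x)) hε.le
    linarith [hmu x hx hx0]
  have h1 := key φ hφ h0 hφA
  have h2 := key (fun x => - φ x) hφ.neg (fun x hx => by rw [h0 x hx, neg_zero])
    (fun x => by rw [abs_neg]; exact hφA x)
  rw [En_neg] at h2
  linarith

lemma dgAt_tangential (hS : Sol F F₀ ρ M lam Lam L u) {b x₀ : Eucl n} {h k R : ℝ} (hh : 0 < h)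
    (hk : 0 ≤ k) (hb : ‖b‖ ≤ h) (hbt : b (Fin.last n) = 0) (hR : R ≤ 1) (hρ : ‖x₀‖ + R + h < ρ) :
    DGAt (caccQ lam Lam L) (dq u b h) x₀ R k := by
  have hb' : ‖b‖ ≤ |h| := by rwa [abs_of_pos hh]
  refine hS.toEll.dgAt hh.ne' hb' hR ?_ ?_
  · intro x hx
    exact mem_of_closedBall (by linarith) (ball_subset_closedBall hx)
  · intro r s hr hrs hsR
    have hl := testFn_isLip (dq_isLip hS.isLip b h) (x₀ := x₀) (k := k) hrs
    have h1 : 0 ≤ En F F₀ u (testFn (dq u b h) x₀ r s k) :=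
      hS.En_nonneg (x₀ := x₀) (r := s) hl
        (fun x hx => testFn_of_notMem hrs fun h => hx (ball_subset_closedBall h))
        (by linarith) fun x _ _ => testFn_nonneg _ _ _ _ _ _
    have h2 : 0 ≤ En F F₀ u (fun x => - testFn (dq u b h) x₀ r s k (x - b)) := by
      have hmem : ∀ x, x - b ∈ closedBall x₀ s → x ∈ closedBall x₀ (s + h) := by
        intro x hx
        rw [mem_closedBall_iff_norm] at hx ⊢
        have e : x - x₀ = (x - b - x₀) + b := by abel
        rw [e]
        exact (norm_add_le _ _).trans (by linarith)
      refine hS.thin _ x₀ (s + h) h ?_ ?_ (by linarith) hh ?_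
      · have := (hl.comp_add (-b)).neg
        simpa only [← sub_eq_add_neg] using this
      · intro x hx
        rw [testFn_of_notMem hrs fun hc => hx (hmem x (ball_subset_closedBall hc)), neg_zero]
      · intro x hx hx0
        have hux : 0 ≤ u x := hS.nonneg x (mem_of_closedBall (by linarith) hx) hx0
        by_cases hxb : x - b ∈ ball x₀ s
        · have hxb0 : (x - b) (Fin.last n) = 0 := by simp [hx0, hbt]
          have hu' : 0 ≤ u (x - b) :=
            hS.nonneg _ (mem_of_closedBall (by linarith) (ball_subset_closedBall hxb)) hxb0
          have h3 := testFn_le (dq u b h) x₀ r s k (x - b)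
          have h4 : pp (dq u b h) k (x - b) ≤ u x / h := by
            refine max_le ?_ (by positivity)
            unfold dq
            rw [sub_add_cancel]
            have : (u x - u (x - b)) / h ≤ u x / h :=
              div_le_div_of_nonneg_right (by linarith) hh.le
            linarith
          have h5 := mul_le_mul_of_nonneg_left (h3.trans h4) hh.le
          rw [mul_div_cancel₀ _ hh.ne'] at h5
          linarith
        · rw [testFn_of_notMem hrs hxb]; linarith
    rw [En_neg] at h2
    exact div_nonpos_of_nonpos_of_nonneg (by linarith) hh.le

lemma dgAt_of_pos (hS : Sol F F₀ ρ M lam Lam L u) {b x₀ : Eucl n} {h k R : ℝ} (hh : h ≠ 0)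
    (hb : ‖b‖ ≤ |h|) (hR : R ≤ 1) (hρ : ‖x₀‖ + (R + |h|) < ρ)
    (hp : ∀ x ∈ closedBall x₀ (R + |h|), x (Fin.last n) = 0 → 0 < u x) :
    DGAt (caccQ lam Lam L) (dq u b h) x₀ R k := by
  have hah := abs_nonneg h
  refine hS.toEll.dgAt hh hb hR ?_ ?_
  · intro x hx
    exact mem_of_closedBall (by linarith) (ball_subset_closedBall hx)
  · intro r s hr hrs hsR
    have hl := testFn_isLip (dq_isLip hS.isLip b h) (x₀ := x₀) (k := k) hrs
    have h1 : En F F₀ u (testFn (dq u b h) x₀ r s k) = 0 := by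
      refine hS.En_eq_zero (x₀ := x₀) (r := R + |h|) hl ?_ hρ hp
      intro x hx
      exact testFn_of_notMem hrs fun hc => hx
        ((ball_subset_closedBall.trans (closedBall_subset_closedBall (by linarith))) hc)
    have h2 : En F F₀ u (fun x => testFn (dq u b h) x₀ r s k (x - b)) = 0 := by
      refine hS.En_eq_zero (x₀ := x₀) (r := R + |h|) ?_ ?_ hρ hp
      · have := hl.comp_add (-b)
        simpa only [← sub_eq_add_neg] using this
      · intro x hx
        refine testFn_of_notMem hrs fun hc => hx ?_
        rw [mem_ball_iff_norm] at hc
        rw [mem_closedBall_iff_norm]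
        have e : x - x₀ = (x - b - x₀) + b := by abel
        rw [e]
        exact (norm_add_le _ _).trans (by linarith)
    rw [h1, h2]; simp

end Sol

/-- `u` is `δ`-close to affine in the Lipschitz seminorm on the ball, with slope given by any of
its gradients. -/
def Flat (u : Eucl n → ℝ) (x₀ : Eucl n) (r δ : ℝ) : Prop :=
  ∀ y ∈ ball x₀ r, DifferentiableAt ℝ u y → ∀ x ∈ ball x₀ r, ∀ x' ∈ ball x₀ r,
    |u x' - u x - ⟪gradient u y, x' - x⟫_ℝ| ≤ δ * ‖x' - x‖

lemma tendsto_natCast_mul_sub {u : Eucl n → ℝ} {y : Eucl n} (hy : DifferentiableAt ℝ u y)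
    (b : Eucl n) :
    Tendsto (fun m : ℕ => (m : ℝ) * (u (y + (m : ℝ)⁻¹ • b) - u y)) atTop
      (𝓝 ⟪gradient u y, b⟫_ℝ) := by
  rw [inner_gradient]
  have h := hy.hasFDerivAt.lim (c := fun m : ℕ => (m : ℝ)) (l := atTop) b
    (tendsto_norm_atTop_atTop.comp tendsto_natCast_atTop_atTop)
  simpa using h

lemma flat_of_increments {u : Eucl n → ℝ} {x₀ : Eucl n} {r r₀ δ : ℝ} (hr₀ : 0 < r₀)
    (h : ∀ b : Eucl n, ‖b‖ ≤ r₀ → ∀ x ∈ ball x₀ r, ∀ y ∈ ball x₀ r,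
      |(u (x + b) - u x) - (u (y + b) - u y)| ≤ δ * ‖b‖) : Flat u x₀ r δ := by
  intro y hy hyd x hx x' hx'
  set b := x' - x with hb
  have hlim := tendsto_natCast_mul_sub hyd b
  have hlim2 : Tendsto (fun m : ℕ => |u x' - u x - (m : ℝ) * (u (y + (m : ℝ)⁻¹ • b) - u y)|)
      atTop (𝓝 |u x' - u x - ⟪gradient u y, b⟫_ℝ|) := (tendsto_const_nhds.sub hlim).abs
  refine le_of_tendsto hlim2 ?_
  obtain ⟨N, hN⟩ := exists_nat_gt (‖b‖ / r₀)
  filter_upwards [eventually_ge_atTop (N + 1)] with m hm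
  have hm0 : (0 : ℝ) < m := by
    have : 0 < m := by omega
    exact_mod_cast this
  have hbm : ‖(m : ℝ)⁻¹ • b‖ = ‖b‖ / m := by
    rw [norm_smul, norm_inv, Real.norm_natCast, div_eq_inv_mul]
  have hbr : ‖(m : ℝ)⁻¹ • b‖ ≤ r₀ := by
    rw [hbm, div_le_iff₀ hm0]
    rw [div_lt_iff₀ hr₀] at hN
    have : (N : ℝ) ≤ m := by exact_mod_cast (by omega : N ≤ m)
    nlinarith
  have htel : u x' - u x = ∑ i ∈ Finset.range m,
      (u ((x + (i * (m : ℝ)⁻¹ : ℝ) • b) + (m : ℝ)⁻¹ • b) - u (x + (i * (m : ℝ)⁻¹ : ℝ) • b)) := by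
    have := Finset.sum_range_sub (fun i : ℕ => u (x + (i * (m : ℝ)⁻¹ : ℝ) • b)) m
    simp only [Nat.cast_zero, zero_mul, zero_smul, add_zero] at this
    rw [mul_inv_cancel₀ hm0.ne', one_smul, hb, add_sub_cancel, ← hb] at this
    rw [← this]
    refine Finset.sum_congr rfl fun i _ => ?_
    congr 2
    rw [add_assoc, ← add_smul]
    push_cast
    congr 2; ring
  have hconst : (m : ℝ) * (u (y + (m : ℝ)⁻¹ • b) - u y) =
      ∑ i ∈ Finset.range m, (u (y + (m : ℝ)⁻¹ • b) - u y) := by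
    rw [Finset.sum_const, Finset.card_range, nsmul_eq_mul]
  rw [htel, hconst, ← Finset.sum_sub_distrib]
  refine (Finset.abs_sum_le_sum_abs _ _).trans ?_
  refine (Finset.sum_le_card_nsmul _ _ (δ * (‖b‖ / m)) fun i hi => ?_).trans ?_
  · rw [← hbm]
    refine h _ hbr _ ?_ y hy
    have hi' : (i : ℝ) * (m : ℝ)⁻¹ ≤ 1 := by
      rw [← div_eq_mul_inv, div_le_one hm0]
      exact_mod_cast (Finset.mem_range.1 hi).le
    have := (convex_ball x₀ r).add_smul_sub_mem hx hx' (t := i * (m : ℝ)⁻¹)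
      ⟨by positivity, hi'⟩
    exact this
  · rw [Finset.card_range, nsmul_eq_mul]
    apply le_of_eq; field_simp

lemma Flat.norm_gradient_sub_le {x₀ : Eucl n} {r δ : ℝ} (h : Flat u x₀ r δ) {y y' : Eucl n}
    (hy : y ∈ ball x₀ r) (hy' : y' ∈ ball x₀ r) (hd : DifferentiableAt ℝ u y)
    (hd' : DifferentiableAt ℝ u y') : ‖gradient u y - gradient u y'‖ ≤ 2 * δ := by
  have hr : 0 < r := pos_of_mem_ball hy
  set v := gradient u y - gradient u y' with hv
  by_cases hv0 : v = 0
  · rw [hv0, norm_zero]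
    have := h y hy hd x₀ (mem_ball_self hr)
    have hδ : 0 ≤ δ := by
      obtain ⟨e, he⟩ : ∃ e : Eucl n, e ≠ 0 := exists_ne 0
      have hen := norm_pos_iff.2 he
      have h1 := this (x₀ + (r / 2 / ‖e‖) • e) (by
        rw [mem_ball_iff_norm, add_sub_cancel_left, norm_smul, Real.norm_eq_abs,
          abs_of_pos (by positivity), div_mul_cancel₀ _ hen.ne']; linarith)
      have h2 := (abs_nonneg _).trans h1
      rw [add_sub_cancel_left, norm_smul, Real.norm_eq_abs,
          abs_of_pos (by positivity), div_mul_cancel₀ _ hen.ne'] at h2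
      nlinarith
    linarith
  have hvn : 0 < ‖v‖ := norm_pos_iff.2 hv0
  set t := r / 2 / ‖v‖ with ht
  have ht0 : 0 < t := by positivity
  have hx' : x₀ + t • v ∈ ball x₀ r := by
    rw [mem_ball_iff_norm, add_sub_cancel_left, norm_smul, Real.norm_eq_abs,
      abs_of_pos ht0, ht, div_mul_cancel₀ _ hvn.ne']; linarith
  have h1 := h y hy hd x₀ (mem_ball_self hr) _ hx'
  have h2 := h y' hy' hd' x₀ (mem_ball_self hr) _ hx'
  rw [add_sub_cancel_left, norm_smul, Real.norm_eq_abs, abs_of_pos ht0,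
    real_inner_smul_right] at h1 h2
  have h3 : ⟪gradient u y, v⟫_ℝ - ⟪gradient u y', v⟫_ℝ = ‖v‖ * ‖v‖ := by
    rw [← inner_sub_left, ← hv, real_inner_self_eq_norm_mul_norm]
  have h4 : t * (‖v‖ * ‖v‖) ≤ 2 * (δ * (t * ‖v‖)) := by
    rw [← h3]
    have a1 := abs_le.1 h1
    have a2 := abs_le.1 h2
    nlinarith
  have h5 : (t * ‖v‖) * ‖v‖ ≤ (t * ‖v‖) * (2 * δ) := by nlinarith
  exact le_of_mul_le_mul_left h5 (by positivity)

lemma exists_tendsto_of_osc {E' : Type*} [NormedAddCommGroup E'] [CompleteSpace E']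
    {f : Eucl n → E'} {S : Set (Eucl n)} {x₀ : Eucl n} (hS : (𝓝[S] x₀).NeBot)
    (h : ∀ δ > 0, ∃ r > 0, ∀ y ∈ S ∩ ball x₀ r, ∀ y' ∈ S ∩ ball x₀ r, ‖f y - f y'‖ ≤ δ) :
    ∃ G, Tendsto f (𝓝[S] x₀) (𝓝 G) := by
  refine cauchy_map_iff_exists_tendsto.1 ?_
  rw [Metric.cauchy_iff]
  refine ⟨hS.map f, fun ε hε => ?_⟩
  obtain ⟨r, hr, hrS⟩ := h (ε / 2) (by positivity)
  refine ⟨Set.image f (S ∩ ball x₀ r), image_mem_map ?_, ?_⟩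
  · exact inter_mem self_mem_nhdsWithin (mem_nhdsWithin_of_mem_nhds (ball_mem_nhds _ hr))
  · rintro _ ⟨y, hy, rfl⟩ _ ⟨y', hy', rfl⟩
    rw [dist_eq_norm]
    linarith [hrS y hy y' hy']

lemma differentiable_dense (hu : IsLip u) (x₀ : Eucl n) :
    (𝓝[{y | DifferentiableAt ℝ u y}] x₀).NeBot :=
  mem_closure_iff_nhdsWithin_neBot.1
    ((Measure.dense_of_ae hu.ae_differentiableAt) x₀)

lemma hasStrictFDerivAt_of_flat (hu : IsLip u) {x₀ : Eucl n}
    (h : ∀ δ > 0, ∃ r > 0, Flat u x₀ r δ) :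
    ∃ p : Eucl n, HasStrictFDerivAt u (innerSL ℝ p) x₀ ∧
      Tendsto (gradient u) (𝓝[{y | DifferentiableAt ℝ u y}] x₀) (𝓝 p) := by
  have hne := differentiable_dense hu x₀
  obtain ⟨p, hp⟩ := exists_tendsto_of_osc (f := gradient u) hne (by
    intro δ hδ
    obtain ⟨r, hr, hf⟩ := h (δ / 2) (by positivity)
    refine ⟨r, hr, fun y hy y' hy' => ?_⟩
    have := hf.norm_gradient_sub_le hy.2 hy'.2 hy.1 hy'.1
    linarith)
  refine ⟨p, ?_, hp⟩
  rw [hasStrictFDerivAt_iff_isLittleO, Asymptotics.isLittleO_iff]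
  intro δ hδ
  obtain ⟨r, hr, hf⟩ := h δ hδ
  have : (ball x₀ r ×ˢ ball x₀ r) ∈ 𝓝 (x₀, x₀) :=
    prod_mem_nhds (ball_mem_nhds _ hr) (ball_mem_nhds _ hr)
  filter_upwards [this] with q hq
  rw [Real.norm_eq_abs, innerSL_apply_apply]
  have hlim : Tendsto (fun y => |u q.1 - u q.2 - ⟪gradient u y, q.1 - q.2⟫_ℝ|)
      (𝓝[{y | DifferentiableAt ℝ u y}] x₀) (𝓝 |u q.1 - u q.2 - ⟪p, q.1 - q.2⟫_ℝ|) :=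
    (tendsto_const_nhds.sub (hp.inner tendsto_const_nhds)).abs
  refine le_of_tendsto hlim ?_
  filter_upwards [self_mem_nhdsWithin, mem_nhdsWithin_of_mem_nhds (ball_mem_nhds x₀ hr)]
    with y hy1 hy2
  exact hf y hy2 hy1 _ hq.2 _ hq.1

lemma differentiableAt_of_flat (hu : IsLip u) {x₀ : Eucl n}
    (h : ∀ δ > 0, ∃ r > 0, Flat u x₀ r δ) : DifferentiableAt ℝ u x₀ := by
  obtain ⟨p, hp, -⟩ := hasStrictFDerivAt_of_flat hu h
  exact hp.hasFDerivAt.differentiableAt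

lemma dq_neg_step (u : Eucl n → ℝ) (b : Eucl n) (h : ℝ) :
    (fun x => - dq u b h x) = dq u b (-h) := by
  ext x; unfold dq; rw [div_neg]

lemma Ell.abs_dq_le (hE : Ell F F₀ ρ M lam Lam L u) {b : Eucl n} {h : ℝ} (hh : h ≠ 0)
    (hb : ‖b‖ ≤ |h|) (x : Eucl n) : |dq u b h x| ≤ L := by
  unfold dq
  rw [abs_div, div_le_iff₀ (abs_pos.2 hh)]
  have := hE.u_lip (x + b) x
  rw [add_sub_cancel_left] at this
  exact this.trans (mul_le_mul_of_nonneg_left hb hE.L_nonneg)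

/-- Interior flatness away from the contact set, uniform in the data. -/
lemma exists_flat_radius (n : ℕ) {lam Lam L δ : ℝ} (hlam : 0 < lam) (hδ : 0 < δ) :
    ∃ κ : ℝ, 0 < κ ∧ κ < 1 ∧ ∀ (F : Eucl n → ℝ → Eucl n → Eucl n) (F₀ : Eucl n → ℝ → Eucl n → ℝ)
      (ρ M : ℝ) (u : Eucl n → ℝ), Sol F F₀ ρ M lam Lam L u → ∀ (x₀ : Eucl n) (R : ℝ), 0 < R →
      R ≤ 1 → ‖x₀‖ + R < ρ → (∀ x ∈ closedBall x₀ R, x (Fin.last n) = 0 → 0 < u x) →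
      Flat u x₀ (κ * R) δ := by
  obtain ⟨κ, hκ, hκ1, H⟩ := deGiorgi_osc n (Q := caccQ lam Lam L) (L := L) (caccQ_nonneg hlam) hδ
  refine ⟨κ / 2, by positivity, by linarith, fun F F₀ ρ M u hS x₀ R hR hR1 hρ hp => ?_⟩
  refine flat_of_increments (r₀ := R / 2) (by positivity) fun b hb x hx y hy => ?_
  rcases eq_or_ne b 0 with rfl | hb0
  · simp
  have hbn : 0 < ‖b‖ := norm_pos_iff.2 hb0
  have hsub : closedBall x₀ (R / 2 + ‖b‖) ⊆ closedBall x₀ R :=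
    closedBall_subset_closedBall (by linarith)
  have hab : |‖b‖| = ‖b‖ := abs_of_pos hbn
  have h1 := H (dq u b ‖b‖) (dq_isLip hS.isLip _ _) x₀ (R / 2) (by positivity) (by linarith)
    (fun k => hS.dgAt_of_pos hbn.ne' hab.ge (by linarith) (by rw [hab]; linarith)
      (by rw [hab]; exact fun x hx => hp x (hsub hx)))
    (fun k => by
      rw [dq_neg_step]
      exact hS.dgAt_of_pos (neg_ne_zero.2 hbn.ne') (by rw [abs_neg, hab]) (by linarith)
        (by rw [abs_neg, hab]; linarith)
        (by rw [abs_neg, hab]; exact fun x hx => hp x (hsub hx)))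
    (fun x _ => hS.toEll.abs_dq_le hbn.ne' hab.ge x) x (by convert hx using 2; ring)
    y (by convert hy using 2; ring)
  unfold dq at h1
  rwa [← sub_div, abs_div, hab, div_le_iff₀ hbn] at h1

namespace Sol

lemma pos_of_near (hS : Sol F F₀ ρ M lam Lam L u) {x : Eucl n}
    (h : x (Fin.last n) = 0 → 0 < u x) :
    ∃ R > 0, ∀ y ∈ ball x R, y (Fin.last n) = 0 → 0 < u y := by
  by_cases hx : x (Fin.last n) = 0
  · obtain ⟨R, hR, hb⟩ := Metric.eventually_nhds_iff_ball.1
      (hS.isLip.continuous.continuousAt.eventually (lt_mem_nhds (h hx)))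
    exact ⟨R, hR, fun y hy _ => hb y hy⟩
  · have hc : Continuous fun y : Eucl n => y (Fin.last n) := by fun_prop
    obtain ⟨R, hR, hb⟩ := Metric.eventually_nhds_iff_ball.1
      (hc.continuousAt.eventually_ne hx)
    exact ⟨R, hR, fun y hy hy0 => absurd hy0 (hb y hy)⟩

/-- Arbitrarily good flatness on small balls away from the contact set. -/
lemma flat_small (hS : Sol F F₀ ρ M lam Lam L u) {x : Eucl n} (hx : x ∈ ball (0 : Eucl n) ρ)
    (h : x (Fin.last n) = 0 → 0 < u x) {δ : ℝ} (hδ : 0 < δ) : ∃ r > 0, Flat u x r δ := by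
  obtain ⟨κ, hκ, -, H⟩ := exists_flat_radius n (Lam := Lam) (L := L) hS.lam_pos hδ
  obtain ⟨R, hR, hp⟩ := hS.pos_of_near h
  rw [mem_ball_zero_iff] at hx
  set R' := min (R / 2) (min 1 ((ρ - ‖x‖) / 2)) with hR'
  have h1 : R' ≤ R / 2 := min_le_left _ _
  have h2 : R' ≤ 1 := (min_le_right _ _).trans (min_le_left _ _)
  have h3 : R' ≤ (ρ - ‖x‖) / 2 := (min_le_right _ _).trans (min_le_right _ _)
  have h0 : 0 < R' := lt_min (by positivity) (lt_min one_pos (by linarith))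
  exact ⟨κ * R', by positivity, H F F₀ ρ M u hS x R' h0 h2 (by linarith)
    fun y hy => hp y (closedBall_subset_ball (by linarith) hy)⟩

lemma differentiableAt (hS : Sol F F₀ ρ M lam Lam L u) {x : Eucl n}
    (hx : x ∈ ball (0 : Eucl n) ρ) (h : x (Fin.last n) = 0 → 0 < u x) :
    DifferentiableAt ℝ u x :=
  differentiableAt_of_flat hS.isLip fun _ hδ => hS.flat_small hx h hδ

lemma continuousAt_gradient (hS : Sol F F₀ ρ M lam Lam L u) {x : Eucl n}
    (hx : x ∈ ball (0 : Eucl n) ρ) (h : x (Fin.last n) = 0 → 0 < u x) :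
    ContinuousAt (gradient u) x := by
  obtain ⟨p, hp, hlim⟩ := hasStrictFDerivAt_of_flat hS.isLip fun _ hδ => hS.flat_small hx h hδ
  have hpx : gradient u x = p := by
    refine ext_inner_right ℝ fun v => ?_
    rw [inner_gradient, hp.hasFDerivAt.fderiv, innerSL_apply_apply]
  have hmem : {y | DifferentiableAt ℝ u y} ∈ 𝓝 x := by
    obtain ⟨R, hR, hb⟩ := hS.pos_of_near h
    filter_upwards [ball_mem_nhds x hR, isOpen_ball.mem_nhds hx] with y hy hy'
    exact hS.differentiableAt hy' (hb y hy)
  rw [nhdsWithin_eq_nhds.2 hmem] at hlim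
  rw [ContinuousAt, hpx]
  exact hlim

end Sol

lemma norm_eLast : ‖eLast n‖ = 1 := by simp [eLast]

@[simp] lemma eLast_last : eLast n (Fin.last n) = 1 := by simp [eLast]

lemma inner_eLast (x : Eucl n) : ⟪x, eLast n⟫_ℝ = x (Fin.last n) := by
  simp [eLast, EuclideanSpace.inner_single_right]

lemma abs_last_le (x : Eucl n) : |x (Fin.last n)| ≤ ‖x‖ := by
  rw [← inner_eLast]
  simpa [norm_eLast] using abs_real_inner_le_norm x (eLast n)

/-- Orthogonal projection onto the thin hyperplane. -/
def pr (x : Eucl n) : Eucl n := x - x (Fin.last n) • eLast n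

@[simp] lemma pr_last (x : Eucl n) : pr x (Fin.last n) = 0 := by
  simp [pr]

lemma norm_sub_pr (x : Eucl n) : ‖x - pr x‖ = |x (Fin.last n)| := by
  rw [pr, sub_sub_cancel, norm_smul, norm_eLast, mul_one, Real.norm_eq_abs]

lemma norm_sq_eq (x : Eucl n) : ‖x‖ ^ 2 = ‖pr x‖ ^ 2 + x (Fin.last n) ^ 2 := by
  have : x = pr x + x (Fin.last n) • eLast n := by rw [pr]; abel
  conv_lhs => rw [this]
  rw [norm_add_sq_real, real_inner_smul_right, inner_eLast, pr_last, norm_smul, norm_eLast]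
  simp

lemma pr_sub (x y : Eucl n) : pr (x - y) = pr x - pr y := by
  simp only [pr, PiLp.sub_apply, sub_smul]; abel

lemma pr_of_last {x : Eucl n} (h : x (Fin.last n) = 0) : pr x = x := by
  rw [pr, h, zero_smul, sub_zero]

lemma norm_pr_le (x : Eucl n) : ‖pr x‖ ≤ ‖x‖ := by
  have := norm_sq_eq x
  nlinarith [norm_nonneg x, norm_nonneg (pr x), sq_nonneg (x (Fin.last n))]

lemma Sol.ge_neg (hS : Sol F F₀ ρ M lam Lam L u) {x : Eucl n} (hx : x ∈ ball (0 : Eucl n) ρ) :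
    - (L * |x (Fin.last n)|) ≤ u x := by
  have h1 : 0 ≤ u (pr x) := by
    refine hS.nonneg _ ?_ (pr_last x)
    rw [mem_ball_zero_iff] at *
    exact (norm_pr_le x).trans_lt hx
  have h2 := hS.u_lip x (pr x)
  rw [norm_sub_pr] at h2
  linarith [neg_le_of_abs_le h2]

/-- One-sided bound on tangential increments. -/
def TanBd (u : Eucl n → ℝ) (x₀ : Eucl n) (r m : ℝ) : Prop :=
  ∀ b : Eucl n, b (Fin.last n) = 0 → ‖b‖ ≤ r → ∀ x ∈ ball x₀ r, u (x + b) - u x ≤ m * ‖b‖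

lemma measure_of_average {w : Eucl n → ℝ} (hw : IsLip w) {x : Eucl n} {r m L : ℝ} (hr : 0 ≤ r)
    (hL : ∀ y, - L ≤ w y)
    (hm : ∫ z in ball (0 : Eucl n) r, w (x + z) ≤ m / 4 * (r ^ (n + 1) * omega n)) :
    m / 4 * (r ^ (n + 1) * omega n) ≤
      (L + m / 2) * volume.real ({y | w y ≤ m / 2} ∩ ball x r) := by
  set V := r ^ (n + 1) * omega n with hV
  have hball : volume.real (ball (0 : Eucl n) r) = V := volume_real_ball 0 hr
  set G := {z | w (x + z) ≤ m / 2} ∩ ball (0 : Eucl n) r with hG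
  have hwc : IsLip fun z => w (x + z) := by
    simpa only [add_comm x] using hw.comp_add x
  have mG : MeasurableSet G :=
    (measurableSet_le hwc.measurable measurable_const).inter measurableSet_ball
  have hGm : volume.real G = volume.real ({y | w y ≤ m / 2} ∩ ball x r) := by
    have : G = (fun z => x + z) ⁻¹' ({y | w y ≤ m / 2} ∩ ball x r) := by
      ext z; simp [hG]
    rw [this, measureReal_def, measureReal_def, measure_preimage_add]
  rw [← hGm]
  have i1 : IntegrableOn (fun _ : Eucl n => m / 2) (ball (0 : Eucl n) r) :=
    integrableOn_const measure_ball_lt_top.ne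
  have i2 : IntegrableOn (G.indicator fun _ => L + m / 2) (ball (0 : Eucl n) r) :=
    (integrableOn_const measure_ball_lt_top.ne).indicator mG
  have h1 : ∫ z in ball (0 : Eucl n) r, (m / 2 - G.indicator (fun _ => L + m / 2) z) ≤
      ∫ z in ball (0 : Eucl n) r, w (x + z) := by
    refine setIntegral_mono_on (i1.sub i2) (hwc.integrableOn_ball _ _) measurableSet_ball ?_
    intro z hz
    by_cases hzG : z ∈ G
    · rw [Set.indicator_of_mem hzG]; linarith [hL (x + z)]
    · rw [Set.indicator_of_notMem hzG]
      have : ¬ w (x + z) ≤ m / 2 := fun hc => hzG ⟨hc, hz⟩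
      linarith
  rw [integral_sub i1 i2, setIntegral_const, setIntegral_indicator mG, setIntegral_const,
    Set.inter_eq_self_of_subset_right Set.inter_subset_right, hball] at h1
  simp only [smul_eq_mul] at h1
  linarith

lemma Sol.exists_small_average (hS : Sol F F₀ ρ M lam Lam L u) {x₀ b : Eucl n} {R r : ℝ}
    (hx₀ : x₀ (Fin.last n) = 0) (hu : u x₀ = 0) (hb : b (Fin.last n) = 0) (hb0 : 0 < ‖b‖)
    (hbR : ‖b‖ ≤ R / 4) (hr : 0 < r) (hrR : r ≤ R / 2) (hρ : ‖x₀‖ + R < ρ) :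
    ∃ x, ball x r ⊆ ball x₀ R ∧ ∫ z in ball (0 : Eucl n) r, dq u b ‖b‖ (x + z) ≤
      8 * L * r / R * (r ^ (n + 1) * omega n) := by
  have hR : 0 < R := by linarith
  set h := ‖b‖ with hh
  set V := r ^ (n + 1) * omega n with hV
  have hV0 : 0 < V := mul_pos (by positivity) omega_pos
  have hball : volume.real (ball (0 : Eucl n) r) = V := volume_real_ball 0 hr.le
  set N := ⌈R / (4 * h)⌉₊ with hN
  have hN1 : R / 4 ≤ N * h := by
    have := Nat.le_ceil (R / (4 * h))
    rw [div_le_iff₀ (by positivity)] at this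
    linarith
  have hN2 : N * h ≤ R / 2 := by
    have := (Nat.ceil_lt_add_one (a := R / (4 * h)) (by positivity)).le
    have h2 := mul_le_mul_of_nonneg_right this hb0.le
    have h3 : (R / (4 * h) + 1) * h = R / 4 + h := by field_simp
    linarith
  have hNpos : 0 < N := Nat.ceil_pos.2 (by positivity)
  have hmemN : ∀ i ≤ N, ∀ z ∈ ball (0 : Eucl n) r, x₀ - (i : ℝ) • b + z ∈ ball x₀ R := by
    intro i hi z hz
    rw [mem_ball_zero_iff] at hz
    rw [mem_ball_iff_norm]
    have e : x₀ - (i : ℝ) • b + z - x₀ = z - (i : ℝ) • b := by abel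
    rw [e]
    have h1 := norm_sub_le z ((i : ℝ) • b)
    rw [norm_smul, Real.norm_natCast] at h1
    have h2 : (i : ℝ) * h ≤ N * h :=
      mul_le_mul_of_nonneg_right (by exact_mod_cast hi) hb0.le
    linarith
  have hlip : ∀ x, IsLip fun z => u (x + z) := fun x => by
    simpa only [add_comm x] using hS.isLip.comp_add x
  set g : ℕ → ℝ := fun i => ∫ z in ball (0 : Eucl n) r, u (x₀ - (i : ℝ) • b + z) with hg
  have ic : ∀ c : ℝ, IntegrableOn (fun _ : Eucl n => c) (ball (0 : Eucl n) r) := fun c =>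
    integrableOn_const measure_ball_lt_top.ne
  have hc : ∀ c : ℝ, ∫ _ in ball (0 : Eucl n) r, c = V * c := fun c => by
    rw [setIntegral_const, hball, smul_eq_mul]
  have g0 : g 0 ≤ V * (L * r) := by
    rw [← hc]
    refine setIntegral_mono_on ((hlip _).integrableOn_ball _ _) (ic _) measurableSet_ball ?_
    intro z hz
    rw [mem_ball_zero_iff] at hz
    have h1 := hS.u_lip (x₀ + z) x₀
    rw [hu, add_sub_cancel_left, sub_zero] at h1
    have h2 := mul_le_mul_of_nonneg_left hz.le hS.L_nonneg
    simp only [Nat.cast_zero, zero_smul, sub_zero]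
    linarith [le_abs_self (u (x₀ + z))]
  have gN : V * (-(L * r)) ≤ g N := by
    rw [← hc]
    refine setIntegral_mono_on (ic _) ((hlip _).integrableOn_ball _ _) measurableSet_ball ?_
    intro z hz
    have hm := hmemN N le_rfl z hz
    have h1 := hS.ge_neg (Sol.mem_of_closedBall hρ (ball_subset_closedBall hm))
    rw [mem_ball_zero_iff] at hz
    have h3 : (x₀ - (N : ℝ) • b + z) (Fin.last n) = z (Fin.last n) := by
      simp [hx₀, hb]
    rw [h3] at h1
    have h2 := mul_le_mul_of_nonneg_left ((abs_last_le z).trans hz.le) hS.L_nonneg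
    linarith
  have hsum : ∑ i ∈ Finset.range N, (g i - g (i + 1)) ≤
      ∑ i ∈ Finset.range N, (2 * V * L * r / N) := by
    rw [Finset.sum_range_sub', Finset.sum_const, Finset.card_range, nsmul_eq_mul,
      mul_div_cancel₀ _ (by positivity)]
    linarith
  obtain ⟨i, hi, hgi⟩ := Finset.exists_le_of_sum_le
    (Finset.nonempty_range_iff.2 hNpos.ne') hsum
  refine ⟨x₀ - ((i + 1 : ℕ) : ℝ) • b, ?_, ?_⟩
  · intro y hy
    have := hmemN (i + 1) (Finset.mem_range.1 hi) (y - (x₀ - ((i + 1 : ℕ) : ℝ) • b)) (by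
      rw [mem_ball_zero_iff]; exact mem_ball_iff_norm.1 hy)
    simpa using this
  · have hdq : ∀ z, dq u b h (x₀ - ((i + 1 : ℕ) : ℝ) • b + z) =
        (u (x₀ - (i : ℝ) • b + z) - u (x₀ - ((i + 1 : ℕ) : ℝ) • b + z)) / h := by
      intro z
      unfold dq
      congr 3
      push_cast
      rw [add_smul, one_smul]; abel
    simp_rw [hdq]
    rw [integral_div, integral_sub ((hlip _).integrableOn_ball _ _)
      ((hlip _).integrableOn_ball _ _), div_le_iff₀ hb0]
    refine hgi.trans ?_
    rw [div_le_iff₀ (by positivity), div_mul_eq_mul_div, div_mul_eq_mul_div, div_mul_eq_mul_div,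
      le_div_iff₀ hR]
    have hP : 0 ≤ 8 * L * r * V := by have := hS.L_nonneg; positivity
    nlinarith [mul_le_mul_of_nonneg_left hN1 hP]

/-- Improvement of the tangential one-sided bound at a contact point. -/
lemma exists_tanBd_step (n : ℕ) {lam Lam L ε : ℝ} (hlam : 0 < lam) (hL : 0 ≤ L) (hε : 0 < ε) :
    ∃ θ : ℝ, 0 < θ ∧ θ < 1 ∧ ∀ (F : Eucl n → ℝ → Eucl n → Eucl n)
      (F₀ : Eucl n → ℝ → Eucl n → ℝ) (ρ M : ℝ) (u : Eucl n → ℝ), Sol F F₀ ρ M lam Lam L u →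
      ∀ (x₀ : Eucl n) (r m : ℝ), x₀ (Fin.last n) = 0 → u x₀ = 0 → 0 < r → r ≤ 1 → r ≤ θ * ε →
      ‖x₀‖ + 2 * r < ρ → ε ≤ m → m ≤ L + ε → TanBd u x₀ r m → TanBd u x₀ (r / 8) ((1 - θ) * m) := by
  set σ := min (1 / 2) (ε / (32 * (L + 1))) with hσ
  have hσ0 : 0 < σ := lt_min (by norm_num) (by positivity)
  have hσ1 : σ ≤ 1 / 2 := min_le_left _ _
  have hσ2 : 32 * L * σ ≤ ε := by
    have h1 : σ ≤ ε / (32 * (L + 1)) := min_le_right _ _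
    rw [le_div_iff₀ (by positivity)] at h1
    nlinarith
  set c := (ε / 4 * (σ ^ (n + 1) * omega n)) / (L + (L + ε) / 2) with hc
  have hom := omega_pos (n := n)
  have hc0 : 0 < c := by positivity
  obtain ⟨θ, hθ, hθ1, H⟩ := deGiorgi_decay n (Q := caccQ lam Lam L) (caccQ_nonneg hlam) hc0
  refine ⟨θ / 2, by positivity, by linarith, ?_⟩
  intro F F₀ ρ M u hS x₀ r m hx₀ hu hr hr1 hrε hρ hεm hmL hbd b hb hbr x hx
  rcases eq_or_ne b 0 with rfl | hb0
  · simp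
  have hbn : 0 < ‖b‖ := norm_pos_iff.2 hb0
  have hab : |‖b‖| = ‖b‖ := abs_of_pos hbn
  set w := dq u b ‖b‖ with hw
  have hwl : IsLip w := dq_isLip hS.isLip _ _
  set R := r / 2 with hR
  have hR0 : 0 < R := by positivity
  have hwm : ∀ y ∈ ball x₀ (2 * R), w y ≤ m / 2 + m / 2 := by
    intro y hy
    rw [hw]; unfold dq
    rw [div_le_iff₀ hbn]
    have := hbd b hb (by linarith) y (by convert hy using 2; rw [hR]; ring)
    linarith
  obtain ⟨x₁, hx₁, hav⟩ := hS.exists_small_average (R := R) (r := σ * R) hx₀ hu hb hbn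
    (by rw [hR]; linarith) (by positivity) (by nlinarith) (by linarith)
  have hpow : 0 ≤ (σ * R) ^ (n + 1) * omega n := by positivity
  have hmeas := measure_of_average (m := m) (L := L) hwl (x := x₁) (r := σ * R) (by positivity)
    (fun y => neg_le_of_abs_le (hS.toEll.abs_dq_le hbn.ne' hab.ge y)) (hav.trans (by
      refine mul_le_mul_of_nonneg_right ?_ hpow
      rw [div_le_iff₀ hR0]
      have := mul_le_mul_of_nonneg_right (hσ2.trans hεm) hR0.le
      nlinarith))
  have hmeas2 : c * R ^ (n + 1) ≤ volume.real ({y | w y ≤ m / 2} ∩ ball x₀ R) := by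
    have hmono : volume.real ({y | w y ≤ m / 2} ∩ ball x₁ (σ * R)) ≤
        volume.real ({y | w y ≤ m / 2} ∩ ball x₀ R) :=
      measureReal_mono (Set.inter_subset_inter_right _ hx₁)
        ((measure_mono Set.inter_subset_right).trans_lt measure_ball_lt_top).ne
    rw [hc, div_mul_eq_mul_div, div_le_iff₀ (by positivity)]
    have e : ε / 4 * (σ ^ (n + 1) * omega n) * R ^ (n + 1) =
        ε / 4 * ((σ * R) ^ (n + 1) * omega n) := by rw [mul_pow]; ring
    rw [e]
    have h1 : ε / 4 * ((σ * R) ^ (n + 1) * omega n) ≤ m / 4 * ((σ * R) ^ (n + 1) * omega n) :=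
      mul_le_mul_of_nonneg_right (by linarith) hpow
    refine h1.trans (hmeas.trans ?_)
    rw [mul_comm]
    refine mul_le_mul hmono (by linarith) (by linarith) measureReal_nonneg
  have hfin := H w hwl x₀ R (m / 2) (m / 2) hR0 (by rw [hR]; nlinarith)
    (fun k' hk' => hS.dgAt_tangential hbn (by linarith) le_rfl hb (by linarith)
      (by linarith)) hwm hmeas2 x (ball_subset_ball (by linarith) hx)
  rw [hw] at hfin; unfold dq at hfin
  rw [div_le_iff₀ hbn] at hfin
  have e : m / 2 + (1 - θ) * (m / 2) = (1 - θ / 2) * m := by ring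
  rwa [e] at hfin

lemma TanBd.mono {x₀ : Eucl n} {r r' m m' : ℝ} (h : TanBd u x₀ r m) (hr : r' ≤ r) (hm : m ≤ m') :
    TanBd u x₀ r' m' := fun b hb hbr x hx =>
  (h b hb (hbr.trans hr) x (ball_subset_ball hr hx)).trans
    (mul_le_mul_of_nonneg_right hm (norm_nonneg _))

/-- At a contact point the tangential oscillation is `o(1)` in the Lipschitz sense. -/
lemma Sol.tangential_small (hS : Sol F F₀ ρ M lam Lam L u) {x₀ : Eucl n}
    (hx₀ : x₀ (Fin.last n) = 0) (hu : u x₀ = 0) (hρ : x₀ ∈ ball (0 : Eucl n) ρ) {ε : ℝ}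
    (hε : 0 < ε) : ∃ r > 0, ∀ x ∈ ball x₀ r, ∀ y ∈ ball x₀ r,
      x (Fin.last n) = y (Fin.last n) → |u x - u y| ≤ ε * ‖x - y‖ := by
  obtain ⟨θ, hθ, hθ1, H⟩ := exists_tanBd_step n (Lam := Lam) hS.lam_pos hS.L_nonneg hε
  rw [mem_ball_zero_iff] at hρ
  have key : ∀ j : ℕ, ∃ r > 0, r ≤ 1 ∧ r ≤ θ * ε ∧ ‖x₀‖ + 2 * r < ρ ∧
      TanBd u x₀ r (max ε ((1 - θ) ^ j * L)) := by
    intro j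
    induction j with
    | zero =>
      refine ⟨min 1 (min (θ * ε) ((ρ - ‖x₀‖) / 3)), lt_min one_pos (lt_min (by positivity)
        (by linarith)), min_le_left _ _, (min_le_right _ _).trans (min_le_left _ _), ?_, ?_⟩
      · have : min 1 (min (θ * ε) ((ρ - ‖x₀‖) / 3)) ≤ (ρ - ‖x₀‖) / 3 :=
          (min_le_right _ _).trans (min_le_right _ _)
        linarith
      · intro b hb _ x _
        have h1 := hS.u_lip (x + b) x
        rw [add_sub_cancel_left] at h1
        refine (le_abs_self _).trans (h1.trans (mul_le_mul_of_nonneg_right ?_ (norm_nonneg _)))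
        simp
    | succ j ih =>
      obtain ⟨r, hr, hr1, hrε, hrρ, hb⟩ := ih
      refine ⟨r / 8, by positivity, by linarith, by linarith, by linarith, ?_⟩
      have h1 : (1 - θ) ^ j * L ≤ L :=
        mul_le_of_le_one_left hS.L_nonneg (pow_le_one₀ (by linarith) (by linarith))
      have := H F F₀ ρ M u hS x₀ r _ hx₀ hu hr hr1 hrε hrρ (le_max_left _ _)
        (max_le (by linarith [hS.L_nonneg]) (by linarith)) hb
      refine this.mono le_rfl ?_
      rw [mul_max_of_nonneg _ _ (by linarith : (0 : ℝ) ≤ 1 - θ)]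
      refine max_le_max ?_ (by rw [pow_succ]; apply le_of_eq; ring)
      nlinarith
  obtain ⟨j, hj⟩ : ∃ j : ℕ, (1 - θ) ^ j * L ≤ ε := by
    have : Tendsto (fun j : ℕ => (1 - θ) ^ j * L) atTop (𝓝 (0 * L)) :=
      (tendsto_pow_atTop_nhds_zero_of_lt_one (by linarith) (by linarith)).mul_const L
    rw [zero_mul] at this
    exact (this.eventually (gt_mem_nhds hε)).exists.imp fun _ h => le_of_lt h
  obtain ⟨r, hr, -, -, -, hb⟩ := key j
  rw [max_eq_left hj] at hb
  refine ⟨r / 2, by positivity, fun x hx y hy hxy => ?_⟩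
  have hxr := ball_subset_ball (by linarith : r / 2 ≤ r) hx
  have hyr := ball_subset_ball (by linarith : r / 2 ≤ r) hy
  have hn : ‖x - y‖ ≤ r := by
    rw [mem_ball_iff_norm] at hx hy
    have e : x - y = (x - x₀) - (y - x₀) := by abel
    rw [e]
    linarith [norm_sub_le (x - x₀) (y - x₀)]
  rw [abs_le]
  have h1 := hb (x - y) (by simp [hxy]) hn y hyr
  have h2 := hb (y - x) (by simp [hxy]) (by rwa [norm_sub_rev]) x hxr
  rw [add_sub_cancel] at h1 h2
  rw [norm_sub_rev y x] at h2
  constructor <;> linarith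

/-- Weak divergence inequality from one-sided difference quotients of a continuous field. -/
lemma le_integral_inner_gradient {w : Eucl n → ℝ} {V : Eucl n → Eucl n} (hw : IsLip w)
    {z : Eucl n} {r : ℝ} (h0 : ∀ x ∉ closedBall z r, w x = 0) (hw0 : ∀ x, 0 ≤ w x)
    (hV : Continuous V) {c h₀ : ℝ} (hh₀ : 0 < h₀)
    (h : ∀ h, 0 < h → h < h₀ → ∀ x, w x ≠ 0 →
      c * h ≤ ∑ i, (V (x - h • EuclideanSpace.single i (1 : ℝ)) i - V x i)) :
    c * ∫ x, w x ≤ ∫ x, ⟪V x, gradient w x⟫_ℝ := by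
  have hcs : HasCompactSupport w :=
    HasCompactSupport.intro (isCompact_closedBall z r) h0
  have hVi : ∀ i, Continuous fun x => V x i := fun i => by fun_prop
  obtain ⟨C, hC⟩ := hw
  set e : Fin (n + 1) → Eucl n := fun i => EuclideanSpace.single i (1 : ℝ) with he
  have iw : ∀ (b : Eucl n) (i : Fin (n + 1)), Integrable fun x => w (x + b) * V x i := by
    intro b i
    refine Continuous.integrable_of_hasCompactSupport ?_ ?_
    · exact (hC.continuous.comp (by fun_prop)).mul (hVi i)
    · exact (hcs.comp_homeomorph (Homeomorph.addRight b)).mul_right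
  have iw0 : ∀ i : Fin (n + 1), Integrable fun x => w x * V x i := by
    intro i; simpa using iw 0 i
  have iw' : ∀ (b : Eucl n) (i : Fin (n + 1)), Integrable fun x => w x * V (x - b) i := by
    intro b i
    refine Continuous.integrable_of_hasCompactSupport ?_ hcs.mul_right
    exact hC.continuous.mul ((hVi i).comp (by fun_prop))
  have hT := tendsto_finsetSum Finset.univ fun i _ =>
    hC.integral_inv_smul_sub_mul_tendsto_integral_lineDeriv_mul' (μ := volume) hcs (hVi i) (e i)
  have hlim : ∑ i, ∫ x, lineDeriv ℝ w x (e i) * V x i = ∫ x, ⟪V x, gradient w x⟫_ℝ := by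
    rw [← integral_finsetSum]
    · refine integral_congr_ae ?_
      filter_upwards [hC.ae_differentiableAt] with x hx
      rw [PiLp.inner_apply]
      refine Finset.sum_congr rfl fun i _ => ?_
      have e2 : fderiv ℝ w x (e i) = gradient w x i := by
        rw [← inner_gradient, EuclideanSpace.inner_single_right]; simp
      rw [hx.lineDeriv_eq_fderiv, e2]
      simp [mul_comm]
    · intro i _
      have hm : Measurable fun x => lineDeriv ℝ w x (e i) * V x i :=
        (measurable_lineDeriv hC.continuous).mul (hVi i).measurable
      have hz : ∀ x ∉ closedBall z r, lineDeriv ℝ w x (e i) * V x i = 0 := by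
        intro x hx
        have h1 : w =ᶠ[𝓝 x] fun _ => 0 := by
          filter_upwards [isClosed_closedBall.isOpen_compl.mem_nhds hx] with y hy using h0 y hy
        have h2 : HasFDerivAt w (0 : Eucl n →L[ℝ] ℝ) x :=
          (hasFDerivAt_const (0 : ℝ) x).congr_of_eventuallyEq h1
        rw [h2.differentiableAt.lineDeriv_eq_fderiv, h2.fderiv]; simp
      obtain ⟨B, hB⟩ := (isCompact_closedBall z r).exists_bound_of_continuousOn (hVi i).continuousOn
      refine integrable_of_bound_support (x₀ := z) (r := r) (C := C * |B|) hm hz ?_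
      intro x
      by_cases hx : x ∈ closedBall z r
      · rw [abs_mul]
        refine mul_le_mul ?_ ?_ (abs_nonneg _) C.2
        · have := norm_lineDeriv_le_of_lipschitz ℝ hC (x₀ := x) (v := e i)
          simpa [he] using this
        · exact (hB x hx).trans (le_abs_self _)
      · rw [hz x hx]; simp; positivity
  rw [hlim] at hT
  refine ge_of_tendsto hT ?_
  filter_upwards [Ioo_mem_nhdsGT hh₀] with t ht
  have key : ∀ i, ∫ x, t⁻¹ • (w (x + t • e i) - w x) * V x i
      = ∫ x, t⁻¹ * (w x * (V (x - t • e i) i - V x i)) := by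
    intro i
    have e1 : ∫ x, w (x + t • e i) * V x i = ∫ x, w x * V (x - t • e i) i := by
      rw [← integral_sub_right_eq_self _ (t • e i)]
      simp
    calc _ = t⁻¹ * ((∫ x, w (x + t • e i) * V x i) - ∫ x, w x * V x i) := by
          rw [← integral_sub (iw _ i) (iw0 i), ← integral_const_mul]
          congr 1; ext x; simp only [smul_eq_mul]; ring
      _ = _ := by
          rw [e1, ← integral_sub (iw' _ i) (iw0 i), ← integral_const_mul]
          congr 1; ext x; ring
  simp_rw [key]
  rw [← integral_finsetSum, ← integral_const_mul]
  · refine integral_mono ?_ ?_ ?_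
    · exact (hC.continuous.integrable_of_hasCompactSupport hcs).const_mul c
    · refine integrable_finsetSum _ fun i _ => ?_
      have : Integrable fun x => t⁻¹ * (w x * V (x - t • e i) i - w x * V x i) :=
        ((iw' _ i).sub (iw0 i)).const_mul _
      simpa only [mul_sub] using this
    · intro x
      simp only
      rw [← Finset.mul_sum, ← Finset.mul_sum]
      by_cases hx : w x = 0
      · simp [hx]
      · have h1 := mul_le_mul_of_nonneg_left (h t ht.1 ht.2 x hx) (hw0 x)
        have h2 := mul_le_mul_of_nonneg_left h1 (inv_nonneg.2 ht.1.le)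
        refine le_trans (le_of_eq ?_) h2
        field_simp [ht.1.ne']
  · intro i _
    have : Integrable fun x => t⁻¹ * (w x * V (x - t • e i) i - w x * V x i) :=
      ((iw' _ i).sub (iw0 i)).const_mul _
    simpa only [mul_sub] using this

/-- Cutting off the positive part of a function outside a region where it is nonpositive on the
boundary. -/
lemma isLip_indicator_posPart {f : Eucl n → ℝ} {Ω : Set (Eucl n)} {C : ℝ}
    (hΩ : IsOpen Ω) (hf : ∀ x ∈ closure Ω, ∀ y ∈ closure Ω, |f x - f y| ≤ C * ‖x - y‖)
    (hC : 0 ≤ C)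
    (hb : ∀ x ∈ closure Ω, x ∉ Ω → f x ≤ 0) :
    IsLip (Ω.indicator fun x => max (f x) 0) := by
  classical
  have out : ∀ x ∈ Ω, ∀ y ∉ Ω, max (f x) 0 ≤ C * ‖x - y‖ := by
    intro x hx y hy
    obtain ⟨p, ⟨hp1, hp2⟩, hp3⟩ : ∃ p, p ∈ closure Ω ∩ segment ℝ x y ∧ p ∉ Ω := by
      by_contra! hc
      exact hy ((convex_segment x y).isPreconnected.subset_of_closure_inter_subset hΩ
        ⟨x, left_mem_segment ℝ x y, hx⟩ hc (right_mem_segment ℝ x y))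
    refine max_le ?_ (by positivity)
    have h1 := le_of_abs_le (hf x (subset_closure hx) p hp1)
    have h2 := hb p hp1 hp3
    have h3 : ‖x - p‖ ≤ ‖x - y‖ := by
      have := norm_sub_le_of_mem_segment hp2
      rw [norm_sub_rev, norm_sub_rev x y]; exact this
    nlinarith
  refine IsLip.of_abs_sub_le (C := C) fun x y => ?_
  by_cases hx : x ∈ Ω <;> by_cases hy : y ∈ Ω
  · rw [Set.indicator_of_mem hx, Set.indicator_of_mem hy]
    exact (abs_max_sub_max_le_abs _ _ _).trans (hf x (subset_closure hx) y (subset_closure hy))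
  · rw [Set.indicator_of_mem hx, Set.indicator_of_notMem hy, sub_zero,
      abs_of_nonneg (le_max_right _ _)]
    exact out x hx y hy
  · rw [Set.indicator_of_notMem hx, Set.indicator_of_mem hy, zero_sub, abs_neg,
      abs_of_nonneg (le_max_right _ _), norm_sub_rev]
    exact out y hy x hx
  · rw [Set.indicator_of_notMem hx, Set.indicator_of_notMem hy]
    simp; positivity

/-- The comparison barrier. -/
def bar (z : Eucl n) (m t K : ℝ) (x : Eucl n) : ℝ :=
  m * x (Fin.last n) + t * (‖pr (x - z)‖ ^ 2 - K * x (Fin.last n) ^ 2)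

/-- The gradient of the comparison barrier. -/
def gbar (z : Eucl n) (m t K : ℝ) (x : Eucl n) : Eucl n :=
  (m - 2 * t * K * x (Fin.last n)) • eLast n + (2 * t) • pr (x - z)

lemma inner_pr_left (x y : Eucl n) : ⟪pr x, y⟫_ℝ = ⟪pr x, pr y⟫_ℝ := by
  conv_lhs => rw [show y = pr y + y (Fin.last n) • eLast n by rw [pr]; abel]
  rw [inner_add_right, real_inner_smul_right, inner_eLast, pr_last]; simp

lemma pr_add (x y : Eucl n) : pr (x + y) = pr x + pr y := by
  simp only [pr, PiLp.add_apply, add_smul]; abel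

lemma bar_add (z : Eucl n) (m t K : ℝ) (x v : Eucl n) :
    bar z m t K (x + v) = bar z m t K x + ⟪gbar z m t K x, v⟫_ℝ
      + t * (‖pr v‖ ^ 2 - K * v (Fin.last n) ^ 2) := by
  have e : pr (x + v - z) = pr (x - z) + pr v := by
    rw [show x + v - z = (x - z) + v by abel, pr_add]
  have e2 : ⟪eLast n, v⟫_ℝ = v (Fin.last n) := by rw [real_inner_comm, inner_eLast]
  simp only [bar, gbar, e, norm_add_sq_real, inner_add_left, real_inner_smul_left,
    PiLp.add_apply, e2]
  rw [inner_pr_left (x - z) v]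
  ring

lemma continuous_pr : Continuous (pr : Eucl n → Eucl n) := by
  unfold pr; fun_prop

lemma continuous_bar (z : Eucl n) (m t K : ℝ) : Continuous (bar z m t K) := by
  have := continuous_pr (n := n)
  unfold bar; fun_prop

lemma continuous_gbar (z : Eucl n) (m t K : ℝ) : Continuous (gbar z m t K) := by
  have := continuous_pr (n := n)
  unfold gbar; fun_prop

lemma abs_bar_quad_le {t K : ℝ} (ht : 0 ≤ t) (hK : 0 ≤ K) (v : Eucl n) :
    |t * (‖pr v‖ ^ 2 - K * v (Fin.last n) ^ 2)| ≤ t * (1 + K) * ‖v‖ ^ 2 := by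
  rw [abs_mul, abs_of_nonneg ht, mul_assoc]
  refine mul_le_mul_of_nonneg_left ?_ ht
  have h := norm_sq_eq v
  have h1 := sq_nonneg ‖pr v‖
  have h2 := sq_nonneg (v (Fin.last n))
  rw [abs_le]
  constructor <;> nlinarith [mul_nonneg hK h1, mul_nonneg hK h2]

lemma hasGradientAt_bar (z : Eucl n) (m t K : ℝ) (ht : 0 ≤ t) (hK : 0 ≤ K) (x : Eucl n) :
    HasGradientAt (bar z m t K) (gbar z m t K x) x := by
  rw [hasGradientAt_iff_isLittleO]
  have h1 : (fun y => bar z m t K y - bar z m t K x - ⟪gbar z m t K x, y - x⟫_ℝ)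
      =O[𝓝 x] fun y => ‖y - x‖ ^ 2 := by
    refine Asymptotics.IsBigO.of_bound (t * (1 + K)) (Eventually.of_forall fun y => ?_)
    have e := bar_add z m t K x (y - x)
    rw [add_sub_cancel] at e
    rw [Real.norm_eq_abs, Real.norm_eq_abs, e, abs_of_nonneg (sq_nonneg ‖y - x‖)]
    refine le_trans (le_of_eq ?_) (abs_bar_quad_le ht hK (y - x))
    congr 1; ring
  refine h1.trans_isLittleO ?_
  have h2 : Tendsto (fun y => ‖y - x‖) (𝓝 x) (𝓝 0) := by
    have : Continuous fun y => ‖y - x‖ := by fun_prop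
    simpa using this.tendsto x
  have h3 := (Asymptotics.isLittleO_one_iff ℝ).2 h2
  have h4 := h3.mul_isBigO (Asymptotics.isBigO_refl (fun y => ‖y - x‖) (𝓝 x))
  simp only [one_mul] at h4
  simp only [sq]
  exact h4.trans_isBigO (Asymptotics.isBigO_of_le _ fun y => by simp)

lemma norm_gbar_le {z : Eucl n} {m t K r : ℝ} (hz : z (Fin.last n) = 0) (ht : 0 ≤ t) (hK : 0 ≤ K)
    {x : Eucl n} (hx : x ∈ closedBall z r) : ‖gbar z m t K x‖ ≤ |m| + 2 * t * (1 + K) * r := by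
  have hx' : ‖x - z‖ ≤ r := by rwa [mem_closedBall, dist_eq_norm] at hx
  have h1 := abs_last_le (x - z)
  rw [PiLp.sub_apply, hz, sub_zero] at h1
  have h2 := norm_pr_le (x - z)
  refine (norm_add_le _ _).trans ?_
  rw [norm_smul, norm_smul, norm_eLast, Real.norm_eq_abs, Real.norm_eq_abs,
    abs_of_nonneg (by positivity : 0 ≤ 2 * t), mul_one]
  have h3 : |m - 2 * t * K * x (Fin.last n)| ≤ |m| + 2 * t * K * r := by
    refine (abs_sub _ _).trans (add_le_add_right ?_ _)
    rw [abs_mul, abs_of_nonneg (by positivity)]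
    exact mul_le_mul_of_nonneg_left (h1.trans hx') (by positivity)
  have h4 : 2 * t * ‖pr (x - z)‖ ≤ 2 * t * r :=
    mul_le_mul_of_nonneg_left (h2.trans hx') (by positivity)
  linarith

/-- The weight of the vertical direction in the barrier. -/
def Kc (n : ℕ) (lam Lam : ℝ) : ℝ := (n * Lam + 1) / lam

/-- The lower bound on the opening of the barrier that makes it a strict supersolution. -/
def Tc (n : ℕ) (M lam Lam : ℝ) : ℝ := (n + 1) * Lam * (1 + M) + Lam + Lam ^ 2 / lam + 1

lemma abs_apply_le (x : Eucl n) (i : Fin (n + 1)) : |x i| ≤ ‖x‖ := by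
  simpa using PiLp.norm_apply_le x i

lemma gbar_sub (z : Eucl n) (m t K : ℝ) (x v : Eucl n) :
    gbar z m t K (x - v) - gbar z m t K x =
      (2 * t * K * v (Fin.last n)) • eLast n - (2 * t) • pr v := by
  have e : pr (x - v - z) = pr (x - z) - pr v := by
    rw [show x - v - z = (x - z) - v by abel, pr_sub]
  simp only [gbar, e, PiLp.sub_apply, smul_sub]
  module

lemma Ell.bar_diff (hE : Ell F F₀ ρ M lam Lam L u) {z : Eucl n} {m t γ : ℝ} (ht : 0 < t)
    {x : Eucl n} (hx : x ∈ ball (0 : Eucl n) ρ)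
    (hb : |γ + bar z m t (Kc n lam Lam) x| ≤ M)
    (hg : ‖gbar z m t (Kc n lam Lam) x‖ ≤ M - 1) {h : ℝ} (h0 : 0 < h)
    (h1 : h * (2 * t * (1 + Kc n lam Lam)) ≤ 1) :
    (2 * t - (n + 1) * Lam * (1 + M)) * h ≤
      ∑ i, (F (x - h • EuclideanSpace.single i (1 : ℝ))
          (γ + bar z m t (Kc n lam Lam) (x - h • EuclideanSpace.single i (1 : ℝ)))
          (gbar z m t (Kc n lam Lam) (x - h • EuclideanSpace.single i (1 : ℝ))) i -
        F x (γ + bar z m t (Kc n lam Lam) x) (gbar z m t (Kc n lam Lam) x) i) := by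
  set K := Kc n lam Lam with hK
  have hLam := hE.Lam_nonneg
  have hlam := hE.lam_pos
  have hK0 : 0 ≤ K := by rw [hK, Kc]; positivity
  have hKlam : K * lam = n * Lam + 1 := by rw [hK, Kc]; field_simp
  have hM : 0 ≤ M := by linarith [hE.L_nonneg, hE.L_le]
  set b : Eucl n → ℝ := fun x => γ + bar z m t K x with hb'
  set g := gbar z m t K
  set e : Fin (n + 1) → Eucl n := fun i => EuclideanSpace.single i (1 : ℝ)
  have hne : ∀ i, ‖h • e i‖ = h := fun i => by
    rw [norm_smul, Real.norm_eq_abs, abs_of_pos h0]; simp [e]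
  have hbd : ∀ i, |b (x - h • e i) - b x| ≤ M * h := by
    intro i
    have h2 := bar_add z m t K x (-(h • e i))
    rw [← sub_eq_add_neg] at h2
    have h3 := abs_bar_quad_le ht.le hK0 (-(h • e i))
    rw [norm_neg, hne] at h3
    have h4 : |⟪g x, -(h • e i)⟫_ℝ| ≤ (M - 1) * h := by
      refine (abs_real_inner_le_norm _ _).trans ?_
      rw [norm_neg, hne]
      exact mul_le_mul_of_nonneg_right hg h0.le
    have h5 : b (x - h • e i) - b x = ⟪g x, -(h • e i)⟫_ℝ +
        t * (‖pr (-(h • e i))‖ ^ 2 - K * (-(h • e i)) (Fin.last n) ^ 2) := by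
      simp only [b]; rw [h2]; ring
    rw [h5]
    refine (abs_add_le _ _).trans ?_
    have h6 : t * (1 + K) * h ^ 2 ≤ h := by nlinarith
    linarith
  have htan : ∀ i : Fin n, -(Lam * (1 + M) * h + 2 * t * Lam * h) ≤
      F (x - h • e i.castSucc) (b (x - h • e i.castSucc)) (g (x - h • e i.castSucc)) i.castSucc
        - F x (b x) (g x) i.castSucc := by
    intro i
    have h2 := hE.F_lip (x - h • e i.castSucc) x (b (x - h • e i.castSucc)) (b x)
      (g (x - h • e i.castSucc)) (g x)
    have h3 : ‖g (x - h • e i.castSucc) - g x‖ ≤ 2 * t * h := by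
      simp only [g]
      rw [gbar_sub]
      have : (h • e i.castSucc) (Fin.last n) = 0 := by
        simp [e, (Fin.castSucc_lt_last i).ne']
      rw [this, mul_zero, zero_smul, zero_sub, norm_neg, norm_smul, Real.norm_eq_abs,
        abs_of_pos (by positivity), pr_of_last this, hne]
    have h4 : ‖x - h • e i.castSucc - x‖ = h := by
      rw [sub_sub_cancel_left, norm_neg, hne]
    rw [h4] at h2
    have h5 := abs_apply_le (F (x - h • e i.castSucc) (b (x - h • e i.castSucc))
      (g (x - h • e i.castSucc)) - F x (b x) (g x)) i.castSucc
    have h6 := neg_le_of_abs_le (h5.trans h2)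
    rw [PiLp.sub_apply] at h6
    have h7 := mul_le_mul_of_nonneg_left
      (add_le_add (add_le_add_right (hbd i.castSucc) h) h3) hLam
    linarith
  have hlast : 2 * t * K * lam * h - Lam * (1 + M) * h ≤
      F (x - h • e (Fin.last n)) (b (x - h • e (Fin.last n))) (g (x - h • e (Fin.last n)))
        (Fin.last n) - F x (b x) (g x) (Fin.last n) := by
    set x' := x - h • e (Fin.last n)
    have hge : g x' - g x = (2 * t * K * h) • eLast n := by
      simp only [g, x']
      rw [gbar_sub]
      have h2 : (h • e (Fin.last n)) (Fin.last n) = h := by simp [e]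
      have h3 : pr (h • e (Fin.last n)) = 0 := by
        rw [pr, h2]; simp [e, eLast]
      rw [h2, h3, smul_zero, sub_zero]
    have hn' : ‖g x' - g x‖ = 2 * t * K * h := by
      rw [hge, norm_smul, norm_eLast, Real.norm_eq_abs, abs_of_nonneg (by positivity), mul_one]
    have hg' : ‖g x'‖ ≤ M := by
      have := norm_le_norm_add_norm_sub' (g x') (g x)
      have h9 : 2 * t * K * h ≤ 1 := by nlinarith
      linarith
    have h2 := hE.mono x hx (b x) hb (g x') (g x) hg' (hg.trans (by linarith))
    rw [hn'] at h2
    rw [hge, real_inner_smul_right, inner_eLast, PiLp.sub_apply] at h2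
    have h3 : lam * (2 * t * K * h) ≤
        F x (b x) (g x') (Fin.last n) - F x (b x) (g x) (Fin.last n) := by
      rcases hK0.eq_or_lt with h0' | hKp
      · have : (n : ℝ) * Lam + 1 = 0 := by rw [← hKlam, ← h0', zero_mul]
        have : (0 : ℝ) ≤ n * Lam := by positivity
        linarith
      · have hp : 0 < 2 * t * K * h := by positivity
        refine le_of_mul_le_mul_left ?_ hp
        linarith
    have h4 := hE.F_lip x' x (b x') (b x) (g x') (g x')
    have h5 : ‖x' - x‖ = h := by
      simp only [x']; rw [sub_sub_cancel_left, norm_neg, hne]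
    rw [h5, sub_self, norm_zero, add_zero] at h4
    have h6 := neg_le_of_abs_le ((abs_apply_le (F x' (b x') (g x') - F x (b x) (g x'))
      (Fin.last n)).trans h4)
    rw [PiLp.sub_apply] at h6
    have h7 := mul_le_mul_of_nonneg_left (add_le_add_right (hbd (Fin.last n)) h) hLam
    linarith
  rw [Fin.sum_univ_castSucc]
  have hs : ∑ i : Fin n, -(Lam * (1 + M) * h + 2 * t * Lam * h) ≤ _ :=
    Finset.sum_le_sum fun i _ => htan i
  rw [Finset.sum_const, Finset.card_univ, Fintype.card_fin, nsmul_eq_mul] at hs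
  refine le_trans (le_of_eq ?_) (add_le_add hs hlast)
  rw [show 2 * t * K * lam * h = 2 * t * (K * lam) * h by ring, hKlam]
  ring

/-- The comparison principle with strict supersolutions. -/
lemma Ell.comparison (hE : Ell F F₀ ρ M lam Lam L u) {z : Eucl n} {r m t γ : ℝ} (ht : 0 < t)
    (hz : z (Fin.last n) = 0) (hρ : ‖z‖ + r < ρ)
    (hm : |m| ≤ L + 1) (htr : 2 * t * (1 + Kc n lam Lam) * r ≤ 1)
    (htc : Tc n M lam Lam ≤ 2 * t)
    {w : Eucl n → ℝ} (hw : IsLip w) (h0 : ∀ x ∉ closedBall z r, w x = 0) (hw0 : ∀ x, 0 ≤ w x)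
    (hw1 : ∀ x, w x ≤ 1)
    (hwe : ∀ x, 0 < w x → ∀ᶠ y in 𝓝 x, w y = u y - (γ + bar z m t (Kc n lam Lam) y))
    (hEn : En F F₀ u w ≤ 0) : ∀ x, w x = 0 := by
  set K := Kc n lam Lam with hK
  have hLam := hE.Lam_nonneg
  have hlam := hE.lam_pos
  have hK0 : 0 ≤ K := by rw [hK, Kc]; positivity
  have hM : L + 3 ≤ M := hE.L_le
  have hr0 : ∀ x, w x ≠ 0 → 0 ≤ r := fun x hx => by
    have : x ∈ closedBall z r := by by_contra hc; exact hx (h0 x hc)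
    exact dist_nonneg.trans this
  have hball : ∀ x, w x ≠ 0 → x ∈ closedBall z r := fun x hx => by
    by_contra hc; exact hx (h0 x hc)
  have hballρ : ∀ x, w x ≠ 0 → x ∈ ball (0 : Eucl n) ρ := fun x hx => by
    have h1 := hball x hx
    rw [mem_closedBall, dist_eq_norm] at h1
    rw [mem_ball_zero_iff]
    have := norm_le_norm_add_norm_sub' x z
    linarith
  have hbM : ∀ x, w x ≠ 0 → |γ + bar z m t K x| ≤ M := fun x hx => by
    have h1 : w x = _ := (hwe x (lt_of_le_of_ne (hw0 x) (Ne.symm hx))).self_of_nhds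
    have h2 := abs_le.1 (hE.u_bd x (hballρ x hx))
    have h3 := hw0 x
    have h4 := hw1 x
    rw [abs_le]
    constructor <;> linarith [h2.1, h2.2]
  have hgM : ∀ x, w x ≠ 0 → ‖gbar z m t K x‖ ≤ M - 1 := fun x hx => by
    have h1 := norm_gbar_le (m := m) hz ht.le hK0 (hball x hx)
    linarith
  set V : Eucl n → Eucl n := fun x => F x (γ + bar z m t K x) (gbar z m t K x) with hV
  have hVc : Continuous V := hE.F_continuous.comp
    (continuous_id.prodMk ((continuous_const.add (continuous_bar z m t K)).prodMk
      (continuous_gbar z m t K)))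
  have hdiv := le_integral_inner_gradient hw h0 hw0 hVc
    (c := 2 * t - (n + 1) * Lam * (1 + M)) (h₀ := 1 / (2 * t * (1 + K))) (by positivity)
    (by
      intro h hh hh' x hx
      refine hE.bar_diff ht (hballρ x hx) (hbM x hx) (hgM x hx) hh ?_
      rw [lt_div_iff₀ (by positivity)] at hh'
      exact hh'.le)
  have hcs : HasCompactSupport w := HasCompactSupport.intro (isCompact_closedBall z r) h0
  have iw : Integrable w := hw.continuous.integrable_of_hasCompactSupport hcs
  have iV : Integrable fun x => ⟪V x, gradient w x⟫_ℝ := by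
    have := integrable_pairing (V := V) (f := fun _ => 0) (A := Lam) hVc.measurable
      measurable_const (fun x => hE.F_bd _ _ _) (fun x => by simpa using hLam) hw h0
    simpa using this
  have iE : Integrable fun x =>
      ⟪F x (u x) (gradient u x), gradient w x⟫_ℝ + F₀ x (u x) (gradient u x) * w x :=
    integrable_pairing (hE.measurable_F hE.isLip.measurable)
      (hE.measurable_F₀ hE.isLip.measurable) (fun x => hE.F_bd _ _ _) (fun x => hE.F₀_bd _ _ _)
      hw h0
  have hpt : ∀ᵐ x, ⟪V x, gradient w x⟫_ℝ - (Lam + Lam ^ 2 / lam) * w x ≤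
      ⟪F x (u x) (gradient u x), gradient w x⟫_ℝ + F₀ x (u x) (gradient u x) * w x := by
    filter_upwards [hE.isLip.ae_differentiableAt] with x hx
    by_cases hx0 : w x = 0
    · have : gradient w x = 0 := by
        refine gradient_eq_zero_of_isLocalMin ?_
        refine Eventually.of_forall fun y => ?_
        rw [hx0]; exact hw0 y
      rw [this, hx0]; simp
    · have hpos : 0 < w x := lt_of_le_of_ne (hw0 x) (Ne.symm hx0)
      have he := hwe x hpos
      have hgb := hasGradientAt_bar z m t K ht.le hK0 x
      have hgw : gradient w x = gradient u x - gbar z m t K x := by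
        rw [gradient_congr he, gradient_sub hx (hgb.differentiableAt.const_add γ)]
        congr 1
        rw [← hgb.gradient]
        unfold gradient
        rw [fderiv_const_add]
      have hwx : w x = u x - (γ + bar z m t K x) := he.self_of_nhds
      have hux : |u x| ≤ M := (hE.u_bd x (hballρ x hx0)).trans (by linarith)
      have h1 := hE.mono x (hballρ x hx0) (u x) hux (gradient u x) (gbar z m t K x)
        ((hE.grad_le x).trans (by linarith)) ((hgM x hx0).trans (by linarith))
      rw [← hgw, inner_sub_left] at h1
      have h2 := hE.F_lip x x (u x) (γ + bar z m t K x) (gbar z m t K x) (gbar z m t K x)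
      rw [sub_self, sub_self, norm_zero, zero_add, add_zero, ← hwx, abs_of_pos hpos] at h2
      have h3 := neg_le_of_abs_le ((abs_real_inner_le_norm
        (F x (u x) (gbar z m t K x) - F x (γ + bar z m t K x) (gbar z m t K x))
        (gradient w x)).trans (mul_le_mul_of_nonneg_right h2 (norm_nonneg _)))
      rw [inner_sub_left] at h3
      have h4 : -(Lam * w x) ≤ F₀ x (u x) (gradient u x) * w x := by
        have := neg_le_of_abs_le (hE.F₀_bd x (u x) (gradient u x))
        nlinarith
      have h5 : Lam * w x * ‖gradient w x‖ ≤ lam * ‖gradient w x‖ ^ 2 + Lam ^ 2 / lam * w x := by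
        have e1 : 0 ≤ (lam * ‖gradient w x‖ - Lam * w x / 2) ^ 2 / lam := by positivity
        have e2 : (lam * ‖gradient w x‖ - Lam * w x / 2) ^ 2 / lam =
            lam * ‖gradient w x‖ ^ 2 - Lam * w x * ‖gradient w x‖
              + Lam ^ 2 / lam * (w x ^ 2 / 4) := by field_simp; ring
        have e3 : Lam ^ 2 / lam * (w x ^ 2 / 4) ≤ Lam ^ 2 / lam * w x :=
          mul_le_mul_of_nonneg_left (by nlinarith [hw1 x]) (by positivity)
        linarith
      simp only [hV]
      linarith
  have h_int : ∫ x, (⟪V x, gradient w x⟫_ℝ - (Lam + Lam ^ 2 / lam) * w x) ≤ En F F₀ u w :=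
    integral_mono_ae (iV.sub (iw.const_mul _)) iE hpt
  rw [integral_sub iV (iw.const_mul _), integral_const_mul] at h_int
  have hI0 : 0 ≤ ∫ x, w x := integral_nonneg hw0
  have hle : ∫ x, w x ≤ 0 := by
    have : 1 * ∫ x, w x ≤
        (2 * t - (n + 1) * Lam * (1 + M) - (Lam + Lam ^ 2 / lam)) * ∫ x, w x := by
      refine mul_le_mul_of_nonneg_right ?_ hI0
      unfold Tc at htc; linarith
    linarith
  have hz0 : ∫ x, w x = 0 := le_antisymm hle hI0
  rw [integral_eq_zero_iff_of_nonneg hw0 iw] at hz0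
  have := hw.continuous.ae_eq_iff_eq volume continuous_zero |>.1 hz0
  intro x; rw [this]; rfl

lemma abs_bar_le {z : Eucl n} {m t K r : ℝ} (hz : z (Fin.last n) = 0) (ht : 0 ≤ t) (hK : 0 ≤ K)
    {x : Eucl n} (hx : x ∈ closedBall z r) :
    |bar z m t K x| ≤ (|m| + t * (1 + K) * r) * r := by
  have hx' : ‖x - z‖ ≤ r := by rwa [mem_closedBall, dist_eq_norm] at hx
  have h1 := abs_last_le (x - z)
  have hq := abs_bar_quad_le ht hK (x - z)
  rw [PiLp.sub_apply, hz, sub_zero] at h1 hq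
  rw [add_mul]
  refine (abs_add_le _ _).trans (add_le_add ?_ (hq.trans ?_))
  · rw [abs_mul]
    exact mul_le_mul_of_nonneg_left (h1.trans hx') (abs_nonneg _)
  · rw [mul_assoc (t * (1 + K)), ← sq]
    exact mul_le_mul_of_nonneg_left (by gcongr) (by positivity)

lemma abs_bar_sub_le {z : Eucl n} {m t K r : ℝ} (hz : z (Fin.last n) = 0) (ht : 0 ≤ t)
    (hK : 0 ≤ K) {x y : Eucl n} (hx : x ∈ closedBall z r) (hy : y ∈ closedBall z r) :
    |bar z m t K x - bar z m t K y| ≤ (|m| + 4 * t * (1 + K) * r) * ‖x - y‖ := by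
  have h1 := bar_add z m t K y (x - y)
  rw [add_sub_cancel] at h1
  have h2 := abs_bar_quad_le ht hK (x - y)
  have h3 := norm_gbar_le (m := m) hz ht hK hy
  have h4 : ‖x - y‖ ≤ 2 * r := by
    rw [mem_closedBall, dist_eq_norm] at hx hy
    have : x - y = (x - z) - (y - z) := by abel
    rw [this]; exact (norm_sub_le _ _).trans (by linarith)
  rw [h1, add_assoc, add_sub_cancel_left]
  refine (abs_add_le _ _).trans ?_
  have h5 := (abs_real_inner_le_norm (gbar z m t K y) (x - y)).trans
    (mul_le_mul_of_nonneg_right h3 (norm_nonneg _))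
  have h6 : t * (1 + K) * ‖x - y‖ ^ 2 ≤ t * (1 + K) * (2 * r * ‖x - y‖) := by
    refine mul_le_mul_of_nonneg_left ?_ (by positivity)
    rw [sq]; exact mul_le_mul_of_nonneg_right h4 (norm_nonneg _)
  linarith

lemma Ell.comparison_region (hE : Ell F F₀ ρ M lam Lam L u) {z : Eucl n} {r m t γ : ℝ} (ht : 0 < t)
    (hz : z (Fin.last n) = 0) (hρ : ‖z‖ + r < ρ) (hr0 : 0 < r)
    (hr1 : (3 * L + 3) * r ≤ 1) (hm : |m| ≤ L + 1)
    (htr : 2 * t * (1 + Kc n lam Lam) * r ≤ 1) (htc : Tc n M lam Lam ≤ 2 * t)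
    {Ω : Set (Eucl n)} (hΩ : IsOpen Ω) (hΩr : Ω ⊆ closedBall z r)
    (huz : ∀ x ∈ Ω, u x ≤ γ + (2 * L + 1) * r)
    (hb : ∀ x ∈ closure Ω, x ∉ Ω → u x ≤ γ + bar z m t (Kc n lam Lam) x)
    (hEn : ∀ w, IsLip w → (∀ x ∉ Ω, w x = 0) → (∀ x, 0 ≤ w x) →
      (∀ x, 0 < w x → w x = u x - (γ + bar z m t (Kc n lam Lam) x)) → En F F₀ u w ≤ 0) :
    ∀ x ∈ Ω, u x ≤ γ + bar z m t (Kc n lam Lam) x := by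
  set K := Kc n lam Lam with hK
  have hLam := hE.Lam_nonneg
  have hlam := hE.lam_pos
  have hL := hE.L_nonneg
  have hK0 : 0 ≤ K := by rw [hK, Kc]; positivity
  have hcl : closure Ω ⊆ closedBall z r := closure_minimal hΩr isClosed_closedBall
  set f : Eucl n → ℝ := fun x => u x - (γ + bar z m t K x) with hf
  have hfc : Continuous f := hE.isLip.continuous.sub (continuous_const.add (continuous_bar z m t K))
  set w := Ω.indicator fun x => max (f x) 0 with hw
  have hwl : IsLip w := by
    refine isLip_indicator_posPart (C := L + (|m| + 4 * t * (1 + K) * r)) hΩ ?_ (by positivity) ?_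
    · intro x hx y hy
      have h1 := hE.u_lip x y
      have h2 := abs_bar_sub_le (m := m) hz ht.le hK0 (hcl hx) (hcl hy)
      have : f x - f y = (u x - u y) - (bar z m t K x - bar z m t K y) := by simp only [hf]; ring
      rw [this, add_mul]
      exact (abs_sub _ _).trans (add_le_add h1 h2)
    · intro x hx hx'
      have := hb x hx hx'
      simp only [hf]; linarith
  have hwΩ : ∀ x ∉ Ω, w x = 0 := fun x hx => Set.indicator_of_notMem hx _
  have hw0 : ∀ x, 0 ≤ w x := fun x => Set.indicator_nonneg (fun y _ => le_max_right _ _) x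
  have hwpos : ∀ x, 0 < w x → x ∈ Ω ∧ 0 < f x := by
    intro x hx
    have hxΩ : x ∈ Ω := by by_contra hc; rw [hwΩ x hc] at hx; exact lt_irrefl _ hx
    refine ⟨hxΩ, ?_⟩
    rw [hw, Set.indicator_of_mem hxΩ] at hx
    by_contra hc
    rw [max_eq_right (not_lt.1 hc)] at hx; exact lt_irrefl _ hx
  have hweq : ∀ x ∈ Ω, 0 < f x → w x = f x := by
    intro x hx hfx
    rw [hw, Set.indicator_of_mem hx, max_eq_left hfx.le]
  have hzero := hE.comparison ht hz hρ hm htr htc hwl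
    (fun x hx => hwΩ x fun h => hx (hΩr h)) hw0 (by
      intro x
      by_cases hx : 0 < w x
      · obtain ⟨h1, h2⟩ := hwpos x hx
        rw [hweq x h1 h2]
        have h3 := neg_le_of_abs_le (abs_bar_le (m := m) hz ht.le hK0 (hΩr h1))
        have h4 := huz x h1
        have h5 : (|m| + t * (1 + K) * r) * r ≤ (L + 2) * r :=
          mul_le_mul_of_nonneg_right (by linarith) hr0.le
        simp only [hf]; linarith
      · linarith)
    (by
      intro x hx
      obtain ⟨h1, h2⟩ := hwpos x hx
      filter_upwards [hΩ.mem_nhds h1, (isOpen_lt continuous_const hfc).mem_nhds h2] with y hy hy'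
      exact hweq y hy hy')
    (hEn w hwl hwΩ hw0 fun x hx => hweq x (hwpos x hx).1 (hwpos x hx).2)
  intro x hx
  by_contra hc
  have h1 : 0 < f x := by simp only [hf]; linarith
  have := hweq x hx h1
  rw [hzero x] at this
  linarith

lemma le_bar_of_sphere {z : Eucl n} {m t K r : ℝ} (hz : z (Fin.last n) = 0) (ht : 0 ≤ t)
    (hK : 0 ≤ K) {x : Eucl n} (hx : ‖x - z‖ = r) :
    t * r ^ 2 - t * r * (1 + K) * |x (Fin.last n)| ≤ bar z m t K x - m * x (Fin.last n) := by
  have h1 := abs_last_le (x - z)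
  have h2 := norm_sq_eq (x - z)
  rw [PiLp.sub_apply, hz, sub_zero] at h1 h2
  rw [hx] at h1 h2
  have h3 : x (Fin.last n) ^ 2 ≤ r * |x (Fin.last n)| := by
    rw [← sq_abs, sq]; exact mul_le_mul_of_nonneg_right h1 (abs_nonneg _)
  have h4 : bar z m t K x - m * x (Fin.last n) = t * r ^ 2 - t * (1 + K) * x (Fin.last n) ^ 2 := by
    unfold bar; rw [h2]; ring
  have h5 := mul_le_mul_of_nonneg_left h3 (by positivity : 0 ≤ t * (1 + K))
  rw [h4]; linarith

/-- Smallness of the scale used in comparison arguments. -/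
structure SmallScale (n : ℕ) (M lam Lam L ε s : ℝ) : Prop where
  eps_pos : 0 < ε
  pos : 0 < s
  le : (3 * L + 3) * s ≤ 1
  eps_le : 4 * ε * (1 + Kc n lam Lam) ≤ 1
  tc_le : Tc n M lam Lam * s ≤ 2 * ε

/-- One-sided slope bound from above at a contact region. -/
lemma Ell.barrier_upper (hE : Ell F F₀ ρ M lam Lam L u) {z : Eucl n} {s α ε : ℝ}
    (hs : SmallScale n M lam Lam L ε s) (hz : z (Fin.last n) = 0) (hρ : ‖z‖ + s < ρ)
    (hα : |α| ≤ L)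
    (h0 : ∀ x ∈ closedBall z s, x (Fin.last n) = 0 → u x ≤ 0)
    (hup : ∀ x ∈ closedBall z s, 0 ≤ x (Fin.last n) → u x ≤ α * x (Fin.last n) + ε * s)
    (hEn : ∀ w, IsLip w → (∀ x ∉ closedBall z s, w x = 0) → (∀ x, 0 ≤ w x) →
      (∀ x, x (Fin.last n) ≤ 0 → w x = 0) → En F F₀ u w ≤ 0)
    {y : ℝ} (hy : 0 ≤ y) (hys : y < s) :
    u (z + y • eLast n) ≤ (α + (1 + Kc n lam Lam) * ε) * y := by
  set K := Kc n lam Lam with hK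
  have hLam := hE.Lam_nonneg
  have hlam := hE.lam_pos
  have hL := hE.L_nonneg
  have hK0 : 0 ≤ K := by rw [hK, Kc]; positivity
  have hs0 := hs.pos
  have hε := hs.eps_pos
  have hel : (z + y • eLast n) (Fin.last n) = y := by simp [hz]
  have hdist : ‖z + y • eLast n - z‖ = y := by
    rw [add_sub_cancel_left, norm_smul, norm_eLast, Real.norm_eq_abs, abs_of_nonneg hy, mul_one]
  have hdist_pr : pr (z + y • eLast n - z) = 0 := by
    rw [add_sub_cancel_left, pr]; simp
  rcases hy.eq_or_lt with rfl | hy0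
  · rw [zero_smul, add_zero, mul_zero]
    exact h0 z (mem_closedBall_self hs0.le) hz
  set t := ε / s with ht
  have ht0 : 0 < t := by positivity
  have hts : t * s = ε := by rw [ht]; field_simp
  set Ω : Set (Eucl n) := ball z s ∩ {x | 0 < x (Fin.last n)} with hΩ
  have hcont : Continuous fun x : Eucl n => x (Fin.last n) := by fun_prop
  have hΩo : IsOpen Ω := isOpen_ball.inter (isOpen_lt continuous_const hcont)
  have hΩb : Ω ⊆ closedBall z s := fun x hx => ball_subset_closedBall hx.1
  have hcl : closure Ω ⊆ closedBall z s ∩ {x | 0 ≤ x (Fin.last n)} :=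
    closure_minimal (fun x hx => ⟨hΩb hx, (le_of_lt hx.2 : (0 : ℝ) ≤ x (Fin.last n))⟩)
      (isClosed_closedBall.inter (isClosed_le continuous_const hcont))
  have hpos : 0 ≤ (1 + K) * ε := by positivity
  have hKε : (1 + K) * ε ≤ 1 := by have := hs.eps_le; rw [← hK] at this; linarith
  have key := hE.comparison_region (z := z) (r := s) (m := α + (1 + K) * ε) (t := t)
    (γ := 0) ht0 hz hρ hs0
    hs.le ?_ ?_ ?_ hΩo hΩb ?_ ?_ ?_ (z + y • eLast n) ⟨?_, ?_⟩
  · refine key.trans ?_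
    rw [zero_add]
    rw [bar, hel, hdist_pr, norm_zero]
    have : 0 ≤ t * (K * y ^ 2) := by positivity
    linarith
  · refine (abs_add_le _ _).trans (add_le_add hα ?_)
    rwa [abs_of_nonneg hpos]
  · rw [mul_assoc 2, mul_assoc 2, mul_right_comm, hts, ← hK]; linarith [hs.eps_le]
  · have := hs.tc_le
    rw [← hts] at this
    have h2 : Tc n M lam Lam * s ≤ (2 * t) * s := by linarith
    exact le_of_mul_le_mul_right h2 hs0
  · intro x hx
    have h1 := hE.u_lip x z
    have h2 := h0 z (mem_closedBall_self hs0.le) hz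
    have h3 : ‖x - z‖ ≤ s := by
      have := hΩb hx; rwa [mem_closedBall, dist_eq_norm] at this
    have h4 := le_of_abs_le h1
    have h5 := mul_le_mul_of_nonneg_left h3 hL
    have h6 : 0 ≤ L * s := by positivity
    linarith
  · intro x hx hx'
    obtain ⟨h1, h2⟩ := hcl hx
    have h2 : 0 ≤ x (Fin.last n) := h2
    rcases h2.eq_or_lt with h3 | h3
    · refine (h0 x h1 h3.symm).trans ?_
      rw [zero_add]
      rw [bar, ← h3]
      have : 0 ≤ t * ‖pr (x - z)‖ ^ 2 := by positivity
      simpa using this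
    · have h4 : ‖x - z‖ = s := by
        rw [mem_closedBall, dist_eq_norm] at h1
        refine le_antisymm h1 ?_
        by_contra hc
        exact hx' ⟨by rw [mem_ball, dist_eq_norm]; exact not_le.1 hc, h3⟩
      have h5 := le_bar_of_sphere (m := α + (1 + K) * ε) hz ht0.le hK0 h4
      have h6 := hup x h1 h2
      rw [abs_of_nonneg h2, sq, ← mul_assoc, hts] at h5
      rw [← hK, zero_add]
      linarith
  · intro w hw hw0 hwn _
    refine hEn w hw (fun x hx => hw0 x fun h => hx (hΩb h)) hwn fun x hx => hw0 x fun h => ?_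
    exact absurd h.2 (not_lt.2 hx)
  · rw [mem_ball, dist_eq_norm, hdist]; exact hys
  · show 0 < (z + y • eLast n) (Fin.last n)
    rw [hel]; exact hy0

/-- `u` is `ε s`-close on the ball of radius `s` to a two-plane solution. -/
structure PL (u : Eucl n → ℝ) (z : Eucl n) (s α β ε : ℝ) : Prop where
  up : ∀ x ∈ closedBall z s, 0 ≤ x (Fin.last n) → |u x - u z - α * x (Fin.last n)| ≤ ε * s
  down : ∀ x ∈ closedBall z s, x (Fin.last n) ≤ 0 → |u x - u z - β * x (Fin.last n)| ≤ ε * s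

/-- A strictly concave two-plane profile forces contact. -/
lemma Sol.contact_of_gap (hS : Sol F F₀ ρ M lam Lam L u) {x₀ : Eucl n} {s α β ε : ℝ}
    (hs : SmallScale n M lam Lam L (2 * ε) (s / 2)) (hu : u x₀ = 0)
    (hρ : ‖x₀‖ + s < ρ) (hα : |α| ≤ L) (hβ : |β| ≤ L) (hPL : PL u x₀ s α β ε)
    (hgap : 4 * (1 + Kc n lam Lam) * ε ≤ β - α)
    {z : Eucl n} (hz : z (Fin.last n) = 0) (hzs : ‖z - x₀‖ ≤ s / 2) : u z = 0 := by
  set K := Kc n lam Lam with hK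
  have hLam := hS.Lam_nonneg
  have hlam := hS.lam_pos
  have hL := hS.L_nonneg
  have hK0 : 0 ≤ K := by rw [hK, Kc]; positivity
  have hs0 := hs.pos
  have hε := hs.eps_pos
  set r := s / 2 with hr
  have hsr : s = 2 * r := by rw [hr]; ring
  set t := 2 * ε / r with ht
  have ht0 : 0 < t := by positivity
  have hts : t * r = 2 * ε := by rw [ht]; field_simp
  have hzρ : ‖z‖ + r < ρ := by
    have := norm_le_norm_add_norm_sub' z x₀
    linarith
  have hsub : ∀ x ∈ closedBall z r, x ∈ closedBall x₀ s := by
    intro x hx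
    rw [mem_closedBall, dist_eq_norm] at *
    have : x - x₀ = (x - z) + (z - x₀) := by abel
    rw [this]; exact (norm_add_le _ _).trans (by linarith)
  have hKε := hs.eps_le
  rw [← hK] at hKε
  refine le_antisymm ?_ (hS.nonneg z ?_ hz)
  · have key := hS.toEll.comparison_region (z := z) (r := r) (m := (α + β) / 2) (t := t)
      (γ := 0) ht0 hz hzρ
      hs0 hs.le ?_ ?_ ?_ (Ω := ball z r) isOpen_ball ball_subset_closedBall ?_ ?_ ?_ z
      (mem_ball_self hs0)
    · refine key.trans (le_of_eq ?_)
      rw [zero_add]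
      simp [bar, hz, pr]
    · rw [abs_div, abs_two, div_le_iff₀ two_pos]
      exact (abs_add_le _ _).trans (by linarith)
    · rw [mul_assoc 2, mul_assoc 2, mul_right_comm, hts, ← hK]; linarith
    · have := hs.tc_le
      have h2 : Tc n M lam Lam * r ≤ (2 * t) * r := by linarith
      exact le_of_mul_le_mul_right h2 hs0
    · intro x hx
      have h1 := hS.u_lip x x₀
      have h3 := hsub x (ball_subset_closedBall hx)
      rw [mem_closedBall, dist_eq_norm] at h3
      have h4 := le_of_abs_le h1
      have h5 := mul_le_mul_of_nonneg_left h3 hL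
      rw [hsr] at h5
      linarith
    · intro x hx hx'
      have hxc : x ∈ closedBall z r := closure_minimal ball_subset_closedBall isClosed_closedBall hx
      have h4 : ‖x - z‖ = r := by
        rw [mem_closedBall, dist_eq_norm] at hxc
        rw [mem_ball, dist_eq_norm] at hx'
        exact le_antisymm hxc (not_lt.1 hx')
      have h5 := le_bar_of_sphere (m := (α + β) / 2) hz ht0.le hK0 h4
      rw [sq, ← mul_assoc, hts] at h5
      rw [← hK, zero_add]
      rcases le_total 0 (x (Fin.last n)) with h6 | h6
      · have h7 := le_of_abs_le (hPL.up x (hsub x hxc) h6)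
        rw [abs_of_nonneg h6] at h5
        have h8 := mul_le_mul_of_nonneg_right hgap h6
        rw [hu, hsr] at h7
        linarith
      · have h7 := le_of_abs_le (hPL.down x (hsub x hxc) h6)
        rw [abs_of_nonpos h6] at h5
        have h8 := mul_le_mul_of_nonpos_right hgap h6
        rw [hu, hsr] at h7
        linarith
    · intro w hw hw0 hwn hwe
      have h1 : 0 ≤ En F F₀ u fun x => - w x := by
        refine hS.thin _ z r 1 hw.neg (fun x hx => ?_) hzρ one_pos fun x hx hx0 => ?_
        · rw [hw0 x fun h => hx (ball_subset_closedBall h), neg_zero]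
        · rcases (hwn x).eq_or_lt with h2 | h2
          · rw [← h2]; simpa using hS.nonneg x (mem_of_closedBall hzρ hx) hx0
          · rw [hwe x h2, zero_add, bar, hx0]
            have : 0 ≤ t * ‖pr (x - z)‖ ^ 2 := by positivity
            linarith
      rw [En_neg] at h1
      linarith
  · exact mem_of_closedBall hzρ (mem_closedBall_self hs0.le)

/-! ### Symmetries -/

lemma gradient_fun_neg (φ : Eucl n → ℝ) (x : Eucl n) :
    gradient (fun y => - φ y) x = - gradient φ x := by
  unfold gradient
  rw [fderiv_fun_neg, map_neg]

lemma Ell.neg (hE : Ell F F₀ ρ M lam Lam L u) :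
    Ell (fun x z p => - F x (-z) (-p)) (fun x z p => - F₀ x (-z) (-p)) ρ M lam Lam L
      (fun x => - u x) where
  lam_pos := hE.lam_pos
  Lam_nonneg := hE.Lam_nonneg
  L_nonneg := hE.L_nonneg
  L_le := hE.L_le
  F_lip x x' z z' p p' := by
    have := hE.F_lip x x' (-z) (-z') (-p) (-p')
    rw [neg_sub_neg, norm_sub_rev]
    rwa [neg_sub_neg, abs_sub_comm, neg_sub_neg, norm_sub_rev p'] at this
  F₀_lip x x' z z' p p' := by
    have := hE.F₀_lip x x' (-z) (-z') (-p) (-p')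
    rw [neg_sub_neg, abs_sub_comm]
    rwa [neg_sub_neg, abs_sub_comm z', neg_sub_neg, norm_sub_rev p'] at this
  F_bd x z p := by rw [norm_neg]; exact hE.F_bd _ _ _
  F₀_bd x z p := by rw [abs_neg]; exact hE.F₀_bd _ _ _
  mono x hx z hz p q hp hq := by
    have := hE.mono x hx (-z) (by rwa [abs_neg]) (-q) (-p) (by rwa [norm_neg]) (by rwa [norm_neg])
    rw [neg_sub_neg] at this ⊢
    exact this
  u_lip x y := by
    rw [neg_sub_neg, abs_sub_comm]; exact hE.u_lip x y
  u_bd x hx := by rw [abs_neg]; exact hE.u_bd x hx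

lemma En_neg_neg (φ : Eucl n → ℝ) :
    En (fun x z p => - F x (-z) (-p)) (fun x z p => - F₀ x (-z) (-p)) (fun x => - u x) φ =
      - En F F₀ u φ := by
  unfold En
  rw [← integral_neg]
  congr 1; ext x
  rw [gradient_fun_neg]
  simp only [neg_neg, inner_neg_left]
  ring

/-- The reflection across the thin hyperplane. -/
def refl (n : ℕ) : Eucl n ≃ₗᵢ[ℝ] Eucl n := Submodule.reflection (ℝ ∙ eLast n)ᗮ

lemma refl_apply (x : Eucl n) : refl n x = x - (2 * x (Fin.last n)) • eLast n := by
  rw [refl, Submodule.reflection_orthogonal_apply, Submodule.reflection_singleton_apply]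
  rw [real_inner_comm, inner_eLast, norm_eLast]
  simp only [RCLike.ofReal_real_eq_id, id, one_pow, div_one, mul_smul]
  module

@[simp] lemma refl_last (x : Eucl n) : refl n x (Fin.last n) = - x (Fin.last n) := by
  rw [refl_apply]; simp; ring

@[simp] lemma refl_refl (x : Eucl n) : refl n (refl n x) = x := by
  simp [refl]

lemma refl_of_last {x : Eucl n} (h : x (Fin.last n) = 0) : refl n x = x := by
  rw [refl_apply, h]; simp

lemma inner_refl (x y : Eucl n) : ⟪refl n x, y⟫_ℝ = ⟪x, refl n y⟫_ℝ := by
  conv_lhs => rw [← refl_refl y]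
  rw [LinearIsometryEquiv.inner_map_map]

lemma gradient_comp_isometry (R : Eucl n ≃ₗᵢ[ℝ] Eucl n) (f : Eucl n → ℝ) (x : Eucl n) :
    gradient (fun y => f (R y)) x = R.symm (gradient f (R x)) := by
  refine ext_inner_right ℝ fun v => ?_
  rw [inner_gradient]
  have h1 := R.toContinuousLinearEquiv.comp_right_fderiv (f := f) (x := x)
  have h2 : (fun y => f (R y)) = f ∘ R.toContinuousLinearEquiv := rfl
  rw [h2, h1]
  rw [← R.inner_map_map (R.symm _), R.apply_symm_apply, inner_gradient]
  rfl

lemma refl_symm (n : ℕ) : (refl n).symm = refl n := by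
  ext1 x; rw [LinearIsometryEquiv.symm_apply_eq, refl_refl]

lemma gradient_comp_refl (f : Eucl n → ℝ) (x : Eucl n) :
    gradient (fun y => f (refl n y)) x = refl n (gradient f (refl n x)) := by
  rw [gradient_comp_isometry, refl_symm]

lemma norm_refl_sub (x y : Eucl n) : ‖refl n x - refl n y‖ = ‖x - y‖ := by
  rw [← map_sub, LinearIsometryEquiv.norm_map]

lemma IsLip.comp_refl {φ : Eucl n → ℝ} (h : IsLip φ) : IsLip fun x => φ (refl n x) := by
  obtain ⟨C, hC⟩ := h.exists_abs_sub_le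
  refine IsLip.of_abs_sub_le (C := C) fun x y => ?_
  rw [← norm_refl_sub x y]; exact hC.2 _ _

lemma integral_comp_refl (f : Eucl n → ℝ) : ∫ x, f (refl n x) = ∫ x, f x :=
  (refl n).measurePreserving.integral_comp (refl n).toHomeomorph.measurableEmbedding f

lemma En_comp_refl (φ : Eucl n → ℝ) :
    En (fun x z p => refl n (F (refl n x) z (refl n p))) (fun x z p => F₀ (refl n x) z (refl n p))
      (fun x => u (refl n x)) φ = En F F₀ u fun x => φ (refl n x) := by
  unfold En
  rw [← integral_comp_refl]
  congr 1; ext x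
  simp only [gradient_comp_refl, refl_refl, inner_refl]

lemma Ell.comp_refl (hE : Ell F F₀ ρ M lam Lam L u) :
    Ell (fun x z p => refl n (F (refl n x) z (refl n p))) (fun x z p => F₀ (refl n x) z (refl n p))
      ρ M lam Lam L (fun x => u (refl n x)) where
  lam_pos := hE.lam_pos
  Lam_nonneg := hE.Lam_nonneg
  L_nonneg := hE.L_nonneg
  L_le := hE.L_le
  F_lip x x' z z' p p' := by
    rw [norm_refl_sub, ← norm_refl_sub x x', ← norm_refl_sub p p']
    exact hE.F_lip _ _ _ _ _ _
  F₀_lip x x' z z' p p' := by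
    rw [← norm_refl_sub x x', ← norm_refl_sub p p']
    exact hE.F₀_lip _ _ _ _ _ _
  F_bd x z p := by rw [LinearIsometryEquiv.norm_map]; exact hE.F_bd _ _ _
  F₀_bd x z p := hE.F₀_bd _ _ _
  mono x hx z hz p q hp hq := by
    have hx' : refl n x ∈ ball (0 : Eucl n) ρ := by
      rw [mem_ball_zero_iff, LinearIsometryEquiv.norm_map, ← mem_ball_zero_iff]; exact hx
    have := hE.mono (refl n x) hx' z hz (refl n p) (refl n q)
      (by rwa [LinearIsometryEquiv.norm_map]) (by rwa [LinearIsometryEquiv.norm_map])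
    rw [norm_refl_sub] at this
    rwa [← map_sub, inner_refl, map_sub]
  u_lip x y := by rw [← norm_refl_sub x y]; exact hE.u_lip _ _
  u_bd x hx := by
    refine hE.u_bd _ ?_
    rw [mem_ball_zero_iff, LinearIsometryEquiv.norm_map, ← mem_ball_zero_iff]; exact hx

lemma Sol.comp_refl (hS : Sol F F₀ ρ M lam Lam L u) :
    Sol (fun x z p => refl n (F (refl n x) z (refl n p))) (fun x z p => F₀ (refl n x) z (refl n p))
      ρ M lam Lam L (fun x => u (refl n x)) where
  toEll := hS.toEll.comp_refl
  nonneg x hx hx0 := by rw [refl_of_last hx0]; exact hS.nonneg x hx hx0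
  thin φ x₀ r ε hφ h0 hr hε hpos := by
    rw [En_comp_refl]
    have hmem : ∀ x, x ∈ closedBall (refl n x₀) r ↔ refl n x ∈ closedBall x₀ r := by
      intro x
      rw [mem_closedBall, mem_closedBall, dist_eq_norm, dist_eq_norm, ← norm_refl_sub, refl_refl]
    refine hS.thin _ (refl n x₀) r ε hφ.comp_refl ?_ ?_ hε ?_
    · intro x hx; exact h0 _ fun h => hx ((hmem x).2 h)
    · rwa [LinearIsometryEquiv.norm_map]
    · intro x hx hx0
      have h1 := hpos (refl n x) ((hmem x).1 hx) (by rw [refl_last, hx0, neg_zero])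
      rw [refl_refl] at h1
      rwa [refl_of_last hx0] at h1 ⊢

lemma Kc_nonneg (hlam : 0 < lam) (hLam : 0 ≤ Lam) : 0 ≤ Kc n lam Lam := by
  rw [Kc]; positivity

lemma add_smul_eLast_last {z : Eucl n} (hz : z (Fin.last n) = 0) (y : ℝ) :
    (z + y • eLast n) (Fin.last n) = y := by simp [hz]

lemma norm_smul_eLast (y : ℝ) : ‖y • eLast n‖ = |y| := by
  rw [norm_smul, norm_eLast, Real.norm_eq_abs, mul_one]

lemma norm_sub_add_smul_eLast {z : Eucl n} (hz : z (Fin.last n) = 0) (x : Eucl n) :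
    ‖x - (z + x (Fin.last n) • eLast n)‖ ≤ ‖x - z‖ := by
  have : x - (z + x (Fin.last n) • eLast n) = pr (x - z) := by
    rw [pr, PiLp.sub_apply, hz, sub_zero]; abel
  rw [this]; exact norm_pr_le _

/-- Nearly one-dimensional functions are nearly affine along the normal line, upper bound. -/
lemma Ell.line_upper (hE : Ell F F₀ ρ M lam Lam L u) {z : Eucl n} {s R t α ε : ℝ} (ht : 0 < t)
    (hz : z (Fin.last n) = 0) (hρ : ‖z‖ + R < ρ) (hs : 0 < s) (hsR : s ≤ R)
    (hR : (3 * L + 3) * R ≤ 1) (htr : 2 * t * (1 + Kc n lam Lam) * R ≤ 1)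
    (htc : Tc n M lam Lam ≤ 2 * t) (hlat : 2 * L * s ≤ t * (R ^ 2 - s ^ 2)) (hε : 0 ≤ ε)
    (htan : ∀ x ∈ closedBall z R, ∀ y ∈ closedBall z R, x (Fin.last n) = y (Fin.last n) →
      |u x - u y| ≤ ε * ‖x - y‖)
    (hα : α * s = u (z + s • eLast n) - u z)
    (hEn : ∀ w, IsLip w → (∀ x ∉ closedBall z R, w x = 0) → (∀ x, 0 ≤ w x) →
      (∀ x, x (Fin.last n) ≤ 0 → w x = 0) → En F F₀ u w ≤ 0)
    {y : ℝ} (hy : 0 ≤ y) (hys : y ≤ s) :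
    u (z + y • eLast n) ≤ u z + α * y + (ε * R + t * Kc n lam Lam * s ^ 2) := by
  set K := Kc n lam Lam with hK
  have hLam := hE.Lam_nonneg
  have hlam := hE.lam_pos
  have hL := hE.L_nonneg
  have hK0 : 0 ≤ K := Kc_nonneg hlam hLam
  have hR0 : 0 < R := hs.trans_le hsR
  have hεR : 0 ≤ ε * R := by positivity
  have htK : 0 ≤ t * K * s ^ 2 := by positivity
  have hαL : |α| ≤ L := by
    have h1 := hE.u_lip (z + s • eLast n) z
    rw [← hα, add_sub_cancel_left, norm_smul_eLast, abs_mul] at h1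
    exact le_of_mul_le_mul_right h1 (abs_pos.2 hs.ne')
  rcases hy.eq_or_lt with rfl | hy0
  · rw [zero_smul, add_zero, mul_zero]; linarith
  rcases hys.eq_or_lt with rfl | hys'
  · rw [hα]; linarith
  set Ω : Set (Eucl n) := ball z R ∩ {x | 0 < x (Fin.last n) ∧ x (Fin.last n) < s} with hΩ
  have hcont : Continuous fun x : Eucl n => x (Fin.last n) := by fun_prop
  have hΩo : IsOpen Ω := isOpen_ball.inter
    ((isOpen_lt continuous_const hcont).inter (isOpen_lt hcont continuous_const))
  have hΩb : Ω ⊆ closedBall z R := fun x hx => ball_subset_closedBall hx.1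
  have hcl : closure Ω ⊆ closedBall z R ∩ {x | 0 ≤ x (Fin.last n) ∧ x (Fin.last n) ≤ s} :=
    closure_minimal (fun x hx => ⟨hΩb hx, (le_of_lt hx.2.1 : (0 : ℝ) ≤ x (Fin.last n)),
        (le_of_lt hx.2.2 : x (Fin.last n) ≤ s)⟩)
      (isClosed_closedBall.inter ((isClosed_le continuous_const hcont).inter
        (isClosed_le hcont continuous_const)))
  have hmem : ∀ y : ℝ, 0 ≤ y → y ≤ R → z + y • eLast n ∈ closedBall z R := by
    intro y h0 h1
    rw [mem_closedBall, dist_eq_norm, add_sub_cancel_left, norm_smul_eLast, abs_of_nonneg h0]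
    exact h1
  have htan' : ∀ x ∈ closedBall z R, 0 ≤ x (Fin.last n) → x (Fin.last n) ≤ s →
      u x ≤ u (z + x (Fin.last n) • eLast n) + ε * R := by
    intro x hx h0 h1
    have h2 := le_of_abs_le (htan x hx _ (hmem _ h0 (h1.trans hsR))
      (add_smul_eLast_last hz _).symm)
    have h3 := norm_sub_add_smul_eLast hz x
    rw [mem_closedBall, dist_eq_norm] at hx
    have h4 := mul_le_mul_of_nonneg_left (h3.trans hx) hε
    linarith
  have hdist_pr : pr (z + y • eLast n - z) = 0 := by
    rw [add_sub_cancel_left, pr]; simp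
  have key := hE.comparison_region (z := z) (r := R) (m := α) (t := t)
    (γ := u z + ε * R + t * K * s ^ 2) ht hz hρ hR0 hR (hαL.trans (by linarith)) htr htc hΩo hΩb
    ?_ ?_ ?_ (z + y • eLast n) ⟨?_, ?_⟩
  · refine key.trans ?_
    rw [bar, add_smul_eLast_last hz, hdist_pr, norm_zero]
    have : 0 ≤ t * (K * y ^ 2) := by positivity
    linarith
  · intro x hx
    have h4 := le_of_abs_le (hE.u_lip x z)
    have h3 := hΩb hx
    rw [mem_closedBall, dist_eq_norm] at h3
    have h5 := mul_le_mul_of_nonneg_left h3 hL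
    have h6 : 0 ≤ L * R := by positivity
    linarith
  · intro x hx hx'
    obtain ⟨h1, h2, h3⟩ := hcl hx
    have h2 : 0 ≤ x (Fin.last n) := h2
    have h3 : x (Fin.last n) ≤ s := h3
    have h4 := htan' x h1 h2 h3
    have h5 : t * K * x (Fin.last n) ^ 2 ≤ t * K * s ^ 2 :=
      mul_le_mul_of_nonneg_left (pow_le_pow_left₀ h2 h3 2) (by positivity)
    have h6 : 0 ≤ t * ‖pr (x - z)‖ ^ 2 := by positivity
    rw [← hK, bar]
    rcases h2.eq_or_lt with h7 | h7
    · rw [← h7, zero_smul, add_zero] at h4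
      rw [← h7]
      linarith
    rcases h3.eq_or_lt with h8 | h8
    · rw [h8, ] at h4
      rw [h8]
      linarith
    · have h9 : ‖x - z‖ = R := by
        rw [mem_closedBall, dist_eq_norm] at h1
        refine le_antisymm h1 ?_
        by_contra hc
        exact hx' ⟨by rw [mem_ball, dist_eq_norm]; exact not_le.1 hc, h7, h8⟩
      have h10 := norm_sq_eq (x - z)
      rw [h9, PiLp.sub_apply, hz, sub_zero] at h10
      have h11 : t * (R ^ 2 - s ^ 2) ≤ t * ‖pr (x - z)‖ ^ 2 := by
        refine mul_le_mul_of_nonneg_left ?_ ht.le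
        have := pow_le_pow_left₀ h2 h3 2
        linarith
      have h12 := le_of_abs_le (hE.u_lip (z + x (Fin.last n) • eLast n) z)
      rw [add_sub_cancel_left, norm_smul_eLast, abs_of_nonneg h2] at h12
      have h13 := mul_le_mul_of_nonneg_right (neg_le_of_abs_le hαL) h2
      have h14 := mul_le_mul_of_nonneg_left h3 hL
      linarith
  · intro w hw hw0 hwn _
    refine hEn w hw (fun x hx => hw0 x fun h => hx (hΩb h)) hwn fun x hx => hw0 x fun h => ?_
    exact absurd h.2.1 (not_lt.2 hx)
  · rw [mem_ball, dist_eq_norm, add_sub_cancel_left, norm_smul_eLast, abs_of_nonneg hy]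
    linarith
  · show 0 < (z + y • eLast n) (Fin.last n) ∧ (z + y • eLast n) (Fin.last n) < s
    rw [add_smul_eLast_last hz]; exact ⟨hy0, hys'⟩

lemma Sol.En_eq_zero_of_thin (hS : Sol F F₀ ρ M lam Lam L u) {φ : Eucl n → ℝ} {x₀ : Eucl n} {r : ℝ}
    (hφ : IsLip φ) (h0 : ∀ x ∉ closedBall x₀ r, φ x = 0) (hr : ‖x₀‖ + r < ρ)
    (hp : ∀ x, x (Fin.last n) = 0 → φ x = 0) : En F F₀ u φ = 0 := by
  have h1 := hS.En_nonneg hφ h0 hr fun x _ hx => (hp x hx).ge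
  have h2 := hS.En_nonneg (φ := fun x => - φ x) hφ.neg (fun x hx => by rw [h0 x hx, neg_zero]) hr
    fun x _ hx => by rw [hp x hx, neg_zero]
  rw [En_neg] at h2
  linarith

/-- Nearly one-dimensional solutions are nearly affine in the upper half ball. -/
lemma Sol.affine_up (hS : Sol F F₀ ρ M lam Lam L u) {z : Eucl n} {s R t ε : ℝ} (ht : 0 < t)
    (hz : z (Fin.last n) = 0) (hρ : ‖z‖ + R < ρ) (hs : 0 < s) (hsR : s ≤ R)
    (hR : (3 * L + 3) * R ≤ 1) (htr : 2 * t * (1 + Kc n lam Lam) * R ≤ 1)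
    (htc : Tc n M lam Lam ≤ 2 * t) (hlat : 2 * L * s ≤ t * (R ^ 2 - s ^ 2)) (hε : 0 ≤ ε)
    (htan : ∀ x ∈ closedBall z R, ∀ y ∈ closedBall z R, x (Fin.last n) = y (Fin.last n) →
      |u x - u y| ≤ ε * ‖x - y‖) :
    ∃ α, |α| ≤ L ∧ ∀ x ∈ closedBall z s, 0 ≤ x (Fin.last n) →
      |u x - u z - α * x (Fin.last n)| ≤ 2 * ε * R + t * Kc n lam Lam * s ^ 2 := by
  set α := (u (z + s • eLast n) - u z) / s with hαd
  have hα : α * s = u (z + s • eLast n) - u z := by rw [hαd]; field_simp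
  have hL := hS.L_nonneg
  refine ⟨α, ?_, fun x hx hx0 => ?_⟩
  · have h1 := hS.u_lip (z + s • eLast n) z
    rw [← hα, add_sub_cancel_left, norm_smul_eLast, abs_mul] at h1
    exact le_of_mul_le_mul_right h1 (abs_pos.2 hs.ne')
  · rw [mem_closedBall, dist_eq_norm] at hx
    have hxs : x (Fin.last n) ≤ s := by
      have := (le_abs_self _).trans (abs_last_le (x - z))
      rw [PiLp.sub_apply, hz, sub_zero] at this
      exact this.trans hx
    have h0 : ∀ w, IsLip w → (∀ x ∉ closedBall z R, w x = 0) →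
      (∀ x, x (Fin.last n) ≤ 0 → w x = 0) → En F F₀ u w = 0 := fun w hw hw0 hwn =>
        hS.En_eq_zero_of_thin hw hw0 hρ fun x hx => hwn x hx.le
    have h1 := hS.toEll.line_upper ht hz hρ hs hsR hR htr htc hlat hε htan hα
      (fun w hw hw0 _ hwn => (h0 w hw hw0 hwn).le) hx0 hxs
    have h2 := hS.toEll.neg.line_upper (α := -α) ht hz hρ hs hsR hR htr htc hlat hε
      (fun x hx y hy hxy => by rw [neg_sub_neg, abs_sub_comm]; exact htan x hx y hy hxy)
      (by rw [neg_mul, hα]; ring)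
      (fun w hw hw0 _ hwn => by rw [En_neg_neg, h0 w hw hw0 hwn, neg_zero]) hx0 hxs
    have h3 := htan x (by rw [mem_closedBall, dist_eq_norm]; exact hx.trans hsR)
      (z + x (Fin.last n) • eLast n) (by
        rw [mem_closedBall, dist_eq_norm, add_sub_cancel_left, norm_smul_eLast, abs_of_nonneg hx0]
        exact hxs.trans hsR) (add_smul_eLast_last hz _).symm
    have h4 := mul_le_mul_of_nonneg_left ((norm_sub_add_smul_eLast hz x).trans (hx.trans hsR)) hε
    have h5 := abs_le.1 (h3.trans h4)
    rw [abs_le]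
    constructor <;> linarith [h5.1, h5.2]

/-- Solutions have no convex kinks across the thin hyperplane. -/
lemma Sol.no_kink (hS : Sol F F₀ ρ M lam Lam L u) {z : Eucl n} {s α β ε : ℝ}
    (hs : SmallScale n M lam Lam L (2 * ε) s) (hz : z (Fin.last n) = 0)
    (hρ : ‖z‖ + s < ρ) (hα : |α| ≤ L) (hβ : |β| ≤ L) (hPL : PL u z s α β ε) :
    α ≤ β + 4 * (1 + Kc n lam Lam) * ε := by
  by_contra hgap
  push Not at hgap
  set K := Kc n lam Lam with hK
  have hK0 : 0 ≤ K := Kc_nonneg hS.lam_pos hS.Lam_nonneg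
  have hL := hS.L_nonneg
  have hs0 := hs.pos
  have hε : 0 < ε := by have := hs.eps_pos; linarith
  set t := 2 * ε / s with ht
  have ht0 : 0 < t := by positivity
  have hts : t * s = 2 * ε := by rw [ht]; field_simp
  have hKε := hs.eps_le
  rw [← hK] at hKε
  have hε1 : ε ≤ 1 := by
    have : 0 ≤ ε * K := by positivity
    linarith
  have key := hS.toEll.neg.comparison_region (z := z) (r := s) (m := -((α + β) / 2)) (t := t)
    (γ := - u z - ε * s / 2) ht0 hz hρ
    hs0 hs.le ?_ ?_ ?_ (Ω := ball z s) isOpen_ball ball_subset_closedBall ?_ ?_ ?_ z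
    (mem_ball_self hs0)
  · simp only [bar, hz, sub_self, pr] at key
    have : 0 < ε * s := by positivity
    simp at key
    linarith
  · rw [abs_neg, abs_div, abs_two, div_le_iff₀ two_pos]
    exact (abs_add_le _ _).trans (by linarith)
  · rw [mul_assoc 2, mul_assoc 2, mul_right_comm, hts, ← hK]; linarith
  · have := hs.tc_le
    have h2 : Tc n M lam Lam * s ≤ (2 * t) * s := by linarith
    exact le_of_mul_le_mul_right h2 hs0
  · intro x hx
    have h1 := hS.u_lip x z
    rw [mem_ball, dist_eq_norm] at hx
    have h4 := neg_le_of_abs_le h1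
    have h5 := mul_le_mul_of_nonneg_left hx.le hL
    have h6 : 0 ≤ L * s := by positivity
    have h7 := mul_le_mul_of_nonneg_right hε1 hs0.le
    linarith
  · intro x hx hx'
    have hxc : x ∈ closedBall z s := closure_minimal ball_subset_closedBall isClosed_closedBall hx
    have h4 : ‖x - z‖ = s := by
      rw [mem_closedBall, dist_eq_norm] at hxc
      rw [mem_ball, dist_eq_norm] at hx'
      exact le_antisymm hxc (not_lt.1 hx')
    have h5 := le_bar_of_sphere (m := -((α + β) / 2)) hz ht0.le hK0 h4
    rw [sq, ← mul_assoc, hts] at h5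
    rw [← hK]
    have h9 : 0 < ε * s := by positivity
    rcases le_total 0 (x (Fin.last n)) with h6 | h6
    · have h7 := neg_le_of_abs_le (hPL.up x hxc h6)
      rw [abs_of_nonneg h6] at h5
      have h8 := mul_le_mul_of_nonneg_right hgap.le h6
      linarith
    · have h7 := neg_le_of_abs_le (hPL.down x hxc h6)
      rw [abs_of_nonpos h6] at h5
      have h8 := mul_le_mul_of_nonpos_right hgap.le h6
      linarith
  · intro w hw hw0 hwn _
    rw [En_neg_neg, neg_nonpos]
    exact hS.En_nonneg hw (fun x hx => hw0 x fun h => hx (ball_subset_closedBall h)) hρ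
      fun x _ _ => hwn x

lemma eventually_mul_lt (c : ℝ) {d : ℝ} (hd : 0 < d) : ∀ᶠ r in 𝓝[>] (0 : ℝ), c * r < d := by
  have h : Tendsto (fun r : ℝ => c * r) (𝓝 0) (𝓝 (c * 0)) := tendsto_id.const_mul c
  rw [mul_zero] at h
  exact (h.mono_left nhdsWithin_le_nhds).eventually (gt_mem_nhds hd)

lemma Ell.Tc_pos (hE : Ell F F₀ ρ M lam Lam L u) : 0 < Tc n M lam Lam := by
  have h1 := hE.lam_pos
  have h2 := hE.Lam_nonneg
  have h3 : 0 ≤ M := by linarith [hE.L_nonneg, hE.L_le]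
  rw [Tc]; positivity

lemma Ell.exists_smallScale (hE : Ell F F₀ ρ M lam Lam L u) {ε : ℝ} (hε : 0 < ε)
    (h : 4 * ε * (1 + Kc n lam Lam) ≤ 1) :
    ∃ r > 0, ∀ s, 0 < s → s ≤ r → SmallScale n M lam Lam L ε s := by
  obtain ⟨r, ⟨h1, h2⟩, h3⟩ := (((eventually_mul_lt (3 * L + 3) one_pos).and
    (eventually_mul_lt (Tc n M lam Lam) (by positivity : 0 < 2 * ε))).and
      self_mem_nhdsWithin).exists
  have hL := hE.L_nonneg
  refine ⟨r, h3, fun s hs hsr => ⟨hε, hs, ?_, h, ?_⟩⟩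
  · exact (mul_le_mul_of_nonneg_left hsr (by positivity)).trans h1.le
  · exact (mul_le_mul_of_nonneg_left hsr hE.Tc_pos.le).trans h2.le

/-- At contact points solutions are close to two-plane solutions, uniformly at all small scales. -/
lemma Sol.exists_PL (hS : Sol F F₀ ρ M lam Lam L u) {x₀ : Eucl n}
    (hx₀ : x₀ (Fin.last n) = 0) (hu : u x₀ = 0) (hρ : x₀ ∈ ball (0 : Eucl n) ρ) {ε : ℝ}
    (hε : 0 < ε) (hεK : 8 * ε * (1 + Kc n lam Lam) ≤ 1) :
    ∃ r > 0, ∀ z, z (Fin.last n) = 0 → ‖z - x₀‖ ≤ r → ∀ s, 0 < s → s ≤ r →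
      ∃ α β, |α| ≤ L ∧ |β| ≤ L ∧ PL u z s α β ε ∧ α ≤ β + 4 * (1 + Kc n lam Lam) * ε := by
  set K := Kc n lam Lam with hK
  have hK0 : 0 ≤ K := Kc_nonneg hS.lam_pos hS.Lam_nonneg
  have hL := hS.L_nonneg
  obtain ⟨N, hN2, hN1, hN3⟩ : ∃ N : ℝ, 2 ≤ N ∧ 8 * (L + 1) * (1 + K) ≤ N ∧
      8 * (L + 1) * K / ε ≤ N :=
    ⟨max 2 (max (8 * (L + 1) * (1 + K)) (8 * (L + 1) * K / ε)), le_max_left _ _,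
      (le_max_left _ _).trans (le_max_right _ _), (le_max_right _ _).trans (le_max_right _ _)⟩
  have hN0 : 0 < N := by linarith
  obtain ⟨r₁, hr₁, htan⟩ := hS.tangential_small hx₀ hu hρ (ε := ε / (4 * N)) (by positivity)
  rw [mem_ball_zero_iff] at hρ
  obtain ⟨r₂, hr₂, hss⟩ := hS.toEll.exists_smallScale (ε := 2 * ε) (by positivity)
    (by rw [← hK]; linarith)
  obtain ⟨r, ⟨⟨⟨⟨⟨h1, h2⟩, h3⟩, h4⟩, h5⟩, h6⟩⟩ := ((((((eventually_mul_lt (1 + N) hr₁).and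
    (eventually_mul_lt (1 + N) (sub_pos.2 hρ))).and
    (eventually_mul_lt ((3 * L + 3) * N) one_pos)).and
    (eventually_mul_lt (Tc n M lam Lam * N ^ 2) (by positivity : 0 < 8 * (L + 1)))).and
    (eventually_mul_lt 1 hr₂)).and self_mem_nhdsWithin).exists
  have h6 : 0 < r := h6
  refine ⟨r, h6, fun z hz hzr s hs hsr => ?_⟩
  have hNs : N * s ≤ N * r := mul_le_mul_of_nonneg_left hsr hN0.le
  have hzn : ‖z‖ ≤ ‖x₀‖ + r := by
    have := norm_le_norm_add_norm_sub' z x₀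
    linarith
  set t := 4 * (L + 1) / (N ^ 2 * s) with ht
  have ht0 : 0 < t := by positivity
  have htN : t * (N * s) ^ 2 = 4 * (L + 1) * s := by rw [ht]; field_simp
  have htNs : t * (N * s) * N = 4 * (L + 1) := by rw [ht]; field_simp
  have hzρ : ‖z‖ + N * s < ρ := by linarith
  have hsR : s ≤ N * s := by
    have := mul_le_mul_of_nonneg_right hN2 hs.le
    linarith
  have hR : (3 * L + 3) * (N * s) ≤ 1 := by
    have := mul_le_mul_of_nonneg_left hNs (by positivity : 0 ≤ 3 * L + 3)
    linarith
  have htr : 2 * t * (1 + K) * (N * s) ≤ 1 := by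
    have h7 : 2 * t * (1 + K) * (N * s) * N = 8 * (L + 1) * (1 + K) := by
      linear_combination 2 * (1 + K) * htNs
    rw [← mul_le_mul_iff_left₀ hN0, h7]
    linarith
  have htc : Tc n M lam Lam ≤ 2 * t := by
    have h7 : 2 * t * (N ^ 2 * s) = 8 * (L + 1) := by rw [ht]; field_simp; ring
    have h8 := mul_le_mul_of_nonneg_left hsr
      (mul_nonneg hS.toEll.Tc_pos.le (sq_nonneg N))
    have h9 : Tc n M lam Lam * (N ^ 2 * s) ≤ 2 * t * (N ^ 2 * s) := by
      rw [h7, ← mul_assoc]; exact h8.trans h4.le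
    exact le_of_mul_le_mul_right h9 (by positivity)
  have hts2 : t * s ^ 2 * N ^ 2 = 4 * (L + 1) * s := by rw [← htN]; ring
  have hN4 : 4 ≤ N ^ 2 := by
    have := pow_le_pow_left₀ (by norm_num) hN2 2
    linarith
  have hlat : 2 * L * s ≤ t * ((N * s) ^ 2 - s ^ 2) := by
    have h7 : 0 ≤ t * s ^ 2 := by positivity
    have h8 := mul_le_mul_of_nonneg_left hN4 h7
    rw [mul_sub, htN]
    have : 0 ≤ L * s := by positivity
    linarith
  have hbound : 2 * (ε / (4 * N)) * (N * s) + t * K * s ^ 2 ≤ ε * s := by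
    have h7 : 2 * (ε / (4 * N)) * (N * s) = ε * s / 2 := by field_simp; ring
    rw [div_le_iff₀ hε] at hN3
    have h8 : t * K * s ^ 2 * N ^ 2 = 4 * (L + 1) * K * s := by linear_combination K * hts2
    have h9 : 8 * (L + 1) * K ≤ ε * N ^ 2 := by
      have : N * 1 ≤ N * N := mul_le_mul_of_nonneg_left (by linarith) hN0.le
      have := mul_le_mul_of_nonneg_right this hε.le
      linarith
    have h10 : t * K * s ^ 2 * N ^ 2 ≤ ε * s / 2 * N ^ 2 := by
      have := mul_le_mul_of_nonneg_right h9 hs.le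
      rw [h8]; linarith
    have := le_of_mul_le_mul_right h10 (by positivity)
    rw [h7]; linarith
  have hsub : ∀ x ∈ closedBall z (N * s), x ∈ ball x₀ r₁ := by
    intro x hx
    rw [mem_closedBall, dist_eq_norm] at hx
    rw [mem_ball, dist_eq_norm]
    have : x - x₀ = (x - z) + (z - x₀) := by abel
    rw [this]
    exact (norm_add_le _ _).trans_lt (by linarith)
  obtain ⟨α, hα, hup⟩ := hS.affine_up ht0 hz hzρ hs hsR hR htr htc hlat
    (by positivity : 0 ≤ ε / (4 * N))
    fun x hx y hy hxy => htan x (hsub x hx) y (hsub y hy) hxy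
  have hrefl : ∀ w : ℝ, ∀ x ∈ closedBall z w, refl n x ∈ closedBall z w := by
    intro w x hx
    rw [mem_closedBall, dist_eq_norm] at hx ⊢
    rwa [← refl_of_last hz, norm_refl_sub]
  obtain ⟨β, hβ, hdown⟩ := hS.comp_refl.affine_up ht0 hz hzρ hs hsR hR htr htc hlat
    (by positivity : 0 ≤ ε / (4 * N))
    fun x hx y hy hxy => by
      rw [← norm_refl_sub x y]
      refine htan _ (hsub _ (hrefl _ _ hx)) _ (hsub _ (hrefl _ _ hy)) ?_
      rw [refl_last, refl_last, hxy]
  have hPL : PL u z s α (-β) ε := by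
    refine ⟨fun x hx hx0 => (hup x hx hx0).trans hbound, fun x hx hx0 => ?_⟩
    have h7 := hdown (refl n x) (hrefl _ _ hx) (by rw [refl_last]; linarith)
    rw [refl_refl, refl_of_last hz, refl_last] at h7
    rw [neg_mul]
    rw [mul_neg] at h7
    exact h7.trans hbound
  refine ⟨α, -β, hα, by rwa [abs_neg], hPL, ?_⟩
  exact hS.no_kink (hss s hs (by linarith)) hz (by linarith) hα (by rwa [abs_neg]) hPL

/-- One-sided slope bound from below. -/
lemma Sol.barrier_lower (hS : Sol F F₀ ρ M lam Lam L u) {z : Eucl n} {s α ε : ℝ}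
    (hs : SmallScale n M lam Lam L ε s) (hz : z (Fin.last n) = 0) (hρ : ‖z‖ + s < ρ)
    (hα : |α| ≤ L)
    (hlow : ∀ x ∈ closedBall z s, 0 ≤ x (Fin.last n) → α * x (Fin.last n) - ε * s ≤ u x)
    {y : ℝ} (hy : 0 ≤ y) (hys : y < s) :
    (α - (1 + Kc n lam Lam) * ε) * y ≤ u (z + y • eLast n) := by
  have := hS.toEll.neg.barrier_upper (α := -α) hs hz hρ (by rwa [abs_neg])
    (fun x hx hx0 => neg_nonpos.2 (hS.nonneg x (mem_of_closedBall hρ hx) hx0))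
    (fun x hx hx0 => by have := hlow x hx hx0; linarith)
    (fun w hw hw0 _ hwn => by
      rw [En_neg_neg, hS.En_eq_zero_of_thin hw hw0 hρ fun x hx => hwn x hx.le, neg_zero])
    hy hys
  linarith

lemma closedBall_subset_of_norm {x₀ z : Eucl n} {r s R : ℝ} (h : ‖z - x₀‖ ≤ r) (hR : r + s ≤ R) :
    closedBall z s ⊆ closedBall x₀ R := by
  refine closedBall_subset_closedBall' ?_
  rw [dist_eq_norm]; linarith

lemma refl_add_smul {z : Eucl n} (hz : z (Fin.last n) = 0) (y : ℝ) :
    refl n (z + y • eLast n) = z + (-y) • eLast n := by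
  rw [refl_apply, add_smul_eLast_last hz]
  module

/-- The slope from above is essentially constant on the contact set near a contact point. -/
lemma Sol.slope_stable (hS : Sol F F₀ ρ M lam Lam L u) {x₀ : Eucl n}
    (hx₀ : x₀ (Fin.last n) = 0) (hu : u x₀ = 0) (hρ : x₀ ∈ ball (0 : Eucl n) ρ) {ε : ℝ}
    (hε : 0 < ε) (hεK : 16 * ε * (1 + Kc n lam Lam) ≤ 1) :
    ∃ r > 0, ∃ α : ℝ, ∀ z, z (Fin.last n) = 0 → u z = 0 → ‖z - x₀‖ ≤ r → ∀ s, 0 < s → s < r →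
      ∀ x ∈ closedBall z s, 0 ≤ x (Fin.last n) →
        |u x - α * x (Fin.last n)| ≤ 14 * (1 + Kc n lam Lam) * ε * s := by
  set K := Kc n lam Lam with hK
  have hK0 : 0 ≤ K := Kc_nonneg hS.lam_pos hS.Lam_nonneg
  have hL := hS.L_nonneg
  have hKε : 0 ≤ (1 + K) * ε := by positivity
  have hKε' : ε ≤ (1 + K) * ε := by have : 0 ≤ K * ε := by positivity
                                    linarith
  obtain ⟨r₁, hr₁, hPL⟩ := hS.exists_PL hx₀ hu hρ hε (by rw [← hK]; linarith)
  obtain ⟨r₂, hr₂, hs2⟩ := hS.toEll.exists_smallScale (ε := 2 * ε) (by positivity)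
    (by rw [← hK]; linarith)
  obtain ⟨r₄, hr₄, hs4⟩ := hS.toEll.exists_smallScale (ε := 4 * ε) (by positivity)
    (by rw [← hK]; linarith)
  rw [mem_ball_zero_iff] at hρ
  obtain ⟨s, hs, hs_r1, hs_r2, hs_r4, hsρ⟩ : ∃ s > 0, s ≤ r₁ ∧ s ≤ r₂ ∧ s ≤ r₄ ∧
      2 * s < ρ - ‖x₀‖ := by
    obtain ⟨s, ⟨⟨⟨h1, h2⟩, h3⟩, h4⟩, h5⟩ := ((((eventually_mul_lt 1 hr₁).and
      (eventually_mul_lt 1 hr₂)).and (eventually_mul_lt 1 hr₄)).and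
      (eventually_mul_lt 2 (sub_pos.2 hρ))).and self_mem_nhdsWithin |>.exists
    exact ⟨s, h5, by linarith, by linarith, by linarith, h4⟩
  obtain ⟨α, β, hα, hβ, hP, -⟩ := hPL x₀ hx₀ (by simpa using hr₁.le) s hs hs_r1
  have hsc := hs4 (s / 4) (by positivity) (by linarith)
  refine ⟨s / 8, by positivity, α, fun z hz huz hzr s' hs' hss x hx hx0 => ?_⟩
  have hzρ : ‖z‖ + s / 4 < ρ := by
    have := norm_le_norm_add_norm_sub' z x₀
    linarith
  have hsub : closedBall z (s / 4) ⊆ closedBall x₀ s := closedBall_subset_of_norm hzr (by linarith)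
  have hxd : x (Fin.last n) ≤ s' := by
    rw [mem_closedBall, dist_eq_norm] at hx
    have := (le_abs_self _).trans (abs_last_le (x - z))
    rw [PiLp.sub_apply, hz, sub_zero] at this
    exact this.trans hx
  have hlow : ∀ x ∈ closedBall z (s / 4), 0 ≤ x (Fin.last n) →
      α * x (Fin.last n) - 4 * ε * (s / 4) ≤ u x := by
    intro x hx hx0
    have := neg_le_of_abs_le (hP.up x (hsub hx) hx0)
    rw [hu] at this; linarith
  rcases le_or_gt (4 * (1 + K) * ε) (β - α) with hgap | hgap
  · have hcontact : ∀ z, z (Fin.last n) = 0 → ‖z - x₀‖ ≤ s / 2 → u z = 0 := fun z hz hzs =>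
      hS.contact_of_gap (hs2 _ (by positivity) (by linarith)) hu (by linarith) hα hβ hP hgap hz hzs
    have hpz : pr x + x (Fin.last n) • eLast n = x := by rw [pr]; abel
    have hpr : ‖pr x - x₀‖ ≤ s / 4 := by
      have h1 : pr x - x₀ = pr (x - z) + (z - x₀) := by rw [pr_sub, pr_of_last hz]; abel
      rw [h1]
      refine (norm_add_le _ _).trans ?_
      have h2 := norm_pr_le (x - z)
      rw [mem_closedBall, dist_eq_norm] at hx
      linarith
    have hsub' : closedBall (pr x) (s / 4) ⊆ closedBall x₀ s :=
      closedBall_subset_of_norm hpr (by linarith)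
    have hzρ' : ‖pr x‖ + s / 4 < ρ := by
      have := norm_le_norm_add_norm_sub' (pr x) x₀
      linarith
    have h1 := hS.barrier_lower (α := α) hsc (pr_last x) hzρ' hα (fun x hx hx0 => by
      have := neg_le_of_abs_le (hP.up x (hsub' hx) hx0)
      rw [hu] at this; linarith) hx0 (by linarith)
    have h2 := hS.toEll.barrier_upper (α := α) hsc (pr_last x) hzρ' hα (fun v hv hv0 => by
      have h3 := closedBall_subset_of_norm (R := s / 2) hpr (by linarith) hv
      rw [mem_closedBall, dist_eq_norm] at h3
      exact (hcontact v hv0 h3).le) (fun x hx hx0 => by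
      have := le_of_abs_le (hP.up x (hsub' hx) hx0)
      rw [hu] at this; linarith)
      (fun w hw hw0 _ hwn => (hS.En_eq_zero_of_thin hw hw0 hzρ' fun x hx => hwn x hx.le).le)
      hx0 (by linarith)
    rw [hpz, ← hK] at h1 h2
    have h3 := mul_le_mul_of_nonneg_left hxd hKε
    have h4 : 0 ≤ (1 + K) * ε * s' := by positivity
    rw [abs_le]
    constructor <;> linarith
  · obtain ⟨α', β', hα', hβ', hP', hk⟩ := hPL z hz (by linarith) s' hs' (by linarith)
    have hmem : z + s' • eLast n ∈ closedBall z s' := by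
      rw [mem_closedBall, dist_eq_norm, add_sub_cancel_left, norm_smul_eLast, abs_of_pos hs']
    have hmem' : z + (-s') • eLast n ∈ closedBall z s' := by
      rw [mem_closedBall, dist_eq_norm, add_sub_cancel_left, norm_smul_eLast, abs_neg,
        abs_of_pos hs']
    have h1 := hS.barrier_lower hsc hz hzρ hα hlow hs'.le (by linarith)
    have h2 := le_of_abs_le (hP'.up _ hmem (by rw [add_smul_eLast_last hz]; exact hs'.le))
    rw [add_smul_eLast_last hz, huz] at h2
    have h3 := hS.comp_refl.barrier_lower (α := -β) hsc hz hzρ (by rwa [abs_neg])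
      (fun x hx hx0 => by
        have hx' : refl n x ∈ closedBall x₀ s := by
          have := hsub hx
          rw [mem_closedBall, dist_eq_norm] at this ⊢
          rwa [← refl_of_last hx₀, norm_refl_sub]
        have := neg_le_of_abs_le (hP.down (refl n x) hx' (by rw [refl_last]; linarith))
        rw [hu, refl_last] at this; linarith) hs'.le (by linarith)
    rw [refl_add_smul hz] at h3
    have h4 := le_of_abs_le (hP'.down _ hmem' (by rw [add_smul_eLast_last hz]; linarith))
    rw [add_smul_eLast_last hz, huz] at h4
    rw [← hK] at h1 h3 hk
    have h5 : α - 5 * ((1 + K) * ε) ≤ α' := by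
      refine le_of_mul_le_mul_right (a := s') ?_ hs'
      have := mul_le_mul_of_nonneg_right hKε' hs'.le
      linarith
    have h6 : β' ≤ β + 5 * ((1 + K) * ε) := by
      refine le_of_mul_le_mul_right (a := s') ?_ hs'
      have := mul_le_mul_of_nonneg_right hKε' hs'.le
      linarith
    have h7 : |α' - α| ≤ 13 * ((1 + K) * ε) := by
      rw [abs_le]; constructor <;> linarith
    have h8 := hP'.up x hx hx0
    rw [huz] at h8
    have h9 : |(α' - α) * x (Fin.last n)| ≤ 13 * ((1 + K) * ε) * s' := by
      rw [abs_mul, abs_of_nonneg hx0]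
      exact mul_le_mul h7 hxd hx0 (by positivity)
    have h10 : u x - α * x (Fin.last n) =
      (u x - 0 - α' * x (Fin.last n)) + (α' - α) * x (Fin.last n) := by ring
    rw [h10]
    refine (abs_add_le _ _).trans ?_
    have := mul_le_mul_of_nonneg_right hKε' hs'.le
    linarith

lemma Flat.norm_gradient_sub_smul_le {x : Eucl n} {r δ α A : ℝ} (h : Flat u x r δ) (hr : 0 < r)
    (hδ : 0 ≤ δ) (hd : DifferentiableAt ℝ u x)
    (hA : ∀ v ∈ ball x r, |u v - α * v (Fin.last n)| ≤ A) :
    ‖gradient u x - α • eLast n‖ ≤ δ + 4 * A / r := by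
  set w := gradient u x - α • eLast n with hw
  have hx := mem_ball_self (x := x) hr
  have hA0 : 0 ≤ A := (abs_nonneg _).trans (hA x hx)
  by_cases hw0 : w = 0
  · rw [hw0, norm_zero]; positivity
  have hwp : 0 < ‖w‖ := norm_pos_iff.2 hw0
  set b : Eucl n := (r / 2 / ‖w‖) • w with hb
  have hbn : ‖b‖ = r / 2 := by
    rw [hb, norm_smul, Real.norm_of_nonneg (by positivity)]; field_simp
  have hx' : x + b ∈ ball x r := by
    rw [mem_ball, dist_eq_norm, add_sub_cancel_left, hbn]; linarith
  have h1 := h x hx hd x hx (x + b) hx'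
  rw [add_sub_cancel_left, hbn] at h1
  have h2 := hA x hx
  have h3 := hA _ hx'
  have h4 : ⟪gradient u x, b⟫_ℝ = r / 2 * ‖w‖ + α * b (Fin.last n) := by
    have : gradient u x = w + α • eLast n := by rw [hw]; abel
    rw [this, inner_add_left, real_inner_smul_left, real_inner_comm, real_inner_comm b, inner_eLast]
    conv_lhs => rw [hb, real_inner_smul_left, real_inner_self_eq_norm_sq]
    rw [← hb]
    field_simp
  rw [PiLp.add_apply] at h3
  rw [h4] at h1
  have h5 : r / 2 * ‖w‖ ≤ δ * (r / 2) + 2 * A := by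
    linarith [neg_le_of_abs_le h1, le_of_abs_le h2, neg_le_of_abs_le h2, le_of_abs_le h3]
  refine le_of_mul_le_mul_left (a := r / 2) (h5.trans (le_of_eq ?_)) (by positivity)
  field_simp
  ring

/-- Near a contact point the gradient from above is close to a multiple of the normal. -/
lemma Sol.gradient_near_contact (hS : Sol F F₀ ρ M lam Lam L u) {x₀ : Eucl n}
    (hx₀ : x₀ (Fin.last n) = 0) (hu : u x₀ = 0) (hρ : x₀ ∈ ball (0 : Eucl n) ρ) {δ : ℝ}
    (hδ : 0 < δ) : ∃ r > 0, ∃ α : ℝ, ∀ x ∈ ball x₀ r, 0 < x (Fin.last n) →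
      ‖gradient u x - α • eLast n‖ ≤ 4 * δ := by
  have hlam := hS.lam_pos
  obtain ⟨κ, hκ, hκ1, Hflat⟩ := exists_flat_radius n (Lam := Lam) (L := L) hlam hδ
  set K := Kc n lam Lam with hK
  have hK0 : 0 ≤ K := Kc_nonneg hS.lam_pos hS.Lam_nonneg
  set c := 4 / κ + 2 with hc
  have hc0 : 0 < c := by positivity
  obtain ⟨ε, hε, hεK, hεδ⟩ : ∃ ε > 0, 16 * ε * (1 + K) ≤ 1 ∧
      112 * (1 + K) * ε * c ≤ δ * κ := by
    obtain ⟨ε, ⟨h1, h2⟩, h3⟩ := ((eventually_mul_lt (16 * (1 + K)) one_pos).and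
      (eventually_mul_lt (112 * (1 + K) * c) (mul_pos hδ hκ))).and self_mem_nhdsWithin |>.exists
    exact ⟨ε, h3, by linarith, by linarith⟩
  obtain ⟨r₁, hr₁, α, H⟩ := hS.slope_stable hx₀ hu hρ hε hεK
  rw [mem_ball_zero_iff] at hρ
  have far : ∀ x zs : Eucl n, 0 < x (Fin.last n) → zs (Fin.last n) = 0 → u zs = 0 →
      ‖zs - x₀‖ ≤ r₁ → κ / 4 * ‖pr x - zs‖ ≤ x (Fin.last n) → c * x (Fin.last n) < r₁ →
      x (Fin.last n) ≤ 1 → ‖x‖ + x (Fin.last n) < ρ → ‖gradient u x - α • eLast n‖ ≤ 2 * δ := by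
    intro x zs hx0 hzs huz hzr hd hcr hx1 hxρ
    set y := x (Fin.last n) with hy
    have hlast : ∀ v ∈ closedBall x (y / 2), y / 2 ≤ v (Fin.last n) := by
      intro v hv
      rw [mem_closedBall, dist_eq_norm] at hv
      have := (neg_abs_le _).trans' (neg_le_neg ((abs_last_le (v - x)).trans hv))
      rw [PiLp.sub_apply] at this
      linarith
    have hfl := Hflat _ _ _ _ _ hS x (y / 2) (by positivity) (by linarith) (by linarith)
      fun v hv hv0 => by have := hlast v hv; linarith
    have hxz : ‖x - zs‖ ≤ y + 4 / κ * y := by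
      have h1 : x - zs = (x - pr x) + (pr x - zs) := by abel
      have h2 : ‖pr x - zs‖ ≤ 4 / κ * y := by
        rw [div_mul_eq_mul_div, le_div_iff₀ hκ]; linarith
      rw [h1]
      refine (norm_add_le _ _).trans ?_
      rw [norm_sub_pr, ← hy, abs_of_pos hx0]
      linarith
    have hκy : κ * (y / 2) ≤ y / 2 := by
      have := mul_le_mul_of_nonneg_right hκ1.le (by positivity : 0 ≤ y / 2)
      linarith
    have h1 := hfl.norm_gradient_sub_smul_le (α := α) (A := 14 * (1 + K) * ε * (c * y))
      (by positivity) hδ.le (hS.differentiableAt (by rw [mem_ball_zero_iff]; linarith)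
        fun h => absurd h hx0.ne') fun v hv => by
        have hv' : v ∈ closedBall x (y / 2) := by
          rw [mem_ball] at hv; rw [mem_closedBall]; linarith
        refine H zs hzs huz hzr (c * y) (by positivity) hcr v ?_ (by linarith [hlast v hv'])
        rw [mem_closedBall, dist_eq_norm] at hv' ⊢
        have : v - zs = (v - x) + (x - zs) := by abel
        rw [this]
        refine (norm_add_le _ _).trans ?_
        rw [hc]; linarith
    refine h1.trans ?_
    have : 4 * (14 * (1 + K) * ε * (c * y)) / (κ * (y / 2)) ≤ δ := by
      rw [div_le_iff₀ (by positivity)]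
      have := mul_le_mul_of_nonneg_right hεδ (by positivity : 0 ≤ y / 2)
      linarith
    linarith
  obtain ⟨r, hr, hr2, hcr, hr1, hrρ⟩ : ∃ r > 0, 2 * r ≤ r₁ ∧ c * r < r₁ ∧ r ≤ 1 ∧
      3 * r < ρ - ‖x₀‖ := by
    obtain ⟨s, ⟨⟨⟨h1, h2⟩, h3⟩, h4⟩, h5⟩ := ((((eventually_mul_lt 2 hr₁).and
      (eventually_mul_lt c hr₁)).and (eventually_mul_lt 1 one_pos)).and
      (eventually_mul_lt 3 (sub_pos.2 hρ))).and self_mem_nhdsWithin |>.exists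
    exact ⟨s, h5, h1.le, h2, by linarith, h4⟩
  refine ⟨r, hr, α, fun x hx hx0 => ?_⟩
  rw [mem_ball, dist_eq_norm] at hx
  have hxr : x (Fin.last n) ≤ r := by
    have := (le_abs_self _).trans (abs_last_le (x - x₀))
    rw [PiLp.sub_apply, hx₀, sub_zero] at this
    linarith
  set z := pr x with hz
  have hzl : z (Fin.last n) = 0 := pr_last x
  have hzr : ‖z - x₀‖ ≤ r := by
    have h1 : z - x₀ = pr (x - x₀) := by rw [pr_sub, pr_of_last hx₀]
    rw [h1]; exact (norm_pr_le _).trans hx.le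
  have hxz : ‖x - z‖ = x (Fin.last n) := by rw [hz, norm_sub_pr, abs_of_pos hx0]
  have hcl : IsClosed {v : Eucl n | v (Fin.last n) = 0 ∧ u v = 0} :=
    (isClosed_eq (by fun_prop) continuous_const).inter
      (isClosed_eq hS.toEll.isLip.continuous continuous_const)
  obtain ⟨zs, ⟨hzs, huzs⟩, hdist⟩ := hcl.exists_infDist_eq_dist ⟨x₀, hx₀, hu⟩ z
  set d := ‖z - zs‖ with hd
  have hmin : ∀ v : Eucl n, v (Fin.last n) = 0 → u v = 0 → d ≤ ‖z - v‖ := by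
    intro v hv huv
    rw [hd, ← dist_eq_norm, ← hdist, ← dist_eq_norm]
    exact infDist_le_dist_of_mem ⟨hv, huv⟩
  have hdr : d ≤ r := (hmin x₀ hx₀ hu).trans hzr
  have hzsr : ‖zs - x₀‖ ≤ r₁ := by
    have h1 : zs - x₀ = (z - x₀) - (z - zs) := by abel
    rw [h1]
    exact (norm_sub_le _ _).trans (by linarith)
  have hnz : ‖z‖ ≤ ‖x₀‖ + r := by
    have := norm_le_norm_add_norm_sub' z x₀
    linarith
  have hcxr : ∀ y, y ≤ r → c * y < r₁ := fun y hy =>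
    (mul_le_mul_of_nonneg_left hy hc0.le).trans_lt hcr
  rcases le_or_gt (κ / 4 * d) (x (Fin.last n)) with hcase | hcase
  · refine (far x zs hx0 hzs huzs hzsr hcase (hcxr _ hxr) (by linarith) ?_).trans (by linarith)
    have := norm_le_norm_add_norm_sub' x x₀
    linarith
  · have hd0 : 0 < d := by
      by_contra hc
      have := mul_nonpos_of_nonneg_of_nonpos (by positivity : 0 ≤ κ / 4) (not_lt.1 hc)
      linarith
    have hκd0 : 0 < κ * d := by positivity
    have hκd : κ * d ≤ d := by
      have := mul_le_mul_of_nonneg_right hκ1.le hd0.le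
      linarith
    have hzρ : ‖z‖ + d / 2 < ρ := by linarith
    have hfl := Hflat _ _ _ _ _ hS z (d / 2) (by positivity) (by linarith) hzρ fun v hv hv0 => by
      refine (hS.nonneg v (mem_of_closedBall hzρ hv) hv0).lt_of_ne fun h => ?_
      have := hmin v hv0 h.symm
      rw [mem_closedBall, dist_eq_norm, norm_sub_rev] at hv
      linarith
    set x₁ := z + (κ / 4 * d) • eLast n with hx₁
    have hx₁l : x₁ (Fin.last n) = κ / 4 * d := add_smul_eLast_last hzl _
    have hx₁z : ‖x₁ - z‖ = κ / 4 * d := by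
      rw [hx₁, add_sub_cancel_left, norm_smul_eLast, abs_of_pos (by positivity)]
    have hx₁pr : pr x₁ = z := by
      rw [pr, hx₁l, hx₁]; abel
    have hx₁n : ‖x₁‖ ≤ ‖z‖ + κ / 4 * d := by
      have := norm_le_norm_add_norm_sub' x₁ z
      linarith
    have hxn : ‖x‖ ≤ ‖x₀‖ + r := by
      have := norm_le_norm_add_norm_sub' x x₀
      linarith
    have h1 := far x₁ zs (by rw [hx₁l]; positivity) hzs huzs hzsr (by rw [hx₁pr, hx₁l])
      (by rw [hx₁l]; exact hcxr _ (by linarith)) (by rw [hx₁l]; linarith)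
      (by rw [hx₁l]; linarith)
    have h2 := hfl.norm_gradient_sub_le (y := x) (y' := x₁)
      (by rw [mem_ball, dist_eq_norm, hxz]; linarith)
      (by rw [mem_ball, dist_eq_norm, hx₁z]; linarith)
      (hS.differentiableAt (by rw [mem_ball_zero_iff]; linarith) fun h => absurd h hx0.ne')
      (hS.differentiableAt (by rw [mem_ball_zero_iff]; linarith) fun h => by
        rw [hx₁l] at h; linarith)
    have h3 : gradient u x - α • eLast n =
        (gradient u x - gradient u x₁) + (gradient u x₁ - α • eLast n) := by abel
    rw [h3]
    exact (norm_add_le _ _).trans (by linarith)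

lemma nhdsWithin_upper_neBot {x₀ : Eucl n} (hx₀ : x₀ (Fin.last n) = 0) :
    (𝓝[{x : Eucl n | 0 < x (Fin.last n)}] x₀).NeBot := by
  refine mem_closure_iff_nhdsWithin_neBot.1 (Metric.mem_closure_iff.2 fun ε hε => ?_)
  refine ⟨x₀ + (ε / 2) • eLast n, ?_, ?_⟩
  · show 0 < (x₀ + (ε / 2) • eLast n) (Fin.last n)
    rw [add_smul_eLast_last hx₀]; positivity
  · rw [dist_comm, dist_eq_norm, add_sub_cancel_left, norm_smul_eLast, abs_of_pos (by positivity)]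
    linarith

/-- The gradient has a limit from above at every point of the thin hyperplane. -/
lemma Sol.exists_tendsto_gradient (hS : Sol F F₀ ρ M lam Lam L u) {x₀ : Eucl n}
    (hx₀ : x₀ (Fin.last n) = 0) (hρ : x₀ ∈ ball (0 : Eucl n) ρ) :
    ∃ G, Tendsto (gradient u) (𝓝[{x | 0 < x (Fin.last n)}] x₀) (𝓝 G) := by
  rcases (hS.nonneg x₀ hρ hx₀).eq_or_lt with h | h
  · refine exists_tendsto_of_osc (nhdsWithin_upper_neBot hx₀) fun δ hδ => ?_
    obtain ⟨r, hr, α, H⟩ := hS.gradient_near_contact hx₀ h.symm hρ (δ := δ / 8) (by positivity)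
    refine ⟨r, hr, fun y hy y' hy' => ?_⟩
    have h1 := H y hy.2 hy.1
    have h2 := H y' hy'.2 hy'.1
    have h3 : gradient u y - gradient u y' =
      (gradient u y - α • eLast n) - (gradient u y' - α • eLast n) := by abel
    rw [h3]
    exact (norm_sub_le _ _).trans (by linarith)
  · exact ⟨_, (hS.continuousAt_gradient hρ fun _ => h).tendsto.mono_left nhdsWithin_le_nhds⟩

/-! ### Localisation of the nonlinearities -/

lemma norm_le_sum_abs (v : Eucl n) : ‖v‖ ≤ ∑ i, |v i| := by
  conv_lhs => rw [← (EuclideanSpace.basisFun (Fin (n + 1)) ℝ).sum_repr v]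
  refine (norm_sum_le _ _).trans (Finset.sum_le_sum fun i _ => ?_)
  rw [norm_smul, (EuclideanSpace.basisFun (Fin (n + 1)) ℝ).orthonormal.1 i, mul_one]
  simp

lemma exists_lipschitz_extension {E : Type*} [NormedAddCommGroup E] [NormedSpace ℝ E]
    {f : E → ℝ} {U K : Set E} (hU : IsOpen U) (hK : IsCompact K) (hKU : K ⊆ U)
    (hf : ContDiffOn ℝ 1 f U) :
    ∃ (g : E → ℝ) (C : ℝ≥0) (B : ℝ), LipschitzWith C g ∧ (∀ x, |g x| ≤ B) ∧ ∀ x ∈ K, g x = f x := by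
  have hloc : LocallyLipschitzOn K f := by
    intro x hx
    obtain ⟨C, t, ht, hC⟩ := (hf.contDiffAt (hU.mem_nhds (hKU hx))).exists_lipschitzOnWith
    exact ⟨C, t, mem_nhdsWithin_of_mem_nhds ht, hC⟩
  obtain ⟨C, hC⟩ := hloc.exists_lipschitzOnWith_of_compact hK
  obtain ⟨B, hB⟩ := hK.exists_bound_of_continuousOn (hf.continuousOn.mono hKU)
  obtain ⟨g, hg, hgf⟩ := hC.extend_real
  refine ⟨fun x => max (-|B|) (min |B| (g x)), C, |B|, (hg.const_min _).const_max _, fun x => ?_,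
    fun x hx => ?_⟩
  · have := abs_nonneg B
    rw [abs_le]
    exact ⟨le_max_left _ _, max_le (by linarith) (min_le_left _ _)⟩
  · have h1 := (hB x hx).trans (le_abs_self B)
    rw [Real.norm_eq_abs, abs_le] at h1
    have h2 : g x = f x := (hgf hx).symm
    simp only [h2]
    rw [min_eq_right h1.2, max_eq_right h1.1]

lemma exists_lipschitz_extension_vec {E : Type*} [NormedAddCommGroup E] [NormedSpace ℝ E]
    {f : E → Eucl n} {U K : Set E} (hU : IsOpen U) (hK : IsCompact K) (hKU : K ⊆ U)
    (hf : ContDiffOn ℝ 1 f U) :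
    ∃ (g : E → Eucl n) (C B : ℝ), 0 ≤ C ∧ (∀ x y, ‖g x - g y‖ ≤ C * ‖x - y‖) ∧ (∀ x, ‖g x‖ ≤ B) ∧
      ∀ x ∈ K, g x = f x := by
  have hi : ∀ i, ContDiffOn ℝ 1 (fun x => f x i) U := fun i =>
    (contDiffOn_euclidean.1 hf) i
  choose g C B hg hB hgf using fun i => exists_lipschitz_extension hU hK hKU (hi i)
  refine ⟨fun x => WithLp.toLp 2 fun i => g i x, ∑ i, (C i : ℝ), ∑ i, B i, by positivity,
    ?_, ?_, ?_⟩
  · intro x y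
    refine (norm_le_sum_abs _).trans ?_
    rw [Finset.sum_mul]
    refine Finset.sum_le_sum fun i _ => ?_
    have := (hg i).dist_le_mul x y
    rwa [Real.dist_eq, dist_eq_norm] at this
  · intro x
    exact (norm_le_sum_abs _).trans (Finset.sum_le_sum fun i _ => hB i x)
  · intro x hx
    ext i
    exact hgf i x hx

lemma inner_sub_ge_of_fderiv {V : Type*} [NormedAddCommGroup V] [InnerProductSpace ℝ V]
    {G : V → V} {M lam : ℝ} (hd : Differentiable ℝ G)
    (h : ∀ p, ‖p‖ ≤ M → ∀ ξ, lam * ‖ξ‖ ^ 2 ≤ ⟪fderiv ℝ G p ξ, ξ⟫_ℝ) {p q : V} (hp : ‖p‖ ≤ M)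
    (hq : ‖q‖ ≤ M) : lam * ‖p - q‖ ^ 2 ≤ ⟪G p - G q, p - q⟫_ℝ := by
  have hD : ∀ t : ℝ, HasDerivAt (fun t : ℝ => ⟪G (q + t • (p - q)), p - q⟫_ℝ)
      ⟪fderiv ℝ G (q + t • (p - q)) (p - q), p - q⟫_ℝ t := by
    intro t
    have h1 : HasDerivAt (fun t : ℝ => q + t • (p - q)) (p - q) t := by
      simpa using ((hasDerivAt_id t).smul_const (p - q)).const_add q
    have h2 := (hd (q + t • (p - q))).hasFDerivAt.comp_hasDerivAt t h1
    simpa using h2.inner ℝ (hasDerivAt_const t (p - q))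
  obtain ⟨c, hc, hc'⟩ := exists_hasDerivAt_eq_slope _ _ (zero_lt_one' ℝ)
    (fun t _ => (hD t).continuousAt.continuousWithinAt) fun t _ => hD t
  have hmem : ‖q + c • (p - q)‖ ≤ M := by
    have := (convex_closedBall (0 : V) M).add_smul_sub_mem (x := q) (y := p)
      (by simpa using hq) (by simpa using hp) ⟨hc.1.le, hc.2.le⟩
    simpa using this
  have h3 := h _ hmem (p - q)
  rw [hc'] at h3
  simpa [inner_sub_left] using h3

lemma norm_mk_sub_mk_le {V W : Type*} [SeminormedAddCommGroup V] [SeminormedAddCommGroup W]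
    (x x' : V) (z z' : ℝ) (p p' : W) :
    ‖(x, z, p) - (x', z', p')‖ ≤ ‖x - x'‖ + |z - z'| + ‖p - p'‖ := by
  rw [Prod.mk_sub_mk, Prod.mk_sub_mk, Prod.norm_mk, Prod.norm_mk, Real.norm_eq_abs]
  have h1 := norm_nonneg (x - x')
  have h2 := abs_nonneg (z - z')
  have h3 := norm_nonneg (p - p')
  exact max_le (by linarith) (max_le (by linarith) (by linarith))

/-- The set on which the nonlinearities are only ever evaluated. -/
def locSet (n : ℕ) (ρ M : ℝ) : Set (Eucl n × ℝ × Eucl n) :=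
  closedBall (0 : Eucl n) ρ ×ˢ closedBall (0 : ℝ) M ×ˢ closedBall (0 : Eucl n) M

lemma mem_locSet {x : Eucl n} (hx : x ∈ ball (0 : Eucl n) ρ) {z : ℝ} (hz : |z| ≤ M)
    {p : Eucl n} (hp : ‖p‖ ≤ M) : (x, z, p) ∈ locSet n ρ M :=
  ⟨ball_subset_closedBall hx, by simpa using hz, by simpa using hp⟩

lemma isCompact_locSet : IsCompact (locSet n ρ M) :=
  (isCompact_closedBall _ _).prod ((isCompact_closedBall _ _).prod (isCompact_closedBall _ _))

lemma locSet_subset (hρ : ρ < 1) : locSet n ρ M ⊆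
    ball (0 : Eucl n) 1 ×ˢ (Set.univ : Set ℝ) ×ˢ (Set.univ : Set (Eucl n)) := fun _ hq =>
  ⟨closedBall_subset_ball hρ hq.1, Set.mem_univ _, Set.mem_univ _⟩

lemma H0.exists_vec (hF : H0 F F₀) (hρ : ρ < 1) :
    ∃ (G : Eucl n → ℝ → Eucl n → Eucl n) (C : ℝ), 0 ≤ C ∧
      (∀ x x' z z' p p', ‖G x z p - G x' z' p'‖ ≤ C * (‖x - x'‖ + |z - z'| + ‖p - p'‖)) ∧
      (∀ x z p, ‖G x z p‖ ≤ C) ∧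
      ∀ x ∈ ball (0 : Eucl n) ρ, ∀ z : ℝ, |z| ≤ M → ∀ p : Eucl n, ‖p‖ ≤ M → G x z p = F x z p := by
  obtain ⟨G, C, B, hC0, hGL, hGB, hGF⟩ := exists_lipschitz_extension_vec
    (isOpen_ball.prod (isOpen_univ.prod isOpen_univ)) isCompact_locSet (locSet_subset (M := M) hρ)
    hF.1
  have hB0 : 0 ≤ B := (norm_nonneg _).trans (hGB 0)
  refine ⟨fun x z p => G (x, z, p), C + B, by positivity, fun x x' z z' p p' => ?_,
    fun x z p => (hGB _).trans (by linarith), fun x hx z hz p hp => hGF _ (mem_locSet hx hz hp)⟩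
  exact (hGL _ _).trans (mul_le_mul (by linarith) (norm_mk_sub_mk_le x x' z z' p p')
    (norm_nonneg _) (by positivity))

lemma H0.exists_scalar (hF : H0 F F₀) (hρ : ρ < 1) :
    ∃ (G : Eucl n → ℝ → Eucl n → ℝ) (C : ℝ), 0 ≤ C ∧
      (∀ x x' z z' p p', |G x z p - G x' z' p'| ≤ C * (‖x - x'‖ + |z - z'| + ‖p - p'‖)) ∧
      (∀ x z p, |G x z p| ≤ C) ∧
      ∀ x ∈ ball (0 : Eucl n) ρ, ∀ z : ℝ, |z| ≤ M → ∀ p : Eucl n, ‖p‖ ≤ M → G x z p = F₀ x z p := by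
  obtain ⟨G, C, B, hGL, hGB, hGF⟩ := exists_lipschitz_extension
    (isOpen_ball.prod (isOpen_univ.prod isOpen_univ)) isCompact_locSet (locSet_subset (M := M) hρ)
    hF.2
  have hB0 : 0 ≤ B := (abs_nonneg _).trans (hGB 0)
  have hC0 : (0 : ℝ) ≤ C := C.2
  refine ⟨fun x z p => G (x, z, p), C + B, by positivity, fun x x' z z' p p' => ?_,
    fun x z p => (hGB _).trans (by linarith), fun x hx z hz p hp => hGF _ (mem_locSet hx hz hp)⟩
  have h1 := hGL.dist_le_mul (x, z, p) (x', z', p')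
  rw [Real.dist_eq, dist_eq_norm] at h1
  exact h1.trans (mul_le_mul (by linarith) (norm_mk_sub_mk_le x x' z z' p p')
    (norm_nonneg _) (by positivity))

lemma H0.differentiable (hF : H0 F F₀) {x : Eucl n} (hx : x ∈ ball (0 : Eucl n) 1) (z : ℝ) :
    Differentiable ℝ (F x z) := fun p => by
  have hU : ball (0 : Eucl n) 1 ×ˢ (Set.univ : Set ℝ) ×ˢ (Set.univ : Set (Eucl n)) ∈ 𝓝 (x, z, p) :=
    (isOpen_ball.prod (isOpen_univ.prod isOpen_univ)).mem_nhds ⟨hx, Set.mem_univ _, Set.mem_univ _⟩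
  have h1 := (hF.1.contDiffAt hU).differentiableAt one_ne_zero
  have h2 : DifferentiableAt ℝ (fun p : Eucl n => (x, z, p)) p := by fun_prop
  exact h1.comp (f := fun p : Eucl n => (x, z, p)) p h2

/-- On smaller balls the nonlinearities can be replaced by globally Lipschitz bounded ones. -/
lemma H0.exists_ell {v : Eucl n → ℝ} (hF : H0 F F₀) (hell : H1 F) (hρ : ρ < 1) (hM : 0 < M)
    (hL0 : 0 ≤ L) (hLM : L + 3 ≤ M) (hlip : ∀ x y, |v x - v y| ≤ L * ‖x - y‖)
    (hbd : ∀ x ∈ ball (0 : Eucl n) ρ, |v x| ≤ M - 1) :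
    ∃ (G : Eucl n → ℝ → Eucl n → Eucl n) (G₀ : Eucl n → ℝ → Eucl n → ℝ) (lam Lam : ℝ),
      Ell G G₀ ρ M lam Lam L v ∧
      ∀ x ∈ ball (0 : Eucl n) ρ, ∀ z : ℝ, |z| ≤ M → ∀ p : Eucl n, ‖p‖ ≤ M →
        G x z p = F x z p ∧ G₀ x z p = F₀ x z p := by
  obtain ⟨lam, hlam, hmono⟩ := hell M hM
  obtain ⟨G, C, hC0, hGL, hGB, hGF⟩ := hF.exists_vec (M := M) hρ
  obtain ⟨G₀, C₀, hC₀0, hG₀L, hG₀B, hG₀F⟩ := hF.exists_scalar (M := M) hρ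
  have hnn : ∀ (x x' : Eucl n) (z z' : ℝ) (p p' : Eucl n),
      0 ≤ ‖x - x'‖ + |z - z'| + ‖p - p'‖ := fun _ _ _ _ _ _ => by positivity
  refine ⟨G, G₀, lam, C + C₀, ⟨hlam, by positivity, hL0, hLM, ?_, ?_, ?_, ?_, ?_, hlip, hbd⟩,
    fun x hx z hz p hp => ⟨hGF x hx z hz p hp, hG₀F x hx z hz p hp⟩⟩
  · exact fun x x' z z' p p' => (hGL x x' z z' p p').trans
      (mul_le_mul_of_nonneg_right (by linarith) (hnn x x' z z' p p'))
  · exact fun x x' z z' p p' => (hG₀L x x' z z' p p').trans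
      (mul_le_mul_of_nonneg_right (by linarith) (hnn x x' z z' p p'))
  · exact fun x z p => (hGB x z p).trans (by linarith)
  · exact fun x z p => (hG₀B x z p).trans (by linarith)
  · intro x hx z hz p q hp hq
    have hx1 : x ∈ ball (0 : Eucl n) 1 := ball_subset_ball hρ.le hx
    rw [hGF x hx z hz p hp, hGF x hx z hz q hq]
    exact inner_sub_ge_of_fderiv (hF.differentiable hx1 z) (hmono x hx1 z hz) hp hq

lemma AdmissibleThin.add_mul {g φ : Eucl n → ℝ} {x₀ : Eucl n} {r ε : ℝ} (hu : AdmissibleThin g u)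
    (hφ : IsLip φ) (h0 : ∀ x ∉ closedBall x₀ r, φ x = 0) (hr : ‖x₀‖ + r < 1) (hε : 0 < ε)
    (hpos : ∀ x ∈ closedBall x₀ r, x (Fin.last n) = 0 → 0 ≤ u x + ε * φ x) :
    AdmissibleThin g fun x => u x + ε * φ x := by
  obtain ⟨⟨L, hL⟩, hug, hu0⟩ := hu
  obtain ⟨Cφ, hCφ⟩ := hφ
  refine ⟨⟨L + ε.toNNReal * Cφ, ?_⟩, fun x hx => ?_, fun x hx => ?_⟩
  · refine LipschitzOnWith.of_dist_le_mul fun x hx y hy => ?_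
    have h1 := hL.dist_le_mul x hx y hy
    have h2 := mul_le_mul_of_nonneg_left (hCφ.dist_le_mul x y) hε.le
    rw [Real.dist_eq] at h1 h2 ⊢
    have h3 : u x + ε * φ x - (u y + ε * φ y) = (u x - u y) + ε * (φ x - φ y) := by ring
    rw [h3]
    refine (abs_add_le _ _).trans ?_
    rw [abs_mul, abs_of_pos hε]
    push_cast
    rw [Real.coe_toNNReal _ hε.le]
    linarith
  · have h1 : φ x = 0 := h0 x fun h => by
      have := mem_ball_zero_iff.1 (Sol.mem_of_closedBall hr h)
      rw [mem_sphere_zero_iff_norm] at hx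
      linarith
    simp only [h1, mul_zero, add_zero, hug x hx]
  · by_cases h : x ∈ closedBall x₀ r
    · exact hpos x h hx.2
    · simp only [h0 x h, mul_zero, add_zero, hu0 x hx]

/-- The variational inequality for perturbations supported in a smaller ball. -/
lemma ThinSolution.En_nonneg {g v φ : Eucl n → ℝ} {x₀ : Eucl n} {r ε : ℝ}
    {G : Eucl n → ℝ → Eucl n → Eucl n} {G₀ : Eucl n → ℝ → Eucl n → ℝ}
    (hu : ThinSolution F F₀ g u) (hρ : ρ < 1) (hE : Ell G G₀ ρ M lam Lam L v)
    (hv : ∀ x ∈ closedBall (0 : Eucl n) 1, u x = v x)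
    (hG : ∀ x ∈ ball (0 : Eucl n) ρ, ∀ z : ℝ, |z| ≤ M → ∀ p : Eucl n, ‖p‖ ≤ M →
        G x z p = F x z p ∧ G₀ x z p = F₀ x z p)
    (hφ : IsLip φ) (h0 : ∀ x ∉ closedBall x₀ r, φ x = 0) (hr : ‖x₀‖ + r < ρ) (hε : 0 < ε)
    (hpos : ∀ x ∈ closedBall x₀ r, x (Fin.last n) = 0 → 0 ≤ v x + ε * φ x) :
    0 ≤ En G G₀ v φ := by
  have hmem : ∀ x ∈ closedBall x₀ r, x ∈ ball (0 : Eucl n) ρ := fun x hx =>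
    Sol.mem_of_closedBall hr hx
  have hmem1 : ∀ x ∈ closedBall x₀ r, x ∈ ball (0 : Eucl n) 1 := fun x hx =>
    ball_subset_ball hρ.le (hmem x hx)
  have hz : ∀ x ∉ closedBall x₀ r, gradient φ x = 0 := fun x h =>
    gradient_eq_zero_of_notMem isClosed_closedBall h0 h
  have hadm : AdmissibleThin g fun x => u x + ε * φ x :=
    hu.1.add_mul hφ h0 (hr.trans hρ) hε fun x hx hx0 => by
      rw [hv x (ball_subset_closedBall (hmem1 x hx))]
      exact hpos x hx hx0
  have key := hu.2 _ hadm
  have hgrad : ∀ x ∈ ball (0 : Eucl n) 1, gradient u x = gradient v x := by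
    intro x hx
    refine gradient_congr ?_
    filter_upwards [isOpen_ball.mem_nhds hx] with y hy using hv y (ball_subset_closedBall hy)
  have hgrad' : ∀ x ∈ ball (0 : Eucl n) 1, DifferentiableAt ℝ v x → DifferentiableAt ℝ φ x →
      gradient (fun x => u x + ε * φ x) x = gradient v x + ε • gradient φ x := by
    intro x hx hxv hxφ
    rw [gradient_congr (g := fun x => v x + ε * φ x), gradient_add hxv (hxφ.const_mul ε),
      gradient_const_mul hxφ]
    filter_upwards [isOpen_ball.mem_nhds hx] with y hy
    rw [hv y (ball_subset_closedBall hy)]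
  have heq : (∫ x in ball (0 : Eucl n) 1,
      (⟪F x (u x) (gradient u x), gradient (fun x => u x + ε * φ x) x - gradient u x⟫_ℝ +
        F₀ x (u x) (gradient u x) * (u x + ε * φ x - u x))) =
      ∫ x in ball (0 : Eucl n) 1, ε * (⟪G x (v x) (gradient v x), gradient φ x⟫_ℝ +
        G₀ x (v x) (gradient v x) * φ x) := by
    refine setIntegral_congr_ae measurableSet_ball ?_
    filter_upwards [hE.isLip.ae_differentiableAt, hφ.ae_differentiableAt] with x hxu hxφ hx
    rw [hgrad' x hx hxu hxφ, hgrad x hx, hv x (ball_subset_closedBall hx), add_sub_cancel_left,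
      add_sub_cancel_left, real_inner_smul_right]
    by_cases h : x ∈ closedBall x₀ r
    · have hL := hE.L_le
      obtain ⟨h1, h2⟩ := hG x (hmem x h) (v x) ((hE.u_bd x (hmem x h)).trans (by linarith))
        (gradient v x) ((hE.grad_le x).trans (by linarith))
      rw [h1, h2]
      ring
    · rw [h0 x h, hz x h]
      simp
  rw [heq, setIntegral_of_support, integral_const_mul] at key
  · exact nonneg_of_mul_nonneg_right key hε
  · intro x hx
    have h : x ∉ closedBall x₀ r := fun h => hx (hmem1 x h)
    rw [h0 x h, hz x h]
    simp

/-- The thin obstacle problem satisfies the localised structure conditions on smaller balls. -/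
lemma ThinSolution.exists_sol {g : Eucl n → ℝ} (hF : H0 F F₀) (hell : H1 F)
    (hu : ThinSolution F F₀ g u) (hρ : ρ < 1) :
    ∃ (F' : Eucl n → ℝ → Eucl n → Eucl n) (F₀' : Eucl n → ℝ → Eucl n → ℝ) (M lam Lam L : ℝ)
      (u' : Eucl n → ℝ), Sol F' F₀' ρ M lam Lam L u' ∧
        ∀ x ∈ closedBall (0 : Eucl n) 1, u' x = u x := by
  obtain ⟨L, hL⟩ := hu.1.1
  obtain ⟨v, hvL, hv⟩ := hL.extend_real
  have hlip : ∀ x y, |v x - v y| ≤ L * ‖x - y‖ := fun x y => by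
    have := hvL.dist_le_mul x y
    rwa [Real.dist_eq, dist_eq_norm] at this
  have hL0 : (0 : ℝ) ≤ L := L.2
  have hbd : ∀ x ∈ ball (0 : Eucl n) ρ, |v x| ≤ L + |v 0| + 4 - 1 := by
    intro x hx
    rw [mem_ball_zero_iff] at hx
    have h1 := hlip x 0
    rw [sub_zero] at h1
    have h2 := mul_le_mul_of_nonneg_left (hx.le.trans hρ.le) hL0
    have h3 : |v x| ≤ |v x - v 0| + |v 0| := by
      have := abs_add_le (v x - v 0) (v 0)
      rwa [sub_add_cancel] at this
    linarith
  obtain ⟨G, G₀, lam, Lam, hE, hG⟩ := hF.exists_ell hell hρ (M := L + |v 0| + 4) (by positivity)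
    hL0 (by linarith [abs_nonneg (v 0)]) hlip hbd
  refine ⟨G, G₀, _, lam, Lam, L, v, ⟨hE, fun x hx hx0 => ?_, fun φ x₀ r ε hφ h0 hr hε hpos => ?_⟩,
    fun x hx => (hv hx).symm⟩
  · have hx1 := ball_subset_ball hρ.le hx
    rw [← hv (ball_subset_closedBall hx1)]
    exact hu.1.2.2 x ⟨hx1, hx0⟩
  · exact hu.En_nonneg hρ hE (fun x hx => hv hx) hG hφ h0 hr hε hpos

/-! ### Conclusion -/

/-- The function is locally, in the unit ball, a solution with globalised data. -/
def LocSol (u : Eucl n → ℝ) : Prop :=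
  ∀ ρ, 0 < ρ → ρ < 1 → ∃ (F : Eucl n → ℝ → Eucl n → Eucl n) (F₀ : Eucl n → ℝ → Eucl n → ℝ)
    (M lam Lam L : ℝ) (v : Eucl n → ℝ), Sol F F₀ ρ M lam Lam L v ∧
      ∀ x ∈ closedBall (0 : Eucl n) 1, v x = u x

lemma LocSol.comp_refl (h : LocSol u) : LocSol fun x => u (refl n x) := by
  intro ρ hρ0 hρ
  obtain ⟨F, F₀, M, lam, Lam, L, v, hS, hv⟩ := h ρ hρ0 hρ
  refine ⟨_, _, M, lam, Lam, L, _, hS.comp_refl, fun x hx => hv _ ?_⟩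
  simpa using hx

lemma LocSol.upper (h : LocSol u) :
    ∃ Gp : Eucl n → Eucl n,
      ContinuousOn Gp (hBall (0 : Eucl n) 1 ∪ tBall (0 : Eucl n) 1) ∧
      ∀ x ∈ hBall (0 : Eucl n) 1, HasGradientAt u (Gp x) x := by
  have loc : ∀ x ∈ ball (0 : Eucl n) 1, ∃ (F : Eucl n → ℝ → Eucl n → Eucl n)
      (F₀ : Eucl n → ℝ → Eucl n → ℝ) (ρ M lam Lam L : ℝ) (v : Eucl n → ℝ),
      Sol F F₀ ρ M lam Lam L v ∧ x ∈ ball (0 : Eucl n) ρ ∧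
      ∀ y ∈ ball (0 : Eucl n) 1, v =ᶠ[𝓝 y] u := by
    intro x hx
    rw [mem_ball_zero_iff] at hx
    obtain ⟨ρ, h1, h2⟩ := exists_between hx
    obtain ⟨F, F₀, M, lam, Lam, L, v, hS, hv⟩ := h ρ ((norm_nonneg _).trans_lt h1) h2
    refine ⟨F, F₀, ρ, M, lam, Lam, L, v, hS, by rwa [mem_ball_zero_iff], fun y hy => ?_⟩
    filter_upwards [isOpen_ball.mem_nhds hy] with w hw using hv w (ball_subset_closedBall hw)
  have hgr : ∀ {v : Eucl n → ℝ}, (∀ y ∈ ball (0 : Eucl n) 1, v =ᶠ[𝓝 y] u) →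
      ∀ x ∈ ball (0 : Eucl n) 1,
      gradient v =ᶠ[𝓝 x] gradient u := by
    intro v hv x hx
    filter_upwards [isOpen_ball.mem_nhds hx] with y hy using gradient_congr (hv y hy)
  have hcont : ∀ x ∈ hBall (0 : Eucl n) 1, ContinuousAt (gradient u) x := by
    intro x hx
    obtain ⟨F, F₀, ρ, M, lam, Lam, L, v, hS, hxρ, hv⟩ := loc x hx.1
    have hx0 : 0 < x (Fin.last n) := hx.2
    exact (hS.continuousAt_gradient hxρ fun h => absurd h hx0.ne').congr (hgr hv x hx.1)
  have hcl : hBall (0 : Eucl n) 1 ∪ tBall (0 : Eucl n) 1 ⊆ closure (hBall (0 : Eucl n) 1) := by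
    rintro x (hx | hx)
    · exact subset_closure hx
    · have h1 := nhdsWithin_upper_neBot (x₀ := x) hx.2
      rw [mem_closure_iff_nhdsWithin_neBot, hBall, Set.inter_comm,
        nhdsWithin_inter_of_mem' (mem_nhdsWithin_of_mem_nhds (isOpen_ball.mem_nhds hx.1))]
      exact h1
  refine ⟨extendFrom (hBall (0 : Eucl n) 1) (gradient u), continuousOn_extendFrom hcl ?_, ?_⟩
  · rintro x (hx | hx)
    · exact ⟨_, (hcont x hx).tendsto.mono_left nhdsWithin_le_nhds⟩
    · obtain ⟨F, F₀, ρ, M, lam, Lam, L, v, hS, hxρ, hv⟩ := loc x hx.1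
      obtain ⟨G, hG⟩ := hS.exists_tendsto_gradient hx.2 hxρ
      refine ⟨G, (hG.congr' ((hgr hv x hx.1).filter_mono nhdsWithin_le_nhds)).mono_left
        (nhdsWithin_mono _ Set.inter_subset_right)⟩
  · intro x hx
    rw [extendFrom_eq (subset_closure hx) ((hcont x hx).tendsto.mono_left nhdsWithin_le_nhds)]
    obtain ⟨F, F₀, ρ, M, lam, Lam, L, v, hS, hxρ, hv⟩ := loc x hx.1
    have hx0 : 0 < x (Fin.last n) := hx.2
    exact ((hS.differentiableAt hxρ fun h => absurd h hx0.ne').congr_of_eventuallyEq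
      (hv x hx.1).symm).hasGradientAt

lemma LocSol.lower (h : LocSol u) :
    ∃ Gm : Eucl n → Eucl n,
      ContinuousOn Gm (hBallNeg (0 : Eucl n) 1 ∪ tBall (0 : Eucl n) 1) ∧
      ∀ x ∈ hBallNeg (0 : Eucl n) 1, HasGradientAt u (Gm x) x := by
  obtain ⟨G, hG, hGd⟩ := h.comp_refl.upper
  have hball : ∀ x ∈ ball (0 : Eucl n) 1, refl n x ∈ ball (0 : Eucl n) 1 := fun x hx => by
    simpa using hx
  have hneg : ∀ x ∈ hBallNeg (0 : Eucl n) 1, refl n x ∈ hBall (0 : Eucl n) 1 := fun x hx =>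
    ⟨hball x hx.1, by
      have : x (Fin.last n) < 0 := hx.2
      show 0 < refl n x (Fin.last n)
      rw [refl_last]; linarith⟩
  refine ⟨fun x => refl n (G (refl n x)), ?_, fun x hx => ?_⟩
  · refine (refl n).continuous.comp_continuousOn (hG.comp (refl n).continuous.continuousOn ?_)
    rintro x (hx | hx)
    · exact Or.inl (hneg x hx)
    · refine Or.inr ⟨hball x hx.1, ?_⟩
      have : x (Fin.last n) = 0 := hx.2
      show refl n x (Fin.last n) = 0
      rw [refl_last, this, neg_zero]
  · have h1 := hGd _ (hneg x hx)
    have h2 : DifferentiableAt ℝ (fun y => (fun y => u (refl n y)) (refl n y)) x :=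
      h1.differentiableAt.comp x (refl n).differentiableAt
    have h3 := h2.hasGradientAt
    rw [gradient_comp_refl (fun y => u (refl n y)), h1.gradient] at h3
    simpa only [refl_refl] using h3

end TOP

open TOP in
/-- One-sided `C¹` regularity for Lipschitz solutions of the thin
obstacle problem: the gradient of `u` extends continuously from each open half ball
`B₁⁺`, `B₁⁻` up to the thin obstacle `B₁'`. -/
theorem thin_obstacle_C1_regularity {n : ℕ} (hn : 1 ≤ n)
    (F : Eucl n → ℝ → Eucl n → Eucl n) (F₀ : Eucl n → ℝ → Eucl n → ℝ)
    (g u : Eucl n → ℝ)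
    (hF : H0 F F₀) (hell : H1 F)
    (hu : ThinSolution F F₀ g u) :
    (∃ Gp : Eucl n → Eucl n,
        ContinuousOn Gp (hBall (0 : Eucl n) 1 ∪ tBall (0 : Eucl n) 1) ∧
        ∀ x ∈ hBall (0 : Eucl n) 1, HasGradientAt u (Gp x) x) ∧
    (∃ Gm : Eucl n → Eucl n,
        ContinuousOn Gm (hBallNeg (0 : Eucl n) 1 ∪ tBall (0 : Eucl n) 1) ∧
        ∀ x ∈ hBallNeg (0 : Eucl n) 1, HasGradientAt u (Gm x) x) := by
  refine ⟨LocSol.upper fun _ _ h => hu.exists_sol hF hell h,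
    LocSol.lower fun _ _ h => hu.exists_sol hF hell h⟩
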